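/- Suppose Assumptions (A1) and (A2) hold and fix ε > 0. Let Λ = { λ ∈ [0,1] : there exists a classical solution (u_λ, m_λ) with m_λ > 0 of the discounted MFG system with potential λV, i.e. ε u_λ + (1/2)|Du_λ|² + λV = g(m_λ) and ε m_λ − div(m_λ Du_λ) = ε on T^d }. Then Λ is relatively closed in [0,1]: if λ_n ∈ Λ and λ_n → λ ∈ [0,1], then λ ∈ Λ. -/

import Mathlib

open MeasureTheory Set

noncomputable def pd (d : ℕ) (i : Fin d) (f : (Fin d → ℝ) → ℝ) : (Fin d → ℝ) → ℝ :=
  fun x => fderiv ℝ f x (Pi.single i 1)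

noncomputable def gradSq (d : ℕ) (u : (Fin d → ℝ) → ℝ) (x : Fin d → ℝ) : ℝ :=
  ∑ i, pd d i u x ^ 2

noncomputable def divUp (d : ℕ) (m u : (Fin d → ℝ) → ℝ) (x : Fin d → ℝ) : ℝ :=
  ∑ i, pd d i (fun y => m y * pd d i u y) x

/-- `f` is `ℤ^d`-periodic, i.e. a function on the flat torus `T^d`. -/
def ZPer (d : ℕ) (f : (Fin d → ℝ) → ℝ) : Prop :=
  ∀ (x : Fin d → ℝ) (k : Fin d → ℤ), f (x + fun i => (k i : ℝ)) = f x

/-- `f` has finite `α`-Hölder seminorm. -/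
def HolderSemi (α : ℝ) {E : Type*} [PseudoMetricSpace E] (f : E → ℝ) : Prop :=
  ∃ C : ℝ, 0 ≤ C ∧ ∀ x y, |f x - f y| ≤ C * dist x y ^ α

/-- `f` is of class `C^{1,α}`. -/
def C1Hold (d : ℕ) (α : ℝ) (f : (Fin d → ℝ) → ℝ) : Prop :=
  ContDiff ℝ 1 f ∧ ∀ i, HolderSemi α (pd d i f)

/-- `f` is of class `C^{2,α}`. -/
def C2Hold (d : ℕ) (α : ℝ) (f : (Fin d → ℝ) → ℝ) : Prop :=
  ContDiff ℝ 2 f ∧ ∀ i j, HolderSemi α (pd d i (pd d j f))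

/-- `f` is locally `α`-Hölder on `s`. -/
def LocHolderOn (α : ℝ) (f : ℝ → ℝ) (s : Set ℝ) : Prop :=
  ∀ K : Set ℝ, IsCompact K → K ⊆ s →
    ∃ C : ℝ, 0 ≤ C ∧ ∀ x ∈ K, ∀ y ∈ K, |f x - f y| ≤ C * dist x y ^ α

/-- Standing hypotheses on `g`: strictly increasing and continuous on `[0,∞)`,
of class `C^{1,α}` on `(0,∞)`. -/
def Ghyp (α : ℝ) (g : ℝ → ℝ) : Prop :=
  StrictMonoOn g (Ici 0) ∧ ContinuousOn g (Ici 0) ∧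
    DifferentiableOn ℝ g (Ioi 0) ∧ LocHolderOn α (deriv g) (Ioi 0)

/-- Standing hypotheses on `V`: a `C^{1,α}` function on the torus. -/
def Vhyp (d : ℕ) (α : ℝ) (V : (Fin d → ℝ) → ℝ) : Prop :=
  ZPer d V ∧ C1Hold d α V

/-- The oscillation of `V` over the torus. -/
noncomputable def oscV (d : ℕ) (V : (Fin d → ℝ) → ℝ) : ℝ :=
  sSup (V '' Icc (0 : Fin d → ℝ) 1) - sInf (V '' Icc (0 : Fin d → ℝ) 1)

/-- Assumption (A1): `g⁻¹(g(1) − osc V) > 0`, i.e. `g(1) − osc V` is attained by `g` on `(0,∞)`. -/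
def A1 (d : ℕ) (g : ℝ → ℝ) (V : (Fin d → ℝ) → ℝ) : Prop :=
  g 1 - oscV d V ∈ g '' Ioi (0 : ℝ)

/-- Assumption (A2). -/
def A2 (g : ℝ → ℝ) : Prop :=
  ∃ C₁ C₂ β : ℝ, 0 < C₁ ∧ 0 < C₂ ∧
    (∀ z : ℝ, 0 < z → C₁ * z ^ β ≤ deriv g z) ∧
    (∀ z : ℝ, 0 ≤ z → g z ≤ C₂ + z * g z)

/-- A classical solution `(u, m)` of the discounted MFG system
`ε u + |Du|²/2 + V = g(m)`, `ε m − div(m Du) = ε` on `T^d`. -/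
structure DiscSol (d : ℕ) (α : ℝ) (g : ℝ → ℝ) (V : (Fin d → ℝ) → ℝ) (ε : ℝ)
    (u m : (Fin d → ℝ) → ℝ) : Prop where
  per_u : ZPer d u
  per_m : ZPer d m
  reg_u : C2Hold d α u
  reg_m : C1Hold d α m
  m_nonneg : ∀ x, 0 ≤ m x
  hj : ∀ x, ε * u x + (1 / 2) * gradSq d u x + V x = g (m x)
  fp : ∀ x, ε * m x - divUp d m u x = ε

/-- A classical solution `(u, m, H̄)` of the ergodic MFG system
`|Du|²/2 + V = g(m) + H̄`, `−div(m Du) = 0`, `m ≥ 0`, `∫ m = 1` on `T^d`. -/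
structure ErgSol (d : ℕ) (α : ℝ) (g : ℝ → ℝ) (V : (Fin d → ℝ) → ℝ)
    (u m : (Fin d → ℝ) → ℝ) (H : ℝ) : Prop where
  per_u : ZPer d u
  per_m : ZPer d m
  reg_u : C2Hold d α u
  reg_m : C1Hold d α m
  m_nonneg : ∀ x, 0 ≤ m x
  m_mass : (∫ x in Icc (0 : Fin d → ℝ) 1, m x) = 1
  hj : ∀ x, (1 / 2) * gradSq d u x + V x = g (m x) + H
  fp : ∀ x, divUp d m u x = 0

/-- `lam` belongs to the continuation set `Λ`: the discounted MFG system with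
potential `lam • V` has a classical solution with positive density. -/
def InLambda (d : ℕ) (α : ℝ) (g : ℝ → ℝ) (V : (Fin d → ℝ) → ℝ) (ε lam : ℝ) : Prop :=
  ∃ u m : (Fin d → ℝ) → ℝ,
    DiscSol d α g (fun x => lam * V x) ε u m ∧ ∀ x, 0 < m x


open MeasureTheory Set

set_option linter.unusedSectionVars false
set_option linter.style.longLine false

section Jet
open Filter Topology

def JetAt (f : ℝ → ℝ) (x a b c : ℝ) : Prop :=
  f x = a ∧ ∃ f' : ℝ → ℝ, (∀ᶠ s in 𝓝 x, HasDerivAt f (f' s) s) ∧ f' x = b ∧ HasDerivAt f' c x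

theorem JetAt.of_hasDerivAt {f f' : ℝ → ℝ} {x c : ℝ} (h : ∀ᶠ s in 𝓝 x, HasDerivAt f (f' s) s)
    (h' : HasDerivAt f' c x) : JetAt f x (f x) (f' x) c := ⟨rfl, f', h, rfl, h'⟩

theorem JetAt.congr {f : ℝ → ℝ} {x a b c a' b' c' : ℝ} (h : JetAt f x a b c)
    (ha : a = a') (hb : b = b') (hc : c = c') : JetAt f x a' b' c' := by
  subst ha hb hc; exact h

theorem JetAt.const (k x : ℝ) : JetAt (fun _ => k) x k 0 0 :=
  ⟨rfl, fun _ => 0, Eventually.of_forall fun s => hasDerivAt_const s k, rfl, hasDerivAt_const x 0⟩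

theorem JetAt.id (x : ℝ) : JetAt (fun s => s) x x 1 0 :=
  ⟨rfl, fun _ => 1, Eventually.of_forall fun s => hasDerivAt_id s, rfl, hasDerivAt_const x 1⟩

theorem JetAt.add {f g : ℝ → ℝ} {x a b c a' b' c' : ℝ} (hf : JetAt f x a b c)
    (hg : JetAt g x a' b' c') : JetAt (fun s => f s + g s) x (a + a') (b + b') (c + c') := by
  obtain ⟨h0, f', h1, h2, h3⟩ := hf
  obtain ⟨k0, g', k1, k2, k3⟩ := hg
  refine ⟨by simp [h0, k0], fun s => f' s + g' s, ?_, by simp [h2, k2], h3.add k3⟩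
  filter_upwards [h1, k1] with s a b using a.add b

theorem JetAt.sub {f g : ℝ → ℝ} {x a b c a' b' c' : ℝ} (hf : JetAt f x a b c)
    (hg : JetAt g x a' b' c') : JetAt (fun s => f s - g s) x (a - a') (b - b') (c - c') := by
  obtain ⟨h0, f', h1, h2, h3⟩ := hf
  obtain ⟨k0, g', k1, k2, k3⟩ := hg
  refine ⟨by simp [h0, k0], fun s => f' s - g' s, ?_, by simp [h2, k2], h3.sub k3⟩
  filter_upwards [h1, k1] with s a b using a.sub b

theorem JetAt.mul {f g : ℝ → ℝ} {x a b c a' b' c' : ℝ} (hf : JetAt f x a b c)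
    (hg : JetAt g x a' b' c') :
    JetAt (fun s => f s * g s) x (a * a') (b * a' + a * b') (c * a' + 2 * b * b' + a * c') := by
  obtain ⟨h0, f', h1, h2, h3⟩ := hf
  obtain ⟨k0, g', k1, k2, k3⟩ := hg
  refine ⟨by simp [h0, k0], fun s => f' s * g s + f s * g' s, ?_, by simp [h0, k0, h2, k2], ?_⟩
  · filter_upwards [h1, k1] with s a b using a.mul b
  · have := (h3.mul k1.self_of_nhds).add (h1.self_of_nhds.mul k3)
    rw [h0, k0, h2, k2] at this
    exact this.congr_deriv (by ring)

theorem JetAt.comp {f g : ℝ → ℝ} {x a b c A B C : ℝ} (hf : JetAt f a A B C)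
    (hg : JetAt g x a b c) :
    JetAt (fun s => f (g s)) x A (B * b) (C * b ^ 2 + B * c) := by
  obtain ⟨h0, f', h1, h2, h3⟩ := hf
  obtain ⟨k0, g', k1, k2, k3⟩ := hg
  refine ⟨by simp [h0, k0], fun s => f' (g s) * g' s, ?_, by simp [h2, k0, k2], ?_⟩
  · have hc : Tendsto g (𝓝 x) (𝓝 a) := by
      have := k1.self_of_nhds.continuousAt.tendsto
      rwa [k0] at this
    filter_upwards [hc.eventually h1, k1] with s a b using a.comp s b
  · subst k0
    have := (h3.comp x k1.self_of_nhds).mul k3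
    simp only [Function.comp_apply] at this
    rw [h2, k2] at this
    exact this.congr_deriv (by ring)

theorem JetAt.max {f : ℝ → ℝ} {x a b c : ℝ} (h : JetAt f x a b c) (hm : IsLocalMax f x) :
    b = 0 ∧ c ≤ 0 := by
  obtain ⟨h0, f', h1, h2, h3⟩ := h
  have hd : deriv f =ᶠ[𝓝 x] f' := by
    filter_upwards [h1] with s hs using hs.deriv
  have hb : f' x = 0 := by
    rw [← hd.self_of_nhds]; exact hm.deriv_eq_zero
  refine ⟨h2 ▸ hb, ?_⟩
  by_contra hc
  push Not at hc
  have hdd : deriv (deriv f) x = c := by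
    rw [hd.deriv_eq]; exact h3.deriv
  have hmin : IsLocalMin f x := isLocalMin_of_deriv_deriv_pos (by rw [hdd]; exact hc)
    hm.deriv_eq_zero h1.self_of_nhds.continuousAt
  have hconst : f =ᶠ[𝓝 x] fun _ => f x := by
    filter_upwards [hm, hmin] with s a b using le_antisymm a b
  have h4 : deriv f =ᶠ[𝓝 x] fun _ => 0 := by
    have := hconst.deriv
    simpa using this
  have h5 : deriv (deriv f) x = 0 := by
    rw [h4.deriv_eq]; simp
  linarith

theorem JetAt.sqrt {t : ℝ} (ht : 0 < t) :
    JetAt (fun s => Real.sqrt s) (t ^ 2) t (1 / (2 * t)) (-1 / (4 * t ^ 3)) := by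
  have h2 : (0:ℝ) < t ^ 2 := by positivity
  have hs : Real.sqrt (t ^ 2) = t := Real.sqrt_sq ht.le
  refine ⟨hs, fun s => 1 / (2 * Real.sqrt s), ?_, by simp [hs], ?_⟩
  · filter_upwards [lt_mem_nhds h2] with s hs using Real.hasDerivAt_sqrt hs.ne'
  · have h := (Real.hasDerivAt_sqrt h2.ne')
    have h3 := (h.const_mul 2).inv (by rw [hs]; positivity)
    have h4 : (fun s => 1 / (2 * Real.sqrt s)) = (fun y => (2 * Real.sqrt y))⁻¹ := by
      ext s; simp
    rw [h4]
    refine h3.congr_deriv ?_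
    rw [hs]; field_simp; ring

end Jet

section C2sec
open Filter Topology RealInnerProductSpace
variable {E : Type*} [NormedAddCommGroup E] [InnerProductSpace ℝ E]

structure C2 (v : E → ℝ) (p : E → E) (H : E → E →L[ℝ] E) : Prop where
  hv : ∀ x, HasFDerivAt v (innerSL ℝ (p x)) x
  hp : ∀ x, HasFDerivAt p (H x) x

theorem C2.jet {v : E → ℝ} {p : E → E} {H : E → E →L[ℝ] E} (h : C2 v p H) (x a : E) :
    JetAt (fun s : ℝ => v (x + s • a)) 0 (v x) ⟪p x, a⟫ ⟪H x a, a⟫ := by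
  have hl : ∀ s : ℝ, HasDerivAt (fun s : ℝ => x + s • a) a s := fun s => by
    simpa using ((hasDerivAt_id s).smul_const a).const_add x
  refine ⟨by simp, fun s => ⟪p (x + s • a), a⟫, ?_, by simp, ?_⟩
  · refine Eventually.of_forall fun s => ?_
    have := (h.hv (x + s • a)).comp_hasDerivAt s (hl s)
    exact this.congr_deriv (by simp)
  · have h1 : HasFDerivAt p (H x) (x + (0:ℝ) • a) := by simpa using h.hp x
    have := (h1.comp_hasDerivAt (0:ℝ) (hl 0)).inner ℝ (hasDerivAt_const (0:ℝ) a)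
    simpa using this

theorem normJet {e w : E} (he : e ≠ 0) :
    JetAt (fun s : ℝ => ‖e + s • w‖) 0 ‖e‖ (⟪e, w⟫ / ‖e‖)
      ((‖w‖ ^ 2 - (⟪e, w⟫ / ‖e‖) ^ 2) / ‖e‖) := by
  have hpos : 0 < ‖e‖ := norm_pos_iff.2 he
  have hq : JetAt (fun s : ℝ => ‖e‖ ^ 2 + s * (2 * ⟪e, w⟫) + s * s * ‖w‖ ^ 2) 0 (‖e‖ ^ 2)
      (2 * ⟪e, w⟫) (2 * ‖w‖ ^ 2) := by
    have := (((JetAt.const (‖e‖ ^ 2) 0).add ((JetAt.id 0).mul (JetAt.const (2 * ⟪e, w⟫) 0))).add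
      (((JetAt.id 0).mul (JetAt.id 0)).mul (JetAt.const (‖w‖ ^ 2) 0)))
    exact this.congr (by ring) (by ring) (by ring)
  have h := (JetAt.sqrt hpos).comp hq
  have heq : (fun s : ℝ => Real.sqrt (‖e‖ ^ 2 + s * (2 * ⟪e, w⟫) + s * s * ‖w‖ ^ 2))
      = fun s : ℝ => ‖e + s • w‖ := by
    ext s
    rw [← Real.sqrt_sq (norm_nonneg (e + s • w)), norm_add_sq_real, inner_smul_right, norm_smul]
    congr 1
    rw [mul_pow, Real.norm_eq_abs, sq_abs]; ring
  rw [heq] at h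
  exact h.congr rfl (by field_simp) (by field_simp; ring)

theorem dbl {v h : E → ℝ} {p Dh : E → E} {H D2h : E → E →L[ℝ] E}
    (hv : C2 v p H) (hh : C2 h Dh D2h) {x y : E} (hxy : x ≠ y) {φ0 φ1 : ℝ → ℝ}
    {A0 A1 A2 B0 B1 B2 : ℝ} (h0 : JetAt φ0 ‖x - y‖ A0 A1 A2) (h1 : JetAt φ1 ‖x - y‖ B0 B1 B2)
    (hm : IsLocalMax (fun q : E × E => v q.1 - v q.2 - φ0 ‖q.1 - q.2‖
      - φ1 ‖q.1 - q.2‖ * h ((1/2:ℝ) • (q.1 + q.2))) (x, y))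
    {t P : ℝ} {z c : E} (ht : t = ‖x - y‖) (hz : z = t⁻¹ • (x - y)) (hc : c = (1/2:ℝ) • (x + y))
    (hP : P = A1 + B1 * h c) :
    p x = P • z + (B0 / 2) • Dh c ∧ p y = P • z - (B0 / 2) • Dh c ∧
    ∀ a b : E, ⟪H x a, a⟫ - ⟪H y b, b⟫ ≤
      P * ((‖a - b‖ ^ 2 - ⟪z, a - b⟫ ^ 2) / t) + (A2 + B2 * h c) * ⟪z, a - b⟫ ^ 2
      + 2 * B1 * ⟪z, a - b⟫ * ⟪Dh c, (1/2:ℝ) • (a + b)⟫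
      + B0 * ⟪D2h c ((1/2:ℝ) • (a + b)), (1/2:ℝ) • (a + b)⟫ := by
  have he : x - y ≠ 0 := sub_ne_zero.2 hxy
  have htp : 0 < t := by rw [ht]; exact norm_pos_iff.2 he
  have key : ∀ a b : E, JetAt (fun s : ℝ => (fun q : E × E => v q.1 - v q.2 - φ0 ‖q.1 - q.2‖
      - φ1 ‖q.1 - q.2‖ * h ((1/2:ℝ) • (q.1 + q.2))) (x + s • a, y + s • b)) 0
      (v x - v y - A0 - B0 * h c)
      (⟪p x, a⟫ - ⟪p y, b⟫ - A1 * ⟪z, a - b⟫ -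
        (B1 * ⟪z, a - b⟫ * h c + B0 * ⟪Dh c, (1/2:ℝ) • (a + b)⟫))
      (⟪H x a, a⟫ - ⟪H y b, b⟫ - (A2 * ⟪z, a - b⟫ ^ 2 +
          A1 * ((‖a - b‖ ^ 2 - ⟪z, a - b⟫ ^ 2) / t)) -
        ((B2 * ⟪z, a - b⟫ ^ 2 + B1 * ((‖a - b‖ ^ 2 - ⟪z, a - b⟫ ^ 2) / t)) * h c
        + 2 * (B1 * ⟪z, a - b⟫) * ⟪Dh c, (1/2:ℝ) • (a + b)⟫
        + B0 * ⟪D2h c ((1/2:ℝ) • (a + b)), (1/2:ℝ) • (a + b)⟫)) := by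
    intro a b
    have hwz : ⟪x - y, a - b⟫ / ‖x - y‖ = ⟪z, a - b⟫ := by
      rw [hz, real_inner_smul_left, ht, inv_mul_eq_div]
    have hn := normJet (w := a - b) he
    rw [hwz, ← ht] at hn
    rw [← ht] at h0 h1
    have hc' := hh.jet c ((1/2:ℝ) • (a + b))
    have e1 : (fun s : ℝ => x - y + s • (a - b)) = fun s : ℝ => (x + s • a) - (y + s • b) := by
      ext s; module
    have e2 : (fun s : ℝ => c + s • ((1/2:ℝ) • (a + b)))
        = fun s : ℝ => (1/2:ℝ) • ((x + s • a) + (y + s • b)) := by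
      ext s; rw [hc]; module
    have e1' : ∀ s : ℝ, x - y + s • (a - b) = (x + s • a) - (y + s • b) := fun s => congrFun e1 s
    have e2' : ∀ s : ℝ, c + s • ((1/2:ℝ) • (a + b)) = (1/2:ℝ) • ((x + s • a) + (y + s • b)) :=
      fun s => congrFun e2 s
    simp only [e1'] at hn
    simp only [e2'] at hc'
    exact (((hv.jet x a).sub (hv.jet y b)).sub (h0.comp hn)).sub ((h1.comp hn).mul hc')
  have hlm : ∀ a b : E, IsLocalMax (fun s : ℝ => (fun q : E × E => v q.1 - v q.2 - φ0 ‖q.1 - q.2‖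
      - φ1 ‖q.1 - q.2‖ * h ((1/2:ℝ) • (q.1 + q.2))) (x + s • a, y + s • b)) 0 := by
    intro a b
    have hct : Tendsto (fun s : ℝ => (x + s • a, y + s • b)) (𝓝 0) (𝓝 (x, y)) := by
      have : Continuous (fun s : ℝ => (x + s • a, y + s • b)) := by fun_prop
      simpa using this.tendsto 0
    have := hct.eventually hm
    unfold IsLocalMax IsMaxFilter
    simpa using this
  have fo : ∀ a b : E, ⟪p x, a⟫ - ⟪p y, b⟫ - A1 * ⟪z, a - b⟫ -
        (B1 * ⟪z, a - b⟫ * h c + B0 * ⟪Dh c, (1/2:ℝ) • (a + b)⟫) = 0 :=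
    fun a b => ((key a b).max (hlm a b)).1
  refine ⟨?_, ?_, ?_⟩
  · refine ext_inner_right ℝ fun a => ?_
    have := fo a 0
    simp only [inner_zero_right, sub_zero, add_zero, inner_smul_right] at this
    rw [inner_add_left, real_inner_smul_left, real_inner_smul_left, hP]
    linarith
  · refine ext_inner_right ℝ fun a => ?_
    have := fo 0 a
    simp only [inner_zero_right, zero_sub, zero_add, inner_smul_right, inner_neg_right] at this
    rw [inner_sub_left, real_inner_smul_left, real_inner_smul_left, hP]
    linarith
  · intro a b
    have := ((key a b).max (hlm a b)).2
    rw [hP]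
    linarith

variable [FiniteDimensional ℝ E]

noncomputable def tr (A : E →L[ℝ] E) : ℝ := LinearMap.trace ℝ E (A : E →ₗ[ℝ] E)

theorem tr_add (A B : E →L[ℝ] E) : tr (A + B) = tr A + tr B := by simp [tr]
theorem tr_sub (A B : E →L[ℝ] E) : tr (A - B) = tr A - tr B := by simp [tr]
theorem tr_smul (c : ℝ) (A : E →L[ℝ] E) : tr (c • A) = c * tr A := by simp [tr]

theorem tr_id : tr (ContinuousLinearMap.id ℝ E) = Module.finrank ℝ E := by
  unfold tr
  have : ((ContinuousLinearMap.id ℝ E : E →L[ℝ] E) : E →ₗ[ℝ] E) = LinearMap.id := rfl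
  rw [this, LinearMap.trace_id]

theorem tr_le (N : E →L[ℝ] E) (hN : ∀ a, ⟪N a, a⟫ ≤ 0) (z : E) (hz : ‖z‖ = 1) :
    tr N ≤ ⟪N z, z⟫ := by
  classical
  have ho : Orthonormal ℝ (Subtype.val : ({z} : Set E) → E) := by
    refine ⟨?_, ?_⟩
    · rintro ⟨i, hi⟩; simp at hi; simp [hi, hz]
    · rintro ⟨i, hi⟩ ⟨j, hj⟩ hij; simp at hi hj; exfalso; apply hij; simp [hi, hj]
  obtain ⟨u, b, hu, hb⟩ := ho.exists_orthonormalBasis_extension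
  rw [tr, LinearMap.trace_eq_sum_inner _ b]
  have hzu : z ∈ u := by simpa using hu
  have hz' : b ⟨z, hzu⟩ = z := by rw [hb]
  rw [← Finset.add_sum_erase _ _ (Finset.mem_univ (⟨z, hzu⟩ : u)), hz']
  have : ∑ i ∈ Finset.univ.erase (⟨z, hzu⟩ : u), ⟪b i, (N : E →ₗ[ℝ] E) (b i)⟫ ≤ 0 := by
    apply Finset.sum_nonpos
    intro i _
    rw [real_inner_comm]; exact hN _
  have hcm := real_inner_comm (N z) z
  simp only [ContinuousLinearMap.coe_coe] at this ⊢
  linarith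

theorem tr_nonpos (N : E →L[ℝ] E) (hN : ∀ a, ⟪N a, a⟫ ≤ 0) : tr N ≤ 0 := by
  rw [tr, LinearMap.trace_eq_sum_inner _ (stdOrthonormalBasis ℝ E)]
  apply Finset.sum_nonpos
  intro i _
  rw [real_inner_comm]; exact hN _

theorem tr_rank1 (N : E →L[ℝ] E) (c : E) (h : ∀ a, N a = ⟪c, a⟫ • c) : tr N = ‖c‖ ^ 2 := by
  rw [tr, LinearMap.trace_eq_sum_inner _ (stdOrthonormalBasis ℝ E)]
  rw [← (stdOrthonormalBasis ℝ E).sum_sq_norm_inner_right c]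
  apply Finset.sum_congr rfl
  intro i _
  simp only [ContinuousLinearMap.coe_coe, h, inner_smul_right, Real.norm_eq_abs, sq_abs]
  rw [real_inner_comm]; ring

theorem abs_tr_le (A : E →L[ℝ] E) : |tr A| ≤ Module.finrank ℝ E * ‖A‖ := by
  rw [tr, LinearMap.trace_eq_sum_inner _ (stdOrthonormalBasis ℝ E)]
  refine (Finset.abs_sum_le_sum_abs _ _).trans ?_
  have : ∀ i ∈ (Finset.univ : Finset (Fin (Module.finrank ℝ E))),
      |⟪stdOrthonormalBasis ℝ E i, (A : E →ₗ[ℝ] E) (stdOrthonormalBasis ℝ E i)⟫| ≤ ‖A‖ := by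
    intro i _
    refine (abs_real_inner_le_norm _ _).trans ?_
    have := A.le_opNorm (stdOrthonormalBasis ℝ E i)
    simpa using this
  simpa using Finset.sum_le_sum this

end C2sec

open MeasureTheory Set
set_option linter.unusedSectionVars false

section Improve
open Filter Topology RealInnerProductSpace
variable {E : Type*} [NormedAddCommGroup E] [InnerProductSpace ℝ E]

noncomputable def cutF (θ : ℝ) (n : ℕ) (c : E) : ℝ := (θ ^ 2 - ‖c‖ ^ 2) ^ (n + 2)
noncomputable def cutD (θ : ℝ) (n : ℕ) (c : E) : E :=
  (-2 * (n + 2) * (θ ^ 2 - ‖c‖ ^ 2) ^ (n + 1)) • c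
noncomputable def cutH (θ : ℝ) (n : ℕ) (c : E) : E →L[ℝ] E :=
  (4 * (n + 2) * (n + 1) * (θ ^ 2 - ‖c‖ ^ 2) ^ n) • ((innerSL ℝ c).smulRight c)
    - (2 * (n + 2) * (θ ^ 2 - ‖c‖ ^ 2) ^ (n + 1)) • ContinuousLinearMap.id ℝ E

theorem hasFDerivAt_normsq (c : E) : HasFDerivAt (fun c : E => ‖c‖ ^ 2) ((2:ℝ) • innerSL ℝ c) c := by
  have := (hasStrictFDerivAt_norm_sq c).hasFDerivAt
  refine this.congr_fderiv ?_
  ext; simp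

theorem cut_C2 (θ : ℝ) (n : ℕ) : C2 (cutF θ n : E → ℝ) (cutD θ n) (cutH θ n) := by
  have hs : ∀ c : E, HasFDerivAt (fun c : E => θ ^ 2 - ‖c‖ ^ 2) (-((2:ℝ) • innerSL ℝ c)) c :=
    fun c => by simpa using (hasFDerivAt_normsq c).const_sub (θ ^ 2)
  constructor
  · intro c
    have := (hs c).pow (n + 2)
    refine this.congr_fderiv ?_
    ext a
    simp [cutD, inner_smul_left]
    ring
  · intro c
    have := (((hs c).pow (n + 1)).const_mul (-2 * ((n:ℝ) + 2))).smul (hasFDerivAt_id c)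
    refine this.congr_fderiv ?_
    ext a
    simp [cutH]
    rw [smul_smul, sub_eq_neg_add]
    congr 1
    module

variable [FiniteDimensional ℝ E]

theorem tr_cutH (θ : ℝ) (n : ℕ) (c : E) : tr (cutH θ n c) =
    4 * (n + 2) * (n + 1) * (θ ^ 2 - ‖c‖ ^ 2) ^ n * ‖c‖ ^ 2
      - 2 * (n + 2) * (θ ^ 2 - ‖c‖ ^ 2) ^ (n + 1) * Module.finrank ℝ E := by
  rw [cutH, tr_sub, tr_smul, tr_smul, tr_id, tr_rank1 _ c (fun a => by simp)]

theorem inner_cutH (θ : ℝ) (n : ℕ) (c a : E) : ⟪cutH θ n c a, a⟫ =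
    4 * (n + 2) * (n + 1) * (θ ^ 2 - ‖c‖ ^ 2) ^ n * ⟪c, a⟫ ^ 2
      - 2 * (n + 2) * (θ ^ 2 - ‖c‖ ^ 2) ^ (n + 1) * ‖a‖ ^ 2 := by
  simp only [cutH, ContinuousLinearMap.sub_apply, ContinuousLinearMap.smul_apply, inner_sub_left,
    real_inner_smul_left, ContinuousLinearMap.smulRight_apply, innerSL_apply_apply,
    ContinuousLinearMap.id_apply, real_inner_self_eq_norm_sq]
  ring

theorem norm_cutD (θ : ℝ) (n : ℕ) (c : E) (hθ : θ ≤ 1) (hθ0 : 0 < θ) (hc : ‖c‖ ≤ θ) :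
    ‖cutD θ n c‖ ≤ 2 * (n + 2) * (θ ^ 2 - ‖c‖ ^ 2) ^ (n + 1) := by
  have hs : 0 ≤ θ ^ 2 - ‖c‖ ^ 2 := by nlinarith [norm_nonneg c]
  rw [cutD, norm_smul, Real.norm_eq_abs, abs_mul, abs_mul, abs_of_nonneg (pow_nonneg hs _)]
  have : |(n:ℝ) + 2| = n + 2 := abs_of_nonneg (by positivity)
  rw [this]; norm_num
  have h1 : 0 ≤ 2 * ((n:ℝ) + 2) * (θ ^ 2 - ‖c‖ ^ 2) ^ (n + 1) := by positivity
  nlinarith [norm_nonneg c]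

theorem rank1_split {σ : E → ℝ} {τ0 z q px py : E} {P S L Cσ α : ℝ} (hα : 0 < α)
    (hS : ∀ q, |σ q| ≤ S)
    (hσ : ∀ q q', ‖q‖ ≤ L → ‖q'‖ ≤ L → |σ q - σ q'| ≤ Cσ * ‖q - q'‖ ^ α)
    (hz : ‖z‖ = 1) (hpx : px = P • z - q) (hpy : py = P • z + q) (hx : ‖px‖ ≤ L) (hy : ‖py‖ ≤ L)
    (hC : 0 ≤ Cσ) :
    ‖(σ px • px + τ0) - (σ py • py + τ0)‖ ^ 2 - ⟪z, (σ px • px + τ0) - (σ py • py + τ0)⟫ ^ 2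
      ≤ (2 * S * ‖q‖) ^ 2 ∧
    |⟪z, (σ px • px + τ0) - (σ py • py + τ0)⟫| ≤ L * Cσ * (2 * ‖q‖) ^ α + 2 * S * ‖q‖ ∧ |P| ≤ L := by
  have hS0 : 0 ≤ S := (abs_nonneg _).trans (hS 0)
  set w := (σ px • px + τ0) - (σ py • py + τ0) with hw
  have hw2 : w = ((σ px - σ py) * P) • z + (-(σ px + σ py)) • q := by
    rw [hw]
    generalize σ px = A
    generalize σ py = B
    rw [hpx, hpy]; module
  set k := (σ px - σ py) * P with hk
  set w2 := (-(σ px + σ py)) • q with hw2'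
  have hn2 : ‖w2‖ ≤ 2 * S * ‖q‖ := by
    rw [hw2', norm_smul, Real.norm_eq_abs, abs_neg]
    have := abs_add_le (σ px) (σ py)
    have h1 := hS px; have h2 := hS py
    exact mul_le_mul_of_nonneg_right (by linarith) (norm_nonneg _)
  have hP : |P| ≤ L := by
    have h1 : P • z = (1/2:ℝ) • (px + py) := by rw [hpx, hpy]; module
    have h2 : ‖P • z‖ = |P| := by rw [norm_smul, hz, mul_one, Real.norm_eq_abs]
    rw [← h2, h1, norm_smul]
    have := norm_add_le px py
    norm_num; linarith
  have hL : 0 ≤ L := (abs_nonneg _).trans hP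
  have hzw : ⟪z, w⟫ = k + ⟪z, w2⟫ := by
    rw [hw2, inner_add_right, inner_smul_right, real_inner_self_eq_norm_sq, hz]; ring
  have hc := abs_real_inner_le_norm z w2
  rw [hz, one_mul] at hc
  refine ⟨?_, ?_, hP⟩
  · have : ‖w‖ ^ 2 = k ^ 2 + 2 * k * ⟪z, w2⟫ + ‖w2‖ ^ 2 := by
      rw [hw2, norm_add_sq_real, norm_smul, hz, real_inner_smul_left, mul_one, Real.norm_eq_abs, sq_abs]
      ring
    rw [this, hzw]
    have h3 : ‖w2‖ ^ 2 ≤ (2 * S * ‖q‖) ^ 2 := pow_le_pow_left₀ (norm_nonneg _) hn2 2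
    nlinarith [sq_nonneg ⟪z, w2⟫]
  · rw [hzw]
    have h1 : |k| ≤ L * Cσ * (2 * ‖q‖) ^ α := by
      rw [hk, abs_mul]
      have h2 := hσ px py hx hy
      have h3 : ‖px - py‖ = 2 * ‖q‖ := by
        have : px - py = (-2:ℝ) • q := by rw [hpx, hpy]; module
        rw [this, norm_smul]; norm_num
      rw [h3] at h2
      calc _ ≤ (Cσ * (2 * ‖q‖) ^ α) * L := by gcongr
        _ = _ := by ring
    calc _ ≤ |k| + |⟪z, w2⟫| := abs_add_le _ _
      _ ≤ _ := by linarith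

theorem expf_jet (K t : ℝ) : JetAt (fun t => Real.exp (K * t) - 1) t (Real.exp (K * t) - 1)
    (K * Real.exp (K * t)) (K ^ 2 * Real.exp (K * t)) := by
  have h1 : ∀ s, HasDerivAt (fun t => Real.exp (K * t)) (K * Real.exp (K * s)) s := fun s => by
    have := ((hasDerivAt_id s).const_mul K).exp
    refine this.congr_deriv ?_
    simp; ring
  refine ⟨rfl, fun s => K * Real.exp (K * s), Eventually.of_forall fun s => (h1 s).sub_const 1, rfl, ?_⟩
  refine ((h1 t).const_mul K).congr_deriv (by ring)

theorem JetAt.smul' {f : ℝ → ℝ} {x a b c : ℝ} (k : ℝ) (hf : JetAt f x a b c) :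
    JetAt (fun s => k * f s) x (k * a) (k * b) (k * c) :=
  ((JetAt.const k x).mul hf).congr rfl (by ring) (by ring)

theorem improve_quad (n : ℕ) (B s : ℝ) {θ : ℝ} (hθ0 : 0 < θ) :
    0 ≤ 2 * ((n:ℝ) + 2) * (n + 1) * θ ^ 2 - B * s + B ^ 2 / θ ^ 2 * s ^ 2 := by
  obtain ⟨r, hr⟩ : ∃ r, r = B * s / θ := ⟨_, rfl⟩
  have hC1' : B ^ 2 / θ ^ 2 * s ^ 2 = r ^ 2 := by rw [hr]; field_simp
  have hBs : B * s = θ * r := by rw [hr]; field_simp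
  rw [hC1', hBs]
  have hn0 : (0:ℝ) ≤ n := Nat.cast_nonneg n
  have h1 : 1 ≤ 2 * ((n:ℝ) + 2) * (n + 1) := by nlinarith
  have h2 : 1 * θ ^ 2 ≤ 2 * ((n:ℝ) + 2) * (n + 1) * θ ^ 2 := by gcongr
  nlinarith only [h2, sq_nonneg (θ - r), sq_nonneg θ, sq_nonneg r]

set_option maxHeartbeats 2000000 in
theorem improve_core {α L S Cσ θ η K : ℝ} {n : ℕ} {σ : E → ℝ} {τ0 : E}
    {v : E → ℝ} {p : E → E} {H : E → E →L[ℝ] E} (hv : C2 v p H)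
    (hα : 0 < α) (hα1 : α < 1) (hn : 1 ≤ (n + 1) * α)
    (hS : ∀ q, |σ q| ≤ S) (hC : 0 ≤ Cσ)
    (hσ : ∀ q q', ‖q‖ ≤ L → ‖q'‖ ≤ L → |σ q - σ q'| ≤ Cσ * ‖q - q'‖ ^ α)
    (hpL : ∀ x, ‖p x‖ ≤ L)
    (heq : ∀ x, tr (H x) + ⟪H x (σ (p x) • p x + τ0), σ (p x) • p x + τ0⟫ = 0)
    (hθ0 : 0 < θ) (hθ : θ ≤ 1) (hη : 0 < η) {Tb C1 B : ℝ} (hTb : Tb = S * L + ‖τ0‖)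
    (hB : B = 2 * (n + 2) * (n + 1) + 2 * (n + 2) * (Module.finrank ℝ E + Tb ^ 2))
    (hC1 : C1 = B ^ 2 / θ ^ 2) (hK : K = C1 + 2)
    (hη1 : η * (4 * (n + 2) ^ 2 * L * S ^ 2 * K * Real.exp K) ≤ 1)
    (hη2 : 2 * Tb * (L * Cσ * (η * Real.exp K) ^ α * (4 * (n + 2) ^ 2)
      + S * η * Real.exp K * (4 * (n + 2) ^ 2)) ≤ 1)
    {x y : E} (hxy : x ≠ y) (ht1 : ‖x - y‖ ≤ 1) (hcθ : ‖(1/2:ℝ) • (x + y)‖ < θ)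
    (hm : IsLocalMax (fun q : E × E => v q.1 - v q.2 - L * ‖q.1 - q.2‖
      - (-η * (Real.exp (K * ‖q.1 - q.2‖) - 1)) * cutF θ n ((1/2:ℝ) • (q.1 + q.2))) (x, y)) : False := by
  have hS0 : 0 ≤ S := (abs_nonneg _).trans (hS 0)
  have hL0 : 0 ≤ L := (norm_nonneg _).trans (hpL 0)
  set t := ‖x - y‖ with ht
  set c := (1/2:ℝ) • (x + y) with hc
  set z := t⁻¹ • (x - y) with hz
  have htp : 0 < t := norm_pos_iff.2 (sub_ne_zero.2 hxy)
  have hzn : ‖z‖ = 1 := by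
    rw [hz, norm_smul, norm_inv, norm_norm]; exact inv_mul_cancel₀ htp.ne'
  set f := Real.exp (K * t) - 1 with hf
  set e := Real.exp (K * t) with he
  set s := θ ^ 2 - ‖c‖ ^ 2 with hs
  have hsp : 0 < s := by nlinarith only [hcθ, hθ0, hs, norm_nonneg c]
  have hs1 : s ≤ 1 := by nlinarith only [hs, hθ, hθ0, sq_nonneg ‖c‖, norm_nonneg c]
  have hC1n : 0 ≤ C1 := by rw [hC1]; positivity
  have hK1 : 2 ≤ K := by linarith
  have hep : 0 < e := Real.exp_pos _
  have hKt : 0 < K * t := by positivity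
  have hfp : 0 < f := by
    have := Real.add_one_lt_exp hKt.ne'
    rw [hf]; linarith
  have hfe : f ≤ e := by rw [hf]; linarith
  have heK : e ≤ Real.exp K := Real.exp_le_exp.2 (by nlinarith only [hK1, ht1])
  have hft : f ≤ K * Real.exp K * t := by
    have h1 := Real.add_one_le_exp (-(K * t))
    have h2 : Real.exp (-(K*t)) * e = 1 := by rw [he, ← Real.exp_add]; simp
    have : f ≤ K * t * e := by
      rw [hf]; nlinarith only [h1, h2, hep]
    calc f ≤ K * t * e := this
      _ ≤ K * t * Real.exp K := by gcongr
      _ = _ := by ring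
  have hj0 : JetAt (fun t => L * t) t (L * t) L 0 :=
    (JetAt.smul' L (JetAt.id t)).congr rfl (by ring) (by ring)
  have hj1 := JetAt.smul' (-η) (expf_jet K t)
  obtain ⟨hpx, hpy, hH⟩ := dbl hv (cut_C2 θ n) hxy hj0 hj1 hm ht hz hc rfl
  simp only [← hf, ← he] at hpx hpy hH
  set h := cutF θ n c with hh
  have hhs : h = s ^ (n + 2) := rfl
  have hhp : 0 < h := by rw [hhs]; positivity
  set P := L + -η * (K * e) * h with hP
  set D := cutD θ n c with hD
  set q := (η * f / 2) • D with hq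
  have hpx' : p x = P • z - q := by rw [hpx, hq]; module
  have hpy' : p y = P • z + q := by rw [hpy, hq]; module
  obtain ⟨hw1, hw2, hPL⟩ := rank1_split (τ0 := τ0) hα hS hσ hzn hpx' hpy' (hpL x) (hpL y) hC
  set a := σ (p x) • p x + τ0 with ha
  set b := σ (p y) • p y + τ0 with hb
  have hta : ∀ x, ‖σ (p x) • p x + τ0‖ ≤ Tb := fun x => by
    rw [hTb]
    refine (norm_add_le _ _).trans ?_
    rw [norm_smul, Real.norm_eq_abs]
    have := mul_le_mul (hS (p x)) (hpL x) (norm_nonneg _) hS0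
    linarith
  have hTb0 : 0 ≤ Tb := (norm_nonneg _).trans (hta 0)
  set c' := (1/2:ℝ) • (a + b) with hc'
  have hc'n : ‖c'‖ ≤ Tb := by
    rw [hc', norm_smul]
    have := norm_add_le a b
    have h1 := hta x; have h2 := hta y
    norm_num; linarith
  -- norm of D
  have hDn : ‖D‖ ≤ 2 * (n + 2) * s ^ (n + 1) := norm_cutD θ n c hθ hθ0 hcθ.le
  have hqn : 2 * ‖q‖ = η * f * ‖D‖ := by
    rw [hq, norm_smul, Real.norm_eq_abs, abs_of_pos (by positivity)]; ring
  have hpow1 : s ^ (n + 1) * s ^ (n + 1) ≤ h := by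
    rw [← pow_add, hhs]; exact pow_le_pow_of_le_one hsp.le hs1 (by omega)
  have hD2 : ‖D‖ * ‖D‖ ≤ 4 * (n + 2) ^ 2 * h := by
    calc ‖D‖ * ‖D‖ ≤ (2 * (n + 2) * s ^ (n + 1)) * (2 * (n + 2) * s ^ (n + 1)) := by gcongr
      _ = 4 * (n + 2) ^ 2 * (s ^ (n + 1) * s ^ (n + 1)) := by ring
      _ ≤ _ := by gcongr
  have hDα : ‖D‖ ^ α * ‖D‖ ≤ 4 * (n + 2) ^ 2 * h := by
    have h1 : ‖D‖ ^ α * ‖D‖ ≤ (2 * (n + 2) * s ^ (n + 1)) ^ α * (2 * (n + 2) * s ^ (n + 1)) := by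
      gcongr
    have h2 : (2 * (n + 2) * s ^ (n + 1)) ^ α ≤ 2 * ((n:ℝ) + 2) * s := by
      rw [Real.mul_rpow (by positivity) (by positivity)]
      have h3 : (2 * ((n:ℝ) + 2)) ^ α ≤ 2 * ((n:ℝ) + 2) := by
        have : (1:ℝ) ≤ 2 * ((n:ℝ) + 2) := by nlinarith [(Nat.cast_nonneg n : (0:ℝ) ≤ n)]
        simpa using Real.rpow_le_rpow_of_exponent_le this hα1.le
      have h4 : (s ^ (n + 1)) ^ α ≤ s := by
        rw [← Real.rpow_natCast, ← Real.rpow_mul hsp.le]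
        have : s ^ (((n + 1 : ℕ) : ℝ) * α) ≤ s ^ (1:ℝ) :=
          Real.rpow_le_rpow_of_exponent_ge hsp hs1 (by push_cast; exact hn)
        simpa using this
      gcongr
    calc _ ≤ _ := h1
      _ ≤ (2 * ((n:ℝ) + 2) * s) * (2 * (n + 2) * s ^ (n + 1)) := by gcongr
      _ = _ := by rw [hhs]; ring
  -- main inequality for the rank one term
  have hR := hH a b
  have hR1 : P * ((‖a - b‖ ^ 2 - ⟪z, a - b⟫ ^ 2) / t) ≤ η * (f * h) := by
    have h1 : 0 ≤ (‖a - b‖ ^ 2 - ⟪z, a - b⟫ ^ 2) := by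
      have := abs_real_inner_le_norm z (a - b)
      rw [hzn, one_mul] at this
      have := pow_le_pow_left₀ (abs_nonneg _) this 2
      rw [sq_abs] at this; linarith
    have h2 : P * ((‖a - b‖ ^ 2 - ⟪z, a - b⟫ ^ 2) / t) ≤ L * ((2 * S * ‖q‖) ^ 2 / t) := by
      apply mul_le_mul ((le_abs_self _).trans hPL) _ (by positivity) hL0
      gcongr
    refine h2.trans ?_
    have h3 : L * ((2 * S * ‖q‖) ^ 2 / t) = (L * S ^ 2 * η ^ 2 * f * (‖D‖ * ‖D‖)) * (f / t) := by
      have : 2 * S * ‖q‖ = S * (η * f * ‖D‖) := by rw [← hqn]; ring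
      rw [this]; ring
    rw [h3]
    have h4 : f / t ≤ K * Real.exp K := by rw [div_le_iff₀ htp]; exact hft
    calc _ ≤ (L * S ^ 2 * η ^ 2 * f * (4 * (n + 2) ^ 2 * h)) * (K * Real.exp K) := by gcongr
      _ = η * (f * h) * (η * (4 * (n + 2) ^ 2 * L * S ^ 2 * K * Real.exp K)) := by ring
      _ ≤ η * (f * h) * 1 := by gcongr
      _ = _ := by ring
  have hR2 : 2 * (-η * (K * e)) * ⟪z, a - b⟫ * ⟪D, c'⟫ ≤ η * (K * e * h) := by
    have h1 : 2 * (-η * (K * e)) * ⟪z, a - b⟫ * ⟪D, c'⟫ ≤ 2 * (η * (K * e)) * (|⟪z, a - b⟫| * (‖D‖ * Tb)) := by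
      have h2 : |⟪D, c'⟫| ≤ ‖D‖ * Tb := (abs_real_inner_le_norm _ _).trans (by gcongr)
      have h3 : -(⟪z, a - b⟫ * ⟪D, c'⟫) ≤ |⟪z, a - b⟫| * (‖D‖ * Tb) := by
        refine (neg_le_abs _).trans ?_
        rw [abs_mul]; gcongr
      have h4 : 0 ≤ 2 * (η * (K * e)) := by positivity
      linarith only [mul_le_mul_of_nonneg_left h3 h4]
    refine h1.trans ?_
    have h5 : |⟪z, a - b⟫| * (‖D‖ * Tb) ≤ Tb * (L * Cσ * (η * Real.exp K) ^ α * (4 * (n + 2) ^ 2)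
      + S * η * Real.exp K * (4 * (n + 2) ^ 2)) * h := by
      have h6 : |⟪z, a - b⟫| ≤ L * Cσ * ((η * Real.exp K) ^ α * ‖D‖ ^ α) + S * (η * Real.exp K * ‖D‖) := by
        refine hw2.trans ?_
        have h7 : 2 * ‖q‖ ≤ η * Real.exp K * ‖D‖ := by rw [hqn]; gcongr; linarith
        have h8 : (2 * ‖q‖) ^ α ≤ (η * Real.exp K) ^ α * ‖D‖ ^ α := by
          rw [← Real.mul_rpow (by positivity) (norm_nonneg _)]
          exact Real.rpow_le_rpow (by positivity) h7 hα.le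
        have h9 : 2 * S * ‖q‖ = S * (2 * ‖q‖) := by ring
        rw [h9]; gcongr
      calc _ ≤ (L * Cσ * ((η * Real.exp K) ^ α * ‖D‖ ^ α) + S * (η * Real.exp K * ‖D‖)) * (‖D‖ * Tb) := by gcongr
        _ = Tb * (L * Cσ * (η * Real.exp K) ^ α * (‖D‖ ^ α * ‖D‖) + S * η * Real.exp K * (‖D‖ * ‖D‖)) := by ring
        _ ≤ Tb * (L * Cσ * (η * Real.exp K) ^ α * (4 * (n + 2) ^ 2 * h) + S * η * Real.exp K * (4 * (n + 2) ^ 2 * h)) := by gcongr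
        _ = _ := by ring
    calc _ ≤ 2 * (η * (K * e)) * (Tb * (L * Cσ * (η * Real.exp K) ^ α * (4 * (n + 2) ^ 2)
      + S * η * Real.exp K * (4 * (n + 2) ^ 2)) * h) := by gcongr
      _ = η * (K * e * h) * (2 * Tb * (L * Cσ * (η * Real.exp K) ^ α * (4 * (n + 2) ^ 2)
      + S * η * Real.exp K * (4 * (n + 2) ^ 2))) := by ring
      _ ≤ η * (K * e * h) * 1 := by gcongr
      _ = _ := by ring
  have hR3 : (0 + -η * (K ^ 2 * e) * h) * ⟪z, a - b⟫ ^ 2 ≤ 0 := by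
    have : 0 ≤ η * (K ^ 2 * e) * h * ⟪z, a - b⟫ ^ 2 := by positivity
    linarith only [this]
  -- trace part
  set N := H x - H y + (η * f) • cutH θ n c with hN
  have hNa : ∀ a, ⟪N a, a⟫ = ⟪H x a, a⟫ - ⟪H y a, a⟫ + η * f * ⟪cutH θ n c a, a⟫ := fun a => by
    rw [hN]; simp [inner_add_left, inner_sub_left, inner_smul_left]
  have hNn : ∀ a, ⟪N a, a⟫ ≤ 0 := fun a => by
    have := hH a a
    have h1 : (1/2:ℝ) • (a + a) = a := by module
    rw [h1] at this
    simp only [sub_self, inner_zero_right, norm_zero, zero_div, mul_zero, zero_mul, zero_add, ne_eq,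
      OfNat.ofNat_ne_zero, not_false_eq_true, zero_pow] at this
    rw [hNa]; linarith
  have hNz : ⟪N z, z⟫ ≤ -4 * η * (K ^ 2 * e) * h + η * f * ⟪cutH θ n c z, z⟫ := by
    have := hH z (-z)
    have h1 : z - (-z) = (2:ℝ) • z := by module
    rw [h1] at this
    simp only [add_neg_cancel, smul_zero, inner_zero_right, inner_smul_right, norm_smul, map_neg,
      inner_neg_left, inner_neg_right, real_inner_self_eq_norm_sq, hzn] at this
    norm_num at this
    rw [hNa]; linarith
  have htr := tr_le N hNn z hzn
  have hNz0 := hNn z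
  have htrN : tr N = tr (H x) - tr (H y) + η * f * tr (cutH θ n c) := by
    rw [hN, tr_add, tr_sub, tr_smul]
  rw [tr_cutH] at htrN
  rw [inner_cutH] at hNz hR
  rw [← hs] at htrN hNz hR
  have e1 := heq x
  have e2 := heq y
  rw [← ha] at e1
  rw [← hb] at e2
  have hcz : ⟪c, z⟫ ^ 2 ≤ ‖c‖ ^ 2 := by
    have := abs_real_inner_le_norm c z
    rw [hzn, mul_one] at this
    have := pow_le_pow_left₀ (abs_nonneg _) this 2
    rwa [sq_abs] at this
  have hcc : ‖c‖ ^ 2 = θ ^ 2 - s := by rw [hs]; ring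
  rw [hzn] at hNz
  set d := (Module.finrank ℝ E : ℝ) with hd
  have hd0 : 0 ≤ d := by positivity
  have hc'2 : ‖c'‖ ^ 2 ≤ Tb ^ 2 := pow_le_pow_left₀ (norm_nonneg _) hc'n 2
  have hbr : -C1 * h ≤ 4 * (n + 2) * (n + 1) * s ^ n * ‖c‖ ^ 2 - 2 * (n + 2) * s ^ (n + 1) * d
      - 1 / 2 * (4 * (n + 2) * (n + 1) * s ^ n * ⟪c, z⟫ ^ 2 - 2 * (n + 2) * s ^ (n + 1) * 1 ^ 2)
      + (4 * (n + 2) * (n + 1) * s ^ n * ⟪c, c'⟫ ^ 2 - 2 * (n + 2) * s ^ (n + 1) * ‖c'‖ ^ 2) := by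
    have hsn : 0 < s ^ n := by positivity
    have k1 : h = s ^ n * s ^ 2 := by rw [hhs]; ring
    have k2 : s ^ (n + 1) = s ^ n * s := by ring
    rw [k1, k2]
    have hq1 : 0 ≤ 2 * ((n:ℝ) + 2) * (n + 1) * θ ^ 2 - B * s + C1 * s ^ 2 := by
      rw [hC1]; exact improve_quad n B s hθ0
    have hn0 : (0:ℝ) ≤ n := Nat.cast_nonneg n
    have hcoef : 0 ≤ 4 * ((n:ℝ) + 2) * (n + 1) := by positivity
    have i1 : 0 ≤ 4 * ((n:ℝ) + 2) * (n + 1) * ⟪c, c'⟫ ^ 2 := by positivity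
    have i2 := mul_le_mul_of_nonneg_left hcz hcoef
    have i3 : 2 * ((n:ℝ) + 2) * s * ‖c'‖ ^ 2 ≤ 2 * ((n:ℝ) + 2) * s * Tb ^ 2 := by gcongr
    have i4 : 0 ≤ ((n:ℝ) + 2) * s := by positivity
    have hin : 0 ≤ 4 * ((n:ℝ) + 2) * (n + 1) * ‖c‖ ^ 2 - 2 * (n + 2) * s * d
      - 1 / 2 * (4 * (n + 2) * (n + 1) * ⟪c, z⟫ ^ 2 - 2 * (n + 2) * s)
      + (4 * (n + 2) * (n + 1) * ⟪c, c'⟫ ^ 2 - 2 * (n + 2) * s * ‖c'‖ ^ 2) + C1 * s ^ 2 := by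
      rw [hB] at hq1
      rw [hcc] at i2 ⊢
      linarith only [hq1, i1, i2, i3, i4]
    have := mul_nonneg hsn.le hin
    linarith only [this]
  have hbr' := mul_le_mul_of_nonneg_left hbr (by positivity : 0 ≤ η * f)
  have hfin : 0 ≤ η * h * ((C1 + 1) * f + K * e - 2 * (K ^ 2 * e)) := by
    linarith only [hbr', hR, hR1, hR2, hR3, htr, hNz, hNz0, htrN, e1, e2]
  have hneg : (C1 + 1) * f + K * e - 2 * (K ^ 2 * e) < 0 := by
    have h1 : (C1 + 1) * f ≤ (C1 + 1) * e := by gcongr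
    have h2 : (C1 + 1) * e < K ^ 2 * e := by
      apply mul_lt_mul_of_pos_right _ hep
      nlinarith only [hK, hK1]
    have h3 : K * e ≤ K ^ 2 * e := by
      apply mul_le_mul_of_nonneg_right _ hep.le
      nlinarith only [hK1]
    linarith only [h1, h2, h3]
  have : η * h * ((C1 + 1) * f + K * e - 2 * (K ^ 2 * e)) < 0 :=
    mul_neg_of_pos_of_neg (by positivity) hneg
  linarith only [this, hfin]
end Improve

open MeasureTheory Set
set_option linter.unusedSectionVars false

section Improve2
open Filter Topology RealInnerProductSpace
variable {E : Type*} [NormedAddCommGroup E] [InnerProductSpace ℝ E]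

theorem C2.lip {v : E → ℝ} {p : E → E} {H : E → E →L[ℝ] E} (hv : C2 v p H) {L : ℝ}
    (hL : ∀ x, ‖p x‖ ≤ L) (x y : E) : |v x - v y| ≤ L * ‖x - y‖ := by
  have := Convex.norm_image_sub_le_of_norm_hasFDerivWithin_le (𝕜 := ℝ) (f := v)
    (fun x _ => (hv.hv x).hasFDerivWithinAt) (C := L) (s := Set.univ)
    (fun x _ => by simpa using hL x) convex_univ (mem_univ y) (mem_univ x)
  simpa using this

theorem C2.cont {v : E → ℝ} {p : E → E} {H : E → E →L[ℝ] E} (hv : C2 v p H) : Continuous v :=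
  continuous_iff_continuousAt.2 fun x => (hv.hv x).continuousAt

theorem C2.contp {v : E → ℝ} {p : E → E} {H : E → E →L[ℝ] E} (hv : C2 v p H) : Continuous p :=
  continuous_iff_continuousAt.2 fun x => (hv.hp x).continuousAt

theorem deriv_le_of_le {f : ℝ → ℝ} {a b : ℝ} (hf : HasDerivAt f a 0) (h0 : f 0 = 0)
    (h : ∀ s, 0 < s → s ≤ 1 → f s ≤ b * s) : a ≤ b := by
  have := hf.tendsto_slope_zero_right
  refine le_of_tendsto this ?_
  have h1 : Ioc (0:ℝ) 1 ∈ 𝓝[>] (0:ℝ) := Ioc_mem_nhdsGT one_pos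
  filter_upwards [h1] with s hs
  simp only [zero_add, h0, sub_zero, smul_eq_mul]
  rw [inv_mul_le_iff₀ hs.1]
  have := h s hs.1 hs.2
  linarith

theorem C2.sym_deriv {v : E → ℝ} {p : E → E} {H : E → E →L[ℝ] E} (hv : C2 v p H) (c e : E) :
    HasDerivAt (fun s : ℝ => v (c + (s / 2) • e) - v (c - (s / 2) • e)) ⟪p c, e⟫ 0 := by
  have h1 : HasDerivAt (fun s : ℝ => c + (s / 2) • e) ((1/2:ℝ) • e) 0 := by
    simpa using (((hasDerivAt_id (0:ℝ)).div_const 2).smul_const e).const_add c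
  have h2 : HasDerivAt (fun s : ℝ => c - (s / 2) • e) (-((1/2:ℝ) • e)) 0 := by
    simpa using (((hasDerivAt_id (0:ℝ)).div_const 2).smul_const e).const_sub c
  have k1 : HasFDerivAt v (innerSL ℝ (p c)) (c + ((0:ℝ) / 2) • e) := by simpa using hv.hv c
  have k2 : HasFDerivAt v (innerSL ℝ (p c)) (c - ((0:ℝ) / 2) • e) := by simpa using hv.hv c
  have := (k1.comp_hasDerivAt (0:ℝ) h1).sub (k2.comp_hasDerivAt (0:ℝ) h2)
  refine this.congr_deriv ?_
  simp [inner_smul_right]; ring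

theorem C2.grad_le {v : E → ℝ} {p : E → E} {H : E → E →L[ℝ] E} (hv : C2 v p H) (c : E) {M : ℝ}
    (hM : 0 ≤ M) (h : ∀ e : E, ‖e‖ = 1 → ∀ s : ℝ, 0 < s → s ≤ 1 →
      v (c + (s / 2) • e) - v (c - (s / 2) • e) ≤ M * s) : ‖p c‖ ≤ M := by
  by_cases hp : p c = 0
  · simpa [hp] using hM
  have hpn : 0 < ‖p c‖ := norm_pos_iff.2 hp
  have := deriv_le_of_le (hv.sym_deriv c (‖p c‖⁻¹ • p c)) (by simp)
    (h (‖p c‖⁻¹ • p c) (by rw [norm_smul, norm_inv, norm_norm]; exact inv_mul_cancel₀ hpn.ne'))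
  rw [inner_smul_right, real_inner_self_eq_norm_sq] at this
  have e : ‖p c‖⁻¹ * ‖p c‖ ^ 2 = ‖p c‖ := by field_simp
  rwa [e] at this

variable [FiniteDimensional ℝ E]

theorem isCompact_pairs (r R : ℝ) :
    IsCompact {q : E × E | ‖q.1 - q.2‖ ≤ r ∧ ‖(1/2:ℝ) • (q.1 + q.2)‖ ≤ R} := by
  haveI : ProperSpace E := FiniteDimensional.proper_real E
  apply Metric.isCompact_of_isClosed_isBounded
  · apply IsClosed.inter
    · exact isClosed_le (f := fun q : E × E => ‖q.1 - q.2‖) (by fun_prop) continuous_const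
    · exact isClosed_le (f := fun q : E × E => ‖(1/2:ℝ) • (q.1 + q.2)‖) (by fun_prop) continuous_const
  · rw [isBounded_iff_forall_norm_le]
    refine ⟨r + R, ?_⟩
    rintro ⟨x, y⟩ ⟨h1, h2⟩
    simp only at h1 h2
    have hr : 0 ≤ r := (norm_nonneg _).trans h1
    have e1 : x = (1/2:ℝ) • (x + y) + (1/2:ℝ) • (x - y) := by module
    have e2 : y = (1/2:ℝ) • (x + y) - (1/2:ℝ) • (x - y) := by module
    have h3 : ‖(1/2:ℝ) • (x - y)‖ ≤ r := by rw [norm_smul]; norm_num; linarith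
    rw [Prod.norm_def]
    apply max_le
    · simp only; rw [e1]; refine (norm_add_le _ _).trans ?_; linarith
    · simp only; rw [e2]; refine (norm_sub_le _ _).trans ?_; linarith

theorem improve {α L S Cσ θ δ : ℝ} {σ : E → ℝ} (τ0 : E)
    (hα : 0 < α) (hα1 : α < 1) (hS : ∀ q, |σ q| ≤ S) (hC : 0 ≤ Cσ) (hL : 0 < L)
    (hσ : ∀ q q', ‖q‖ ≤ L → ‖q'‖ ≤ L → |σ q - σ q'| ≤ Cσ * ‖q - q'‖ ^ α)
    (hθ0 : 0 < θ) (hθ : θ ≤ 1) (hδ : 0 < δ) :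
    ∃ η' > 0, ∀ (v : E → ℝ) (p : E → E) (H : E → E →L[ℝ] E), C2 v p H → (∀ x, ‖p x‖ ≤ L) →
      (∀ x, tr (H x) + ⟪H x (σ (p x) • p x + τ0), σ (p x) • p x + τ0⟫ = 0) →
      (∀ c e : E, ‖c‖ ≤ θ → ‖e‖ = 1 → v (c + (1/2:ℝ) • e) - v (c - (1/2:ℝ) • e) ≤ L - δ) →
      ∀ c, ‖c‖ ≤ θ / 2 → ‖p c‖ ≤ L - η' := by
  obtain ⟨n, hn⟩ := exists_nat_ge (1 / α)
  have hn' : 1 ≤ ((n:ℝ) + 1) * α := by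
    rw [div_le_iff₀ hα] at hn; nlinarith
  obtain ⟨Tb, hTb⟩ : ∃ Tb, Tb = S * L + ‖τ0‖ := ⟨_, rfl⟩
  obtain ⟨B, hB⟩ : ∃ B : ℝ, B = 2 * (n + 2) * (n + 1) + 2 * (n + 2) * (Module.finrank ℝ E + Tb ^ 2) := ⟨_, rfl⟩
  obtain ⟨C1, hC1⟩ : ∃ C1, C1 = B ^ 2 / θ ^ 2 := ⟨_, rfl⟩
  obtain ⟨K, hK⟩ : ∃ K, K = C1 + 2 := ⟨_, rfl⟩
  have hKp : 0 < K := by rw [hK, hC1]; positivity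
  obtain ⟨η, hη, hη1, hη2, hη3⟩ : ∃ η : ℝ, 0 < η ∧ η * (4 * (n + 2) ^ 2 * L * S ^ 2 * K * Real.exp K) ≤ 1 ∧
    2 * Tb * (L * Cσ * (η * Real.exp K) ^ α * (4 * (n + 2) ^ 2)
      + S * η * Real.exp K * (4 * (n + 2) ^ 2)) ≤ 1 ∧ η * (Real.exp K - 1) ≤ δ := by
    have t1 : ∀ᶠ η in 𝓝 (0:ℝ), η * (4 * (n + 2) ^ 2 * L * S ^ 2 * K * Real.exp K) < 1 := by
      have : Continuous fun η : ℝ => η * (4 * (n + 2) ^ 2 * L * S ^ 2 * K * Real.exp K) := by fun_prop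
      exact (this.tendsto 0).eventually_lt_const (by simp)
    have t2 : ∀ᶠ η in 𝓝 (0:ℝ), 2 * Tb * (L * Cσ * (η * Real.exp K) ^ α * (4 * (n + 2) ^ 2)
      + S * η * Real.exp K * (4 * (n + 2) ^ 2)) < 1 := by
      have h0 : Continuous fun η : ℝ => (η * Real.exp K) ^ α :=
        (Real.continuous_rpow_const hα.le).comp (by fun_prop)
      have : Continuous fun η : ℝ => 2 * Tb * (L * Cσ * (η * Real.exp K) ^ α * (4 * (n + 2) ^ 2)
        + S * η * Real.exp K * (4 * (n + 2) ^ 2)) := by fun_prop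
      exact (this.tendsto 0).eventually_lt_const (by simp [Real.zero_rpow hα.ne'])
    have t3 : ∀ᶠ η in 𝓝 (0:ℝ), η * (Real.exp K - 1) < δ := by
      have : Continuous fun η : ℝ => η * (Real.exp K - 1) := by fun_prop
      exact (this.tendsto 0).eventually_lt_const (by simpa using hδ)
    have t4 : ∀ᶠ η in 𝓝[>] (0:ℝ), 0 < η := self_mem_nhdsWithin
    obtain ⟨η, h⟩ := (((t1.and (t2.and t3)).filter_mono nhdsWithin_le_nhds).and t4).exists
    exact ⟨η, h.2, h.1.1.le, h.1.2.1.le, h.1.2.2.le⟩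
  obtain ⟨h0, hh0⟩ : ∃ h0 : ℝ, h0 = (3 / 4 * θ ^ 2) ^ (n + 2) := ⟨_, rfl⟩
  have hh0p : 0 < h0 := by rw [hh0]; positivity
  refine ⟨min (η * K * h0) L, lt_min (by positivity) hL, ?_⟩
  intro v p H hv hpL heq hfar
  have hbound : ∀ x y : E, ‖x - y‖ ≤ 1 → ‖(1/2:ℝ) • (x + y)‖ ≤ θ →
      v x - v y - L * ‖x - y‖
      - (-η * (Real.exp (K * ‖x - y‖) - 1)) * cutF θ n ((1/2:ℝ) • (x + y)) ≤ 0 := by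
    by_contra hcon
    push Not at hcon
    obtain ⟨x1, y1, hx1, hy1, hpos⟩ := hcon
    set Φ : E × E → ℝ := fun q => v q.1 - v q.2 - L * ‖q.1 - q.2‖
      - (-η * (Real.exp (K * ‖q.1 - q.2‖) - 1)) * cutF θ n ((1/2:ℝ) • (q.1 + q.2)) with hΦ
    have hcut : Continuous (cutF θ n : E → ℝ) := (cut_C2 θ n).cont
    have hvc := hv.cont
    have hΦc : Continuous Φ := by
      have : Continuous fun q : E × E => cutF θ n ((1/2:ℝ) • (q.1 + q.2)) := hcut.comp (by fun_prop)
      fun_prop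
    obtain ⟨⟨x, y⟩, ⟨hx, hy⟩, hmax⟩ := (isCompact_pairs (E := E) 1 θ).exists_isMaxOn
      ⟨(x1, y1), hx1, hy1⟩ hΦc.continuousOn
    have hmax1 : Φ (x1, y1) ≤ Φ (x, y) := hmax ⟨hx1, hy1⟩
    have hpos' : 0 < Φ (x, y) := lt_of_lt_of_le hpos hmax1
    simp only at hx hy
    have hlip := (le_abs_self _).trans (hv.lip hpL x y)
    have hxy : x ≠ y := by
      rintro rfl
      simp [hΦ] at hpos'
    have hc : ‖(1/2:ℝ) • (x + y)‖ < θ := by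
      refine lt_of_le_of_ne hy fun h => ?_
      have : cutF θ n ((1/2:ℝ) • (x + y)) = 0 := by rw [cutF, h]; simp
      simp only [hΦ, this] at hpos'
      linarith
    have hs : 0 ≤ θ ^ 2 - ‖(1/2:ℝ) • (x + y)‖ ^ 2 := by nlinarith only [hc, hθ0, norm_nonneg ((1/2:ℝ) • (x + y))]
    have ht : ‖x - y‖ < 1 := by
      refine lt_of_le_of_ne hx fun h => ?_
      have h1 := hfar ((1/2:ℝ) • (x + y)) (x - y) hy h
      have e1 : (1/2:ℝ) • (x + y) + (1/2:ℝ) • (x - y) = x := by module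
      have e2 : (1/2:ℝ) • (x + y) - (1/2:ℝ) • (x - y) = y := by module
      rw [e1, e2] at h1
      have h2 : cutF θ n ((1/2:ℝ) • (x + y)) ≤ 1 := by
        rw [cutF]; apply pow_le_one₀ hs
        nlinarith only [hθ, hθ0, sq_nonneg ‖(1/2:ℝ) • (x + y)‖]
      simp only [hΦ, h] at hpos'
      rw [mul_one, mul_one] at hpos'
      have h3 : 0 ≤ η * (Real.exp K - 1) := by
        have := Real.add_one_le_exp K
        exact mul_nonneg hη.le (by linarith)
      have h4 := mul_le_mul_of_nonneg_left h2 h3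
      linarith
    refine improve_core hv hα hα1 hn' hS hC hσ hpL heq hθ0 hθ hη hTb hB hC1 hK hη1 hη2 hxy hx hc ?_
    have hnb : {q : E × E | ‖q.1 - q.2‖ ≤ 1 ∧ ‖(1/2:ℝ) • (q.1 + q.2)‖ ≤ θ} ∈ 𝓝 (x, y) := by
      have o1 : ∀ᶠ q : E × E in 𝓝 (x, y), ‖q.1 - q.2‖ < 1 := by
        have : Continuous fun q : E × E => ‖q.1 - q.2‖ := by fun_prop
        exact (this.tendsto (x, y)).eventually_lt_const ht
      have o2 : ∀ᶠ q : E × E in 𝓝 (x, y), ‖(1/2:ℝ) • (q.1 + q.2)‖ < θ := by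
        have : Continuous fun q : E × E => ‖(1/2:ℝ) • (q.1 + q.2)‖ := by fun_prop
        exact (this.tendsto (x, y)).eventually_lt_const hc
      filter_upwards [o1, o2] with q h1 h2 using ⟨h1.le, h2.le⟩
    exact hmax.isLocalMax hnb
  intro c hc
  apply hv.grad_le c (by linarith [min_le_right (η * K * h0) L])
  intro e he s hs0 hs1
  have e1 : (c + (s / 2) • e) - (c - (s / 2) • e) = s • e := by module
  have e2 : (1/2:ℝ) • ((c + (s / 2) • e) + (c - (s / 2) • e)) = c := by module
  have e3 : ‖s • e‖ = s := by rw [norm_smul, he, mul_one, Real.norm_eq_abs, abs_of_pos hs0]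
  have := hbound (c + (s / 2) • e) (c - (s / 2) • e) (by rw [e1, e3]; exact hs1)
    (by rw [e2]; linarith)
  rw [e1, e2, e3] at this
  have k1 : h0 ≤ cutF θ n c := by
    rw [hh0, cutF]
    apply pow_le_pow_left₀ (by positivity)
    nlinarith only [hc, hθ0, norm_nonneg c]
  have k2 : K * s ≤ Real.exp (K * s) - 1 := by
    have := Real.add_one_le_exp (K * s); linarith
  have k3 : η * (K * s) * h0 ≤ η * (Real.exp (K * s) - 1) * cutF θ n c := by
    have : 0 < K * s := by positivity
    apply mul_le_mul _ k1 hh0p.le (mul_nonneg hη.le (by linarith))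
    gcongr
  have k4 := mul_le_mul_of_nonneg_right (min_le_left (η * K * h0) L) hs0.le
  nlinarith only [this, k3, k4]
end Improve2

open MeasureTheory Set
set_option linter.unusedSectionVars false

section Flat
open Filter Topology RealInnerProductSpace
variable {E : Type*} [NormedAddCommGroup E] [InnerProductSpace ℝ E]

theorem normsq_C2 : C2 (fun c : E => ‖c‖ ^ 2) (fun c => (2:ℝ) • c)
    (fun _ => (2:ℝ) • ContinuousLinearMap.id ℝ E) := by
  constructor
  · intro c
    refine (hasFDerivAt_normsq c).congr_fderiv ?_
    ext; simp
  · intro c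
    exact (hasFDerivAt_id c).const_smul (2:ℝ)

theorem C2.sub_lin {v : E → ℝ} {p : E → E} {H : E → E →L[ℝ] E} (hv : C2 v p H) (p0 : E) :
    C2 (fun x => v x - ⟪p0, x⟫) (fun x => p x - p0) H := by
  constructor
  · intro c
    have := (hv.hv c).sub (innerSL ℝ p0).hasFDerivAt
    refine this.congr_fderiv ?_
    ext; simp [inner_sub_left]
  · intro c
    exact (hv.hp c).sub_const p0

theorem rpow_jet {t α : ℝ} (ht : 0 < t) :
    JetAt (fun s => s ^ (1 + α)) t (t ^ (1 + α)) ((1 + α) * t ^ α) ((1 + α) * α * t ^ (α - 1)) := by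
  refine ⟨rfl, fun s => (1 + α) * s ^ α, ?_, rfl, ?_⟩
  · filter_upwards [lt_mem_nhds ht] with s hs
    have := Real.hasDerivAt_rpow_const (x := s) (p := 1 + α) (Or.inl hs.ne')
    simpa using this
  · have := (Real.hasDerivAt_rpow_const (x := t) (p := α) (Or.inl ht.ne')).const_mul (1 + α)
    exact this.congr_deriv (by ring)

variable [FiniteDimensional ℝ E]

set_option maxHeartbeats 1000000 in
theorem flat_core {α L C3 Tb κ K ℓ : ℝ} {τ : E → E}
    {v : E → ℝ} {p : E → E} {H : E → E →L[ℝ] E} {p0 : E} (hv : C2 v p H)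
    (hα : 0 < α) (hα1 : α < 1) (hC3 : 0 ≤ C3) (hTb : ∀ q, ‖q‖ ≤ L → ‖τ q‖ ≤ Tb)
    (hτ : ∀ q q', ‖q‖ ≤ L → ‖q'‖ ≤ L → ‖τ q - τ q'‖ ≤ C3 * ‖q - q'‖ ^ α)
    (hpL : ∀ x, ‖p x‖ ≤ L) (hp0 : ‖p0‖ ≤ L)
    (heq : ∀ x, tr (H x) + ⟪H x (τ (p x)), τ (p x)⟫ = 0)
    (hκ : 0 < κ) (hK : 0 ≤ K) (hℓ : ℓ ≤ 1) (hKℓ : K ≤ ℓ)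
    (hcon : 2 * κ * (Module.finrank ℝ E + Tb ^ 2) + C3 ^ 2 * (8 * κ * L) ^ α < 4 * K * α)
    {x y : E} (hxy : x ≠ y) (ht1 : ‖x - y‖ ≤ 1)
    (hpos : 0 < (v x - ⟪p0, x⟫) - (v y - ⟪p0, y⟫) - (ℓ * ‖x - y‖ - K * ‖x - y‖ ^ (1 + α))
      - κ * ‖(1/2:ℝ) • (x + y)‖ ^ 2)
    (hm : IsLocalMax (fun q : E × E => (v q.1 - ⟪p0, q.1⟫) - (v q.2 - ⟪p0, q.2⟫)
      - (ℓ * ‖q.1 - q.2‖ - K * ‖q.1 - q.2‖ ^ (1 + α))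
      - κ * ‖(1/2:ℝ) • (q.1 + q.2)‖ ^ 2) (x, y)) : False := by
  have hL0 : 0 ≤ L := (norm_nonneg _).trans hp0
  have hw := hv.sub_lin p0
  obtain ⟨t, ht⟩ : ∃ t, t = ‖x - y‖ := ⟨_, rfl⟩
  obtain ⟨c, hc⟩ : ∃ c, c = (1/2:ℝ) • (x + y) := ⟨_, rfl⟩
  obtain ⟨z, hz⟩ : ∃ z, z = t⁻¹ • (x - y) := ⟨_, rfl⟩
  have htp : 0 < t := by rw [ht]; exact norm_pos_iff.2 (sub_ne_zero.2 hxy)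
  have hzn : ‖z‖ = 1 := by
    rw [hz, norm_smul, norm_inv, Real.norm_of_nonneg htp.le, ← ht]; exact inv_mul_cancel₀ htp.ne'
  have hlip := (le_abs_self _).trans (hw.lip (L := 2 * L)
    (fun x => (norm_sub_le _ _).trans (by linarith [hpL x])) x y)
  rw [← ht, ← hc] at hpos
  rw [← ht] at hlip ht1
  have hj0 : JetAt (fun t => ℓ * t - K * t ^ (1 + α)) t (ℓ * t - K * t ^ (1 + α))
      (ℓ - K * ((1 + α) * t ^ α)) (- K * ((1 + α) * α * t ^ (α - 1))) :=
    ((JetAt.smul' ℓ (JetAt.id t)).sub (JetAt.smul' K (rpow_jet htp))).congr rfl (by ring) (by ring)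
  have hj1 := JetAt.const κ t
  rw [ht] at hj0 hj1
  obtain ⟨hpx, hpy, hH⟩ := dbl hw normsq_C2 hxy hj0 hj1 hm ht hz hc rfl
  rw [← ht] at hpx hpy hH
  simp only [zero_mul, add_zero, mul_zero] at hpx hpy hH
  obtain ⟨P, hP⟩ : ∃ P, P = ℓ - K * ((1 + α) * t ^ α) := ⟨_, rfl⟩
  rw [← hP] at hpx hpy hH
  obtain ⟨T, hT⟩ : ∃ T, T = t ^ (α - 1) := ⟨_, rfl⟩
  rw [← hT] at hH
  have hT1 : 1 ≤ T := by
    rw [hT]; exact Real.one_le_rpow_of_pos_of_le_one_of_nonpos htp ht1 (by linarith)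
  have hP1 : P ≤ 1 := by
    have : 0 ≤ K * ((1 + α) * t ^ α) := by positivity
    linarith
  have hpp : p x - p y = (2 * κ) • c := by
    have : p x - p y = (p x - p0) - (p y - p0) := by abel
    rw [this, hpx, hpy]; module
  have hppn : ‖p x - p y‖ = 2 * κ * ‖c‖ := by
    rw [hpp, norm_smul, Real.norm_of_nonneg (by positivity)]
  have hφ : 0 ≤ ℓ * t - K * t ^ (1 + α) := by
    have : t ^ (1 + α) ≤ t := by
      simpa using Real.rpow_le_rpow_of_exponent_ge htp ht1 (by linarith : (1:ℝ) ≤ 1 + α)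
    have h1 := mul_le_mul_of_nonneg_left this hK
    have h2 := mul_le_mul_of_nonneg_right hKℓ htp.le
    linarith
  have hkc : κ * ‖c‖ ^ 2 ≤ 2 * L * t := by linarith
  set a := τ (p x) with ha
  set b := τ (p y) with hb
  have hab : ‖a - b‖ ^ 2 ≤ C3 ^ 2 * ((8 * κ * L) ^ α * t ^ α) := by
    have h1 := hτ _ _ (hpL x) (hpL y)
    rw [hppn] at h1
    have h2 := pow_le_pow_left₀ (norm_nonneg _) h1 2
    refine h2.trans ?_
    rw [mul_pow]
    gcongr
    rw [← Real.mul_rpow (by positivity) htp.le, ← Real.rpow_natCast, ← Real.rpow_mul (by positivity),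
      mul_comm α, Real.rpow_mul (by positivity)]
    apply Real.rpow_le_rpow (by positivity) _ hα.le
    rw [Real.rpow_natCast]
    have := mul_le_mul_of_nonneg_left hkc (by positivity : 0 ≤ 4 * κ)
    nlinarith only [this]
  have hc' : ‖(1/2:ℝ) • (a + b)‖ ≤ Tb := by
    rw [norm_smul]
    have := norm_add_le a b
    have h1 := hTb _ (hpL x); have h2 := hTb _ (hpL y)
    norm_num; linarith
  have hc'2 := pow_le_pow_left₀ (norm_nonneg _) hc' 2
  have hR := hH a b
  have hwz : ⟪z, a - b⟫ ^ 2 ≤ ‖a - b‖ ^ 2 := by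
    have := abs_real_inner_le_norm z (a - b)
    rw [hzn, one_mul] at this
    have := pow_le_pow_left₀ (abs_nonneg _) this 2
    rwa [sq_abs] at this
  have hR1 : P * ((‖a - b‖ ^ 2 - ⟪z, a - b⟫ ^ 2) / t) ≤ C3 ^ 2 * (8 * κ * L) ^ α * T := by
    have h0 : 0 ≤ (‖a - b‖ ^ 2 - ⟪z, a - b⟫ ^ 2) / t := div_nonneg (by linarith) htp.le
    calc _ ≤ 1 * ((‖a - b‖ ^ 2 - ⟪z, a - b⟫ ^ 2) / t) := by gcongr
      _ ≤ (C3 ^ 2 * ((8 * κ * L) ^ α * t ^ α)) / t := by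
          rw [one_mul]; gcongr; linarith [sq_nonneg ⟪z, a - b⟫]
      _ = C3 ^ 2 * (8 * κ * L) ^ α * T := by
          rw [hT, Real.rpow_sub_one htp.ne']; ring
  have hR2 : -K * ((1 + α) * α * T) * ⟪z, a - b⟫ ^ 2 ≤ 0 := by
    have : 0 ≤ K * ((1 + α) * α * T) * ⟪z, a - b⟫ ^ 2 := by positivity
    linarith
  have hR3 : κ * ⟪((2:ℝ) • ContinuousLinearMap.id ℝ E) ((1/2:ℝ) • (a + b)), (1/2:ℝ) • (a + b)⟫ ≤ 2 * κ * Tb ^ 2 := by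
    have : ⟪((2:ℝ) • ContinuousLinearMap.id ℝ E) ((1/2:ℝ) • (a + b)), (1/2:ℝ) • (a + b)⟫ = 2 * ‖(1/2:ℝ) • (a + b)‖ ^ 2 := by
      generalize (1/2:ℝ) • (a + b) = r
      simp [inner_smul_left]
    rw [this]; nlinarith only [hc'2, hκ]
  set N := H x - H y - (2 * κ) • ContinuousLinearMap.id ℝ E with hN
  have hNa : ∀ a, ⟪N a, a⟫ = ⟪H x a, a⟫ - ⟪H y a, a⟫ - 2 * κ * ‖a‖ ^ 2 := fun a => by
    rw [hN]; simp [inner_sub_left, inner_smul_left]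
  have hNn : ∀ a, ⟪N a, a⟫ ≤ 0 := fun a => by
    have := hH a a
    have h1 : (1/2:ℝ) • (a + a) = a := by module
    rw [h1] at this
    simp [inner_smul_left] at this
    rw [hNa]; linarith
  have hNz : ⟪N z, z⟫ ≤ -4 * (K * ((1 + α) * α * T)) := by
    have := hH z (-z)
    have h1 : z - (-z) = (2:ℝ) • z := by module
    rw [h1] at this
    simp only [add_neg_cancel, smul_zero, inner_zero_right, inner_smul_right, norm_smul, map_neg,
      inner_neg_left, inner_neg_right, real_inner_self_eq_norm_sq, hzn] at this
    norm_num at this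
    rw [hNa, hzn]; linarith
  have htr := tr_le N hNn z hzn
  have htrN : tr N = tr (H x) - tr (H y) - 2 * κ * Module.finrank ℝ E := by
    rw [hN, tr_sub, tr_sub, tr_smul, tr_id]
  have e1 := heq x
  have e2 := heq y
  have hα2 : K * α * T ≤ K * ((1 + α) * α * T) := by
    have : 0 ≤ K * α * T * α := by positivity
    linarith only [this]
  have hfin : 0 ≤ 2 * κ * (Module.finrank ℝ E + Tb ^ 2) + C3 ^ 2 * (8 * κ * L) ^ α * T - 4 * K * α * T := by
    linarith only [hα2, htr, htrN, hNz, hR, hR1, hR2, hR3, e1, e2]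
  have h5 : 0 ≤ 2 * κ * (Module.finrank ℝ E + Tb ^ 2) := by positivity
  nlinarith only [hfin, h5, hT1, hcon]

theorem flat {α L C3 Tb ε : ℝ} {τ : E → E}
    (hα : 0 < α) (hα1 : α < 1) (hC3 : 0 ≤ C3) (hTb : ∀ q, ‖q‖ ≤ L → ‖τ q‖ ≤ Tb)
    (hτ : ∀ q q', ‖q‖ ≤ L → ‖q'‖ ≤ L → ‖τ q - τ q'‖ ≤ C3 * ‖q - q'‖ ^ α) (hε : 0 < ε) :
    ∃ δ > 0, ∀ (v : E → ℝ) (p : E → E) (H : E → E →L[ℝ] E) (p0 : E) (c0 : ℝ), C2 v p H →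
      (∀ x, ‖p x‖ ≤ L) → ‖p0‖ ≤ L → (∀ x, tr (H x) + ⟪H x (τ (p x)), τ (p x)⟫ = 0) →
      (∀ y, ‖y‖ ≤ 1 → |v y - c0 - ⟪p0, y⟫| ≤ δ) → ‖p 0 - p0‖ ≤ ε := by
  set Kf : ℝ → ℝ := fun δ => (2 * (8 * δ) * (Module.finrank ℝ E + Tb ^ 2)
    + C3 ^ 2 * (8 * (8 * δ) * L) ^ α) / (4 * α) + |δ| with hKf
  have hKc : Continuous Kf := by
    have h0 : Continuous fun δ : ℝ => (8 * (8 * δ) * L) ^ α :=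
        (Real.continuous_rpow_const hα.le).comp (by fun_prop)
    fun_prop
  have hK0 : Kf 0 = 0 := by simp [hKf, Real.zero_rpow hα.ne']
  obtain ⟨δ, hδ, hℓ1, hℓε⟩ : ∃ δ, 0 < δ ∧ 2 * Kf δ + 2 * δ ≤ 1 ∧ 2 * Kf δ + 2 * δ ≤ ε := by
    have hc : Continuous fun δ => 2 * Kf δ + 2 * δ := by fun_prop
    have t1 := (hc.tendsto 0).eventually_lt_const (u := 1) (by simp [hK0])
    have t2 := (hc.tendsto 0).eventually_lt_const (u := ε) (by simp [hK0, hε])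
    have t4 : ∀ᶠ η in 𝓝[>] (0:ℝ), 0 < η := self_mem_nhdsWithin
    obtain ⟨η, h⟩ := (((t1.and t2).filter_mono nhdsWithin_le_nhds).and t4).exists
    exact ⟨η, h.2, h.1.1.le, h.1.2.le⟩
  refine ⟨δ, hδ, ?_⟩
  intro v p H p0 c0 hv hpL hp0 heq hflat
  have hL0 : 0 ≤ L := (norm_nonneg _).trans hp0
  obtain ⟨κ, hκ⟩ : ∃ κ, κ = 8 * δ := ⟨_, rfl⟩
  obtain ⟨K, hK⟩ : ∃ K, K = Kf δ := ⟨_, rfl⟩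
  obtain ⟨ℓ, hℓ⟩ : ∃ ℓ, ℓ = 2 * K + 2 * δ := ⟨_, rfl⟩
  have hκp : 0 < κ := by rw [hκ]; positivity
  have hKval : K = (2 * κ * (Module.finrank ℝ E + Tb ^ 2) + C3 ^ 2 * (8 * κ * L) ^ α) / (4 * α) + δ := by
    rw [hK, hKf, hκ]; simp only; rw [abs_of_pos hδ]
  have hcon : 2 * κ * (Module.finrank ℝ E + Tb ^ 2) + C3 ^ 2 * (8 * κ * L) ^ α < 4 * K * α := by
    have : 4 * K * α = (2 * κ * (Module.finrank ℝ E + Tb ^ 2) + C3 ^ 2 * (8 * κ * L) ^ α) + 4 * δ * α := by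
      rw [hKval]; field_simp
    rw [this]
    have : 0 < 4 * δ * α := by positivity
    linarith
  have hKp : 0 < K := by
    have : 0 ≤ 2 * κ * (Module.finrank ℝ E + Tb ^ 2) + C3 ^ 2 * (8 * κ * L) ^ α := by positivity
    have h1 : 0 < 4 * K * α := by linarith
    by_contra h
    push Not at h
    nlinarith
  have hw := hv.sub_lin p0
  have hbound : ∀ x y : E, ‖x - y‖ ≤ 1 → ‖(1/2:ℝ) • (x + y)‖ ≤ 1/2 →
      (v x - ⟪p0, x⟫) - (v y - ⟪p0, y⟫) - (ℓ * ‖x - y‖ - K * ‖x - y‖ ^ (1 + α))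
      - κ * ‖(1/2:ℝ) • (x + y)‖ ^ 2 ≤ 0 := by
    by_contra hcon'
    push Not at hcon'
    obtain ⟨x1, y1, hx1, hy1, hpos⟩ := hcon'
    set Φ : E × E → ℝ := fun q => (v q.1 - ⟪p0, q.1⟫) - (v q.2 - ⟪p0, q.2⟫)
      - (ℓ * ‖q.1 - q.2‖ - K * ‖q.1 - q.2‖ ^ (1 + α))
      - κ * ‖(1/2:ℝ) • (q.1 + q.2)‖ ^ 2 with hΦ
    have hvc := hv.cont
    have hΦc : Continuous Φ := by
      have : Continuous fun q : E × E => ‖q.1 - q.2‖ ^ (1 + α) :=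
        (Real.continuous_rpow_const (by linarith)).comp (by fun_prop)
      fun_prop
    obtain ⟨⟨x, y⟩, ⟨hx, hy⟩, hmax⟩ := (isCompact_pairs (E := E) 1 (1/2)).exists_isMaxOn
      ⟨(x1, y1), hx1, hy1⟩ hΦc.continuousOn
    have hmax1 : Φ (x1, y1) ≤ Φ (x, y) := hmax ⟨hx1, hy1⟩
    have hpos' : 0 < Φ (x, y) := lt_of_lt_of_le hpos hmax1
    simp only at hx hy
    have hxy : x ≠ y := by
      rintro rfl
      simp [hΦ, Real.zero_rpow (by linarith : 1 + α ≠ 0)] at hpos'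
      have h9 : ∀ r : E, 0 ≤ κ * ‖r‖ ^ 2 := fun r => by positivity
      exact absurd hpos' (not_lt.2 (h9 _))
    have htp : 0 < ‖x - y‖ := norm_pos_iff.2 (sub_ne_zero.2 hxy)
    have h3 : ‖(1/2:ℝ) • (x - y)‖ ≤ 1/2 := by rw [norm_smul]; norm_num; linarith
    have hxn : ‖x‖ ≤ 1 := by
      have e1 : x = (1/2:ℝ) • (x + y) + (1/2:ℝ) • (x - y) := by module
      rw [e1]; refine (norm_add_le _ _).trans ?_; linarith
    have hyn : ‖y‖ ≤ 1 := by
      have e2 : y = (1/2:ℝ) • (x + y) - (1/2:ℝ) • (x - y) := by module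
      rw [e2]; refine (norm_sub_le _ _).trans ?_; linarith
    have hfx := abs_le.1 (hflat x hxn)
    have hfy := abs_le.1 (hflat y hyn)
    have hφ : 0 ≤ ℓ * ‖x - y‖ - K * ‖x - y‖ ^ (1 + α) := by
      have : ‖x - y‖ ^ (1 + α) ≤ ‖x - y‖ := by
        simpa using Real.rpow_le_rpow_of_exponent_ge htp hx (by linarith : (1:ℝ) ≤ 1 + α)
      have h1 := mul_le_mul_of_nonneg_left this hKp.le
      have h2 : K * ‖x - y‖ ≤ ℓ * ‖x - y‖ := by gcongr; linarith
      linarith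
    have hc : ‖(1/2:ℝ) • (x + y)‖ < 1/2 := by
      refine lt_of_le_of_ne hy fun h => ?_
      simp only [hΦ] at hpos'
      rw [h] at hpos'
      nlinarith
    have ht : ‖x - y‖ < 1 := by
      refine lt_of_le_of_ne hx fun h => ?_
      simp only [hΦ, h, Real.one_rpow] at hpos'
      have : 0 ≤ κ * ‖(1/2:ℝ) • (x + y)‖ ^ 2 := by positivity
      linarith
    refine flat_core hv hα hα1 hC3 hTb hτ hpL hp0 heq hκp hKp.le (ℓ := ℓ) (by rw [hℓ, hK]; exact hℓ1)
      (by linarith) hcon hxy hx hpos' ?_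
    have hnb : {q : E × E | ‖q.1 - q.2‖ ≤ 1 ∧ ‖(1/2:ℝ) • (q.1 + q.2)‖ ≤ 1/2} ∈ 𝓝 (x, y) := by
      have o1 : ∀ᶠ q : E × E in 𝓝 (x, y), ‖q.1 - q.2‖ < 1 := by
        have : Continuous fun q : E × E => ‖q.1 - q.2‖ := by fun_prop
        exact (this.tendsto (x, y)).eventually_lt_const ht
      have o2 : ∀ᶠ q : E × E in 𝓝 (x, y), ‖(1/2:ℝ) • (q.1 + q.2)‖ < 1/2 := by
        have : Continuous fun q : E × E => ‖(1/2:ℝ) • (q.1 + q.2)‖ := by fun_prop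
        exact (this.tendsto (x, y)).eventually_lt_const hc
      filter_upwards [o1, o2] with q h1 h2 using ⟨h1.le, h2.le⟩
    exact hmax.isLocalMax hnb
  apply hw.grad_le 0 hε.le
  intro e he s hs0 hs1
  have e1 : ((0:E) + (s / 2) • e) - (0 - (s / 2) • e) = s • e := by module
  have e2 : (1/2:ℝ) • (((0:E) + (s / 2) • e) + (0 - (s / 2) • e)) = 0 := by module
  have e3 : ‖s • e‖ = s := by rw [norm_smul, he, mul_one, Real.norm_eq_abs, abs_of_pos hs0]
  have := hbound ((0:E) + (s / 2) • e) (0 - (s / 2) • e) (by rw [e1, e3]; exact hs1)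
    (by rw [e2]; norm_num)
  rw [e1, e2, e3] at this
  have k1 : 0 ≤ K * s ^ (1 + α) := by positivity
  have k2 : ℓ * s ≤ ε * s := by gcongr; rw [hℓ, hK]; exact hℓε
  simp only [norm_zero] at this
  norm_num at this ⊢
  linarith
end Flat

open MeasureTheory Set
set_option linter.unusedSectionVars false

section Liou
open Filter Topology RealInnerProductSpace
variable {E : Type*} [NormedAddCommGroup E] [InnerProductSpace ℝ E]

theorem C2.scale {v : E → ℝ} {p : E → E} {H : E → E →L[ℝ] E} (hv : C2 v p H) (x1 : E) {R : ℝ}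
    (hR : R ≠ 0) : C2 (fun y => R⁻¹ * v (x1 + R • y)) (fun y => p (x1 + R • y))
      (fun y => R • H (x1 + R • y)) := by
  have hl : ∀ y, HasFDerivAt (fun y : E => x1 + R • y) (R • ContinuousLinearMap.id ℝ E) y := fun y =>
    ((hasFDerivAt_id y).const_smul R).const_add x1
  constructor
  · intro y
    have := ((hv.hv (x1 + R • y)).comp y (hl y)).const_mul R⁻¹
    refine this.congr_fderiv ?_
    ext a
    simp [hR]
  · intro y
    have := (hv.hp (x1 + R • y)).comp y (hl y)
    refine this.congr_fderiv ?_
    ext a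
    simp

theorem C2.add_const {v : E → ℝ} {p : E → E} {H : E → E →L[ℝ] E} (hv : C2 v p H) (k : ℝ) :
    C2 (fun y => v y + k) p H := ⟨fun x => (hv.hv x).add_const k, hv.hp⟩

theorem halfnorm {e h : E} (he : ‖e‖ = 1) : ‖h + (1/2:ℝ) • e‖ ≤ 1/2 + ⟪e, h⟫ + ‖h‖ ^ 2 := by
  have h1 := abs_le.1 (abs_real_inner_le_norm e h)
  rw [he, one_mul] at h1
  have h2 : 0 ≤ 1/2 + ⟪e, h⟫ + ‖h‖ ^ 2 := by nlinarith [sq_nonneg (‖h‖ - 1/2)]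
  apply abs_le_of_sq_le_sq' _ h2 |>.2
  rw [norm_add_sq_real, inner_smul_right, norm_smul, he, real_inner_comm]
  norm_num
  nlinarith [sq_nonneg (⟪e, h⟫ + ‖h‖ ^ 2)]

theorem flatness {v : E → ℝ} {p : E → E} {H : E → E →L[ℝ] E} (hv : C2 v p H) {L δ : ℝ}
    (hL : ∀ x, ‖p x‖ ≤ L) {c e : E} (he : ‖e‖ = 1)
    (h : L - δ ≤ v (c + (1/2:ℝ) • e) - v (c - (1/2:ℝ) • e)) (y : E) :
    |v y - v (c - (1/2:ℝ) • e) - L / 2 - L * ⟪e, y - c⟫| ≤ δ + L * ‖y - c‖ ^ 2 := by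
  have hL0 : 0 ≤ L := (norm_nonneg _).trans (hL 0)
  have h1 := abs_le.1 (hv.lip hL y (c - (1/2:ℝ) • e))
  have h2 := abs_le.1 (hv.lip hL y (c + (1/2:ℝ) • e))
  have e1 : y - (c - (1/2:ℝ) • e) = (y - c) + (1/2:ℝ) • e := by module
  have e2 : y - (c + (1/2:ℝ) • e) = (y - c) + (1/2:ℝ) • (-e) := by module
  rw [e1] at h1
  rw [e2] at h2
  have k1 := mul_le_mul_of_nonneg_left (halfnorm (h := y - c) he) hL0
  have k2 := mul_le_mul_of_nonneg_left (halfnorm (e := -e) (h := y - c) (by simpa using he)) hL0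
  rw [inner_neg_left] at k2
  have hδ : 0 ≤ δ := by
    have := abs_le.1 (hv.lip hL (c + (1/2:ℝ) • e) (c - (1/2:ℝ) • e))
    have e3 : (c + (1/2:ℝ) • e) - (c - (1/2:ℝ) • e) = e := by module
    rw [e3, he] at this
    linarith
  rw [abs_le]
  constructor <;> linarith

variable [FiniteDimensional ℝ E]

theorem liouville0 {α L S Cσ : ℝ} {σ : E → ℝ} {τ0 : E}
    {v : E → ℝ} {p : E → E} {H : E → E →L[ℝ] E} (hv : C2 v p H)
    (hα : 0 < α) (hα1 : α < 1) (hS : ∀ q, |σ q| ≤ S) (hC : 0 ≤ Cσ)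
    (hσ : ∀ q q', ‖q‖ ≤ L → ‖q'‖ ≤ L → |σ q - σ q'| ≤ Cσ * ‖q - q'‖ ^ α)
    (hpL : ∀ x, ‖p x‖ ≤ L)
    (heq : ∀ x, tr (H x) + ⟪H x (σ (p x) • p x + τ0), σ (p x) • p x + τ0⟫ = 0) (x1 : E) :
    p x1 = p 0 := by
  have hS0 : 0 ≤ S := (abs_nonneg _).trans (hS 0)
  obtain ⟨L0, hL0⟩ : ∃ L0, L0 = ⨆ x, ‖p x‖ := ⟨_, rfl⟩
  have hbdd : BddAbove (Set.range fun x => ‖p x‖) := ⟨L, by rintro _ ⟨x, rfl⟩; exact hpL x⟩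
  have hpL0 : ∀ x, ‖p x‖ ≤ L0 := fun x => by rw [hL0]; exact le_ciSup hbdd x
  have hL0L : L0 ≤ L := by rw [hL0]; exact ciSup_le hpL
  have hL00 : 0 ≤ L0 := (norm_nonneg _).trans (hpL0 0)
  rcases hL00.eq_or_lt with h0 | hL0p
  · have : ∀ x, p x = 0 := fun x => by
      have := hpL0 x; rw [← h0] at this
      exact norm_le_zero_iff.1 this
    rw [this, this]
  have hσ0 : ∀ q q', ‖q‖ ≤ L0 → ‖q'‖ ≤ L0 → |σ q - σ q'| ≤ Cσ * ‖q - q'‖ ^ α :=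
    fun q q' h h' => hσ q q' (h.trans hL0L) (h'.trans hL0L)
  obtain ⟨τ, hτd⟩ : ∃ τ : E → E, τ = fun q => σ q • q + τ0 := ⟨_, rfl⟩
  have hTb : ∀ q, ‖q‖ ≤ L0 → ‖τ q‖ ≤ S * L0 + ‖τ0‖ := fun q hq => by
    rw [hτd]
    refine (norm_add_le _ _).trans ?_
    rw [norm_smul, Real.norm_eq_abs]
    have := mul_le_mul (hS q) hq (norm_nonneg _) hS0
    linarith
  have hτ : ∀ q q', ‖q‖ ≤ L0 → ‖q'‖ ≤ L0 → ‖τ q - τ q'‖ ≤ (Cσ * L0 + S * (2 * L0) ^ (1 - α)) * ‖q - q'‖ ^ α := by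
    intro q q' h h'
    have e : τ q - τ q' = (σ q - σ q') • q + σ q' • (q - q') := by rw [hτd]; module
    rw [e]
    refine (norm_add_le _ _).trans ?_
    rw [norm_smul, norm_smul, Real.norm_eq_abs, Real.norm_eq_abs, add_mul]
    have h1 : ‖q - q'‖ ≤ (2 * L0) ^ (1 - α) * ‖q - q'‖ ^ α := by
      rcases (norm_nonneg (q - q')).eq_or_lt with hz | hz
      · rw [← hz]; positivity
      · have h2 : ‖q - q'‖ ≤ 2 * L0 := (norm_sub_le _ _).trans (by linarith)
        calc ‖q - q'‖ = ‖q - q'‖ ^ (1 - α) * ‖q - q'‖ ^ α := by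
              rw [← Real.rpow_add hz]; simp
          _ ≤ _ := by
              gcongr
    apply add_le_add
    · calc _ ≤ (Cσ * ‖q - q'‖ ^ α) * L0 := by gcongr; exact hσ0 q q' h h'
        _ = _ := by ring
    · calc _ ≤ S * ((2 * L0) ^ (1 - α) * ‖q - q'‖ ^ α) := by gcongr; exact hS q'
        _ = _ := by ring
  have key : ∀ ε > 0, ‖p x1 - p 0‖ ≤ 2 * ε := by
    intro ε hε
    obtain ⟨δ1, hδ1, hflat⟩ := flat (E := E) hα hα1 (by positivity) hTb hτ hε
    obtain ⟨θ, hθ0, hθ1, hθδ⟩ : ∃ θ : ℝ, 0 < θ ∧ θ ≤ 1 ∧ θ * (1 + 9 * L0) ≤ δ1 := by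
      refine ⟨min 1 (δ1 / (1 + 9 * L0)), lt_min one_pos (by positivity), min_le_left _ _, ?_⟩
      rw [← le_div_iff₀ (by positivity)]; exact min_le_right _ _
    obtain ⟨η', hη', himp⟩ := improve (E := E) τ0 hα hα1 hS hC hL0p hσ0 hθ0 hθ1 (by positivity : 0 < θ ^ 2)
    obtain ⟨xs, hxs⟩ : ∃ xs, L0 - η' < ‖p xs‖ := by
      by_contra hcon
      push Not at hcon
      have : L0 ≤ L0 - η' := by nth_rewrite 1 [hL0]; exact ciSup_le hcon
      linarith
    obtain ⟨R, hRp, hR1, hR2⟩ : ∃ R : ℝ, 0 < R ∧ ‖xs‖ ≤ R * (θ / 2) ∧ ‖x1‖ ≤ R * θ := by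
      refine ⟨max 1 (max (‖xs‖ / (θ / 2)) (‖x1‖ / θ)), lt_of_lt_of_le one_pos (le_max_left _ _), ?_, ?_⟩
      · rw [← div_le_iff₀ (by positivity)]; exact (le_max_left _ _).trans (le_max_right _ _)
      · rw [← div_le_iff₀ (by positivity)]; exact (le_max_right _ _).trans (le_max_right _ _)
    have hvR := hv.scale 0 hRp.ne'
    have heqR : ∀ x, tr (R • H (0 + R • x)) + ⟪(R • H (0 + R • x)) (σ (p (0 + R • x)) • p (0 + R • x) + τ0),
        σ (p (0 + R • x)) • p (0 + R • x) + τ0⟫ = 0 := by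
      intro x
      have := heq (0 + R • x)
      rw [tr_smul, smul_apply, real_inner_smul_left, ← mul_add, this, mul_zero]
    have hex : ∃ c e : E, ‖c‖ ≤ θ ∧ ‖e‖ = 1 ∧ L0 - θ ^ 2 ≤
        R⁻¹ * v (0 + R • (c + (1/2:ℝ) • e)) - R⁻¹ * v (0 + R • (c - (1/2:ℝ) • e)) := by
      by_contra hcon
      push Not at hcon
      have := himp _ _ _ hvR (fun x => hpL0 _) heqR (fun c e hc he => (hcon c e hc he).le) (R⁻¹ • xs)
        (by rw [norm_smul, norm_inv, Real.norm_of_nonneg hRp.le, inv_mul_le_iff₀ hRp]; exact hR1)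
      rw [zero_add, smul_smul, mul_inv_cancel₀ hRp.ne', one_smul] at this
      linarith
    obtain ⟨c, e, hc, he, hce⟩ := hex
    have hfl := flatness hvR (fun x => hpL0 _) he hce
    have hbase : ∀ b : E, ‖b‖ ≤ θ → ‖p (R • b) - L0 • e‖ ≤ ε := by
      intro b hb
      have hv2 := hvR.scale b hθ0.ne'
      have := hflat _ _ _ (L0 • e) (θ⁻¹ * (R⁻¹ * v (0 + R • (c - (1/2:ℝ) • e)) + L0 / 2 + L0 * ⟪e, b - c⟫)) hv2
        (fun x => hpL0 _) (by rw [norm_smul, he, mul_one, Real.norm_of_nonneg hL00])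
        (by
          intro x
          have := heqR (b + θ • x)
          rw [hτd]
          simp only
          rw [tr_smul, smul_apply, real_inner_smul_left, ← mul_add, this, mul_zero]) ?_
      · simpa using this
      · intro y hy
        have h1 := hfl (b + θ • y)
        have h2 : ‖b + θ • y - c‖ ≤ 3 * θ := by
          have e1 : ‖θ • y‖ ≤ θ := by
            rw [norm_smul, Real.norm_of_nonneg hθ0.le]; nlinarith
          calc _ ≤ ‖b + θ • y‖ + ‖c‖ := norm_sub_le _ _
            _ ≤ ‖b‖ + ‖θ • y‖ + ‖c‖ := by gcongr; exact norm_add_le _ _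
            _ ≤ _ := by linarith
        have h3 : ‖b + θ • y - c‖ ^ 2 ≤ (3 * θ) ^ 2 := pow_le_pow_left₀ (norm_nonneg _) h2 2
        have h4 : θ ^ 2 + L0 * ‖b + θ • y - c‖ ^ 2 ≤ θ * δ1 := by
          have := mul_le_mul_of_nonneg_left h3 hL00
          nlinarith
        have e2 : b + θ • y - c = (b - c) + θ • y := by abel
        have e3 : ⟪e, b + θ • y - c⟫ = ⟪e, b - c⟫ + θ * ⟪e, y⟫ := by
          rw [e2, inner_add_right, inner_smul_right]
        rw [e3] at h1
        have h5 := h1.trans h4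
        rw [real_inner_smul_left]
        have e4 : θ⁻¹ * (R⁻¹ * v (0 + R • (b + θ • y))) - θ⁻¹ * (R⁻¹ * v (0 + R • (c - (1/2:ℝ) • e)) + L0 / 2 + L0 * ⟪e, b - c⟫)
          - L0 * ⟪e, y⟫ = θ⁻¹ * (R⁻¹ * v (0 + R • (b + θ • y)) - R⁻¹ * v (0 + R • (c - (1/2:ℝ) • e)) - L0 / 2
            - L0 * (⟪e, b - c⟫ + θ * ⟪e, y⟫)) := by
          field_simp; ring
        rw [e4, abs_mul, abs_of_pos (by positivity : 0 < θ⁻¹), inv_mul_le_iff₀ hθ0]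
        exact h5
    have k1 := hbase (R⁻¹ • x1) (by
      rw [norm_smul, norm_inv, Real.norm_of_nonneg hRp.le, inv_mul_le_iff₀ hRp]; exact hR2)
    have k2 := hbase 0 (by simpa using hθ0.le)
    rw [smul_smul, mul_inv_cancel₀ hRp.ne', one_smul] at k1
    rw [smul_zero] at k2
    have e5 : p x1 - p 0 = (p x1 - L0 • e) - (p 0 - L0 • e) := by abel
    rw [e5]
    refine (norm_sub_le _ _).trans (by linarith)
  have : ‖p x1 - p 0‖ ≤ 0 := by
    apply le_of_forall_pos_le_add
    intro ε hε
    have := key (ε / 2) (by positivity)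
    linarith
  exact sub_eq_zero.1 (norm_le_zero_iff.1 this)

/-- Under the Liouville hypotheses the Hessian vanishes. -/
theorem liouville {α L S Cσ : ℝ} {σ : E → ℝ} {τ0 : E}
    {v : E → ℝ} {p : E → E} {H : E → E →L[ℝ] E} (hv : C2 v p H)
    (hα : 0 < α) (hα1 : α < 1) (hS : ∀ q, |σ q| ≤ S) (hC : 0 ≤ Cσ)
    (hσ : ∀ q q', ‖q‖ ≤ L → ‖q'‖ ≤ L → |σ q - σ q'| ≤ Cσ * ‖q - q'‖ ^ α)
    (hpL : ∀ x, ‖p x‖ ≤ L)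
    (heq : ∀ x, tr (H x) + ⟪H x (σ (p x) • p x + τ0), σ (p x) • p x + τ0⟫ = 0) (x : E) :
    H x = 0 := by
  have h1 : p = fun _ => p 0 := funext fun x => liouville0 hv hα hα1 hS hC hσ hpL heq x
  have h2 := hv.hp x
  rw [h1] at h2
  exact h2.unique (hasFDerivAt_const (p 0) x)
end Liou

open MeasureTheory Set
set_option linter.unusedSectionVars false

section Ulim
open Filter Topology RealInnerProductSpace
variable {E : Type*} [NormedAddCommGroup E] [InnerProductSpace ℝ E]
variable {F : Type*} [NormedAddCommGroup F] [NormedSpace ℝ F]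

theorem ulim_exists {X : Type*} [NormedAddCommGroup X] [ProperSpace X] (U : Ultrafilter ℕ) {f : ℕ → X}
    {C : ℝ} (h : ∀ n, ‖f n‖ ≤ C) : ∃ y, Tendsto f U (𝓝 y) := by
  have hc : IsCompact (Metric.closedBall (0 : X) C) := isCompact_closedBall _ _
  obtain ⟨y, -, hy⟩ := hc.ultrafilter_le_nhds (U.map f) (by
    rw [le_principal_iff]
    exact Ultrafilter.mem_map.2 (Filter.univ_mem' fun n => by simpa using h n))
  exact ⟨y, hy⟩

theorem taylor_bd {f : E → F} {f' : E → E →L[ℝ] F} {K a : ℝ} (ha : 0 < a) (hK : 0 ≤ K)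
    (hf : ∀ x, HasFDerivAt f (f' x) x) (h : ∀ x y, ‖f' x - f' y‖ ≤ K * ‖x - y‖ ^ a) (x y : E) :
    ‖f y - f x - f' x (y - x)‖ ≤ K * ‖y - x‖ ^ a * ‖y - x‖ := by
  refine (convex_segment x y).norm_image_sub_le_of_norm_hasFDerivWithin_le'
    (f := f) (f' := f') (fun z _ => (hf z).hasFDerivWithinAt) ?_ (left_mem_segment _ _ _)
    (right_mem_segment _ _ _)
  intro z hz
  refine (h z x).trans ?_
  gcongr
  obtain ⟨t, ht, rfl⟩ := (segment_eq_image' ℝ x y ▸ hz : z ∈ (fun θ : ℝ => x + θ • (y - x)) '' Icc 0 1)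
  simp only [add_sub_cancel_left, norm_smul, Real.norm_eq_abs, abs_of_nonneg ht.1]
  nlinarith [norm_nonneg (y - x), ht.2]

theorem hasFDerivAt_of_taylor {f : E → F} {A : E →L[ℝ] F} {K a : ℝ} (ha : 0 < a) {x : E}
    (h : ∀ y, ‖f y - f x - A (y - x)‖ ≤ K * ‖y - x‖ ^ a * ‖y - x‖) : HasFDerivAt f A x := by
  rw [hasFDerivAt_iff_isLittleO]
  rw [Asymptotics.isLittleO_iff]
  intro c hc
  have : Tendsto (fun y => K * ‖y - x‖ ^ a) (𝓝 x) (𝓝 0) := by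
    have h1 : Continuous (fun y => K * ‖y - x‖ ^ a) :=
      continuous_const.mul ((continuous_norm.comp (continuous_id.sub continuous_const)).rpow_const
        (fun _ => Or.inr ha.le))
    have := h1.tendsto x
    simpa [Real.zero_rpow ha.ne'] using this
  filter_upwards [this.eventually (gt_mem_nhds hc)] with y hy
  refine (h y).trans ?_
  gcongr

theorem ulim_hasFDerivAt {U : Filter ℕ} [U.NeBot] {f : ℕ → E → F} {f' : ℕ → E → E →L[ℝ] F} {K a : ℝ}
    (ha : 0 < a) (hK : 0 ≤ K)
    (hf : ∀ n x, HasFDerivAt (f n) (f' n x) x) (h : ∀ n x y, ‖f' n x - f' n y‖ ≤ K * ‖x - y‖ ^ a)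
    {f0 : E → F} {f0' : E → E →L[ℝ] F} (h0 : ∀ x, Tendsto (fun n => f n x) U (𝓝 (f0 x)))
    (h1 : ∀ x, Tendsto (fun n => f' n x) U (𝓝 (f0' x))) (x : E) : HasFDerivAt f0 (f0' x) x := by
  apply hasFDerivAt_of_taylor ha (K := K)
  intro y
  have h2 : Tendsto (fun n => ‖f n y - f n x - f' n x (y - x)‖) U (𝓝 ‖f0 y - f0 x - f0' x (y - x)‖) := by
    apply Tendsto.norm
    exact ((h0 y).sub (h0 x)).sub
      (((ContinuousLinearMap.apply ℝ F (y - x)).continuous.tendsto _).comp (h1 x))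
  exact le_of_tendsto h2 (Eventually.of_forall fun n => taylor_bd ha hK (hf n) (h n) x y)

theorem C2.lipp {v : E → ℝ} {p : E → E} {H : E → E →L[ℝ] E} (hv : C2 v p H) {B : ℝ}
    (hB : ∀ x, ‖H x‖ ≤ B) (x y : E) : ‖p x - p y‖ ≤ B * ‖x - y‖ :=
  convex_univ.norm_image_sub_le_of_norm_hasFDerivWithin_le
    (fun z _ => (hv.hp z).hasFDerivWithinAt) (fun z _ => hB z) (mem_univ _) (mem_univ _)

variable [FiniteDimensional ℝ E]

theorem ulim_C2 (U : Ultrafilter ℕ) {v : ℕ → E → ℝ} {p : ℕ → E → E} {H : ℕ → E → E →L[ℝ] E}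
    {B0 L B K α : ℝ} (hα : 0 < α) (hK : 0 ≤ K)
    (hv : ∀ n, C2 (v n) (p n) (H n)) (h0 : ∀ n, |v n 0| ≤ B0) (hL : ∀ n x, ‖p n x‖ ≤ L)
    (hB : ∀ n x, ‖H n x‖ ≤ B) (hH : ∀ n x y, ‖H n x - H n y‖ ≤ K * ‖x - y‖ ^ α) :
    ∃ (v0 : E → ℝ) (p0 : E → E) (H0 : E → E →L[ℝ] E), C2 v0 p0 H0 ∧
      (∀ x, Tendsto (fun n => v n x) U (𝓝 (v0 x))) ∧ (∀ x, Tendsto (fun n => p n x) U (𝓝 (p0 x))) ∧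
      (∀ x, Tendsto (fun n => H n x) U (𝓝 (H0 x))) := by
  have : ProperSpace E := FiniteDimensional.proper_real E
  have : ProperSpace (E →L[ℝ] E) := FiniteDimensional.proper_real _
  have e1 : ∀ x, ∃ y, Tendsto (fun n => v n x) U (𝓝 y) := fun x =>
    ulim_exists U (C := B0 + L * ‖x‖) fun n => by
      have := (hv n).lip (hL n) x 0
      rw [sub_zero] at this
      have h2 := abs_add_le (v n x - v n 0) (v n 0)
      rw [sub_add_cancel] at h2
      rw [Real.norm_eq_abs]
      linarith [h0 n]
  have e2 : ∀ x, ∃ y, Tendsto (fun n => p n x) U (𝓝 y) := fun x => ulim_exists U (hL · x)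
  have e3 : ∀ x, ∃ y, Tendsto (fun n => H n x) U (𝓝 y) := fun x => ulim_exists U (hB · x)
  choose v0 hv0 using e1
  choose p0 hp0 using e2
  choose H0 hH0 using e3
  have hB0 : 0 ≤ B := (norm_nonneg _).trans (hB 0 0)
  refine ⟨v0, p0, H0, ⟨?_, ?_⟩, hv0, hp0, hH0⟩
  · intro x
    refine ulim_hasFDerivAt (U := (U : Filter ℕ)) (f := v) (f' := fun n x => innerSL ℝ (p n x)) (K := B) (a := 1)
      one_pos hB0 (fun n => (hv n).hv) ?_ hv0 (f0' := fun x => innerSL ℝ (p0 x)) ?_ x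
    · intro n x y
      rw [← map_sub, innerSL_apply_norm, Real.rpow_one]
      exact (hv n).lipp (hB n) x y
    · intro x
      exact ((innerSL ℝ).continuous.tendsto _).comp (hp0 x)
  · intro x
    exact ulim_hasFDerivAt hα hK (fun n => (hv n).hp) hH hp0 hH0 x

/-- `α`-Hölder Hessian with constant one and bounded gradient gives a Hessian bound. -/
theorem C2.hess_bd {v : E → ℝ} {p : E → E} {H : E → E →L[ℝ] E} (hv : C2 v p H) {L α : ℝ} (hα : 0 < α)
    (hL : ∀ x, ‖p x‖ ≤ L) (hH : ∀ x y, ‖H x - H y‖ ≤ ‖x - y‖ ^ α) (x : E) : ‖H x‖ ≤ 2 * L + 1 := by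
  have hL0 : 0 ≤ L := (norm_nonneg _).trans (hL 0)
  refine ContinuousLinearMap.opNorm_le_of_unit_norm (by positivity) ?_
  intro a ha
  have := taylor_bd hα zero_le_one hv.hp (by simpa using hH) x (x + a)
  simp only [add_sub_cancel_left, ha, Real.one_rpow, mul_one] at this
  have e : H x a = p (x + a) - p x - (p (x + a) - p x - H x a) := by abel
  rw [e]
  refine (norm_sub_le _ _).trans ?_
  have := norm_sub_le (p (x + a)) (p x)
  linarith [hL (x + a), hL x]

theorem tr_continuous : Continuous (tr : (E →L[ℝ] E) → ℝ) := by
  have : (tr : (E →L[ℝ] E) → ℝ) =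
    ((LinearMap.trace ℝ E).comp (ContinuousLinearMap.coeLM ℝ : (E →L[ℝ] E) →ₗ[ℝ] (E →ₗ[ℝ] E))) := by
    ext A; rfl
  rw [this]
  exact LinearMap.continuous_of_finiteDimensional _
end Ulim

open MeasureTheory Set
set_option linter.unusedSectionVars false

section Blow
open Filter Topology RealInnerProductSpace
variable {E : Type*} [NormedAddCommGroup E] [InnerProductSpace ℝ E] [FiniteDimensional ℝ E]

/-- The coefficient vector of the quasilinear equation. -/
noncomputable def tauF (σ : ℝ → ℝ) (p : E → E) (l : E → ℝ) (x : E) : E :=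
  σ (l x + ‖p x‖ ^ 2 / 2) • p x

/-- Solutions of the (rescaled) quasilinear equation with uniform data bounds. -/
structure SS (σ : ℝ → ℝ) (α L lb Λ Fb Cf ρ : ℝ) (u : E → ℝ) (p : E → E) (H : E → E →L[ℝ] E)
    (l f : E → ℝ) : Prop where
  c2 : C2 u p H
  pL : ∀ x, ‖p x‖ ≤ L
  lb : ∀ x, |l x| ≤ lb
  ll : ∀ x y, |l x - l y| ≤ Λ * ρ * ‖x - y‖
  fb : ∀ x, |f x| ≤ Fb * ρ
  fh : ∀ x y, |f x - f y| ≤ Cf * ρ * (‖x - y‖ ^ α + ‖p x - p y‖ ^ α)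
  eq : ∀ x, tr (H x) + ⟪H x (tauF σ p l x), tauF σ p l x⟫ = f x

theorem SS.scale {σ : ℝ → ℝ} {α L lb Λ Fb Cf ρ : ℝ} {u : E → ℝ} {p : E → E} {H : E → E →L[ℝ] E}
    {l f : E → ℝ} (h : SS σ α L lb Λ Fb Cf 1 u p H l f) (hα : 0 < α) (hρ : 0 < ρ) (hρ1 : ρ ≤ 1)
    (hCf : 0 ≤ Cf) (x1 : E) :
    SS σ α L lb Λ Fb Cf ρ (fun y => ρ⁻¹ * u (x1 + ρ • y)) (fun y => p (x1 + ρ • y))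
      (fun y => ρ • H (x1 + ρ • y)) (fun y => l (x1 + ρ • y)) (fun y => ρ * f (x1 + ρ • y)) := by
  have e : ∀ x y : E, ‖x1 + ρ • x - (x1 + ρ • y)‖ = ρ * ‖x - y‖ := by
    intro x y
    rw [add_sub_add_left_eq_sub, ← smul_sub, norm_smul, Real.norm_eq_abs, abs_of_pos hρ]
  refine ⟨h.c2.scale x1 hρ.ne', fun x => h.pL _, fun x => h.lb _, ?_, ?_, ?_, ?_⟩
  · intro x y
    have := h.ll (x1 + ρ • x) (x1 + ρ • y)
    rw [e] at this
    linarith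
  · intro x
    rw [abs_mul, abs_of_pos hρ]
    have := h.fb (x1 + ρ • x)
    nlinarith
  · intro x y
    rw [← mul_sub, abs_mul, abs_of_pos hρ]
    have := h.fh (x1 + ρ • x) (x1 + ρ • y)
    rw [e, Real.mul_rpow hρ.le (norm_nonneg _)] at this
    have h1 : ρ ^ α ≤ 1 := Real.rpow_le_one hρ.le hρ1 hα.le
    have h2 : 0 ≤ ‖x - y‖ ^ α := by positivity
    calc _ ≤ ρ * (Cf * 1 * (ρ ^ α * ‖x - y‖ ^ α + ‖p (x1 + ρ • x) - p (x1 + ρ • y)‖ ^ α)) := by gcongr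
      _ ≤ ρ * (Cf * 1 * (1 * ‖x - y‖ ^ α + ‖p (x1 + ρ • x) - p (x1 + ρ • y)‖ ^ α)) := by gcongr
      _ = _ := by ring
  · intro x
    have := h.eq (x1 + ρ • x)
    simp only [tauF] at this ⊢
    rw [tr_smul, ← this, smul_apply, real_inner_smul_left]
    ring

theorem SS.translate {σ : ℝ → ℝ} {α L lb Λ Fb Cf ρ : ℝ} {u : E → ℝ} {p : E → E} {H : E → E →L[ℝ] E}
    {l f : E → ℝ} (h : SS σ α L lb Λ Fb Cf ρ u p H l f) (x1 : E) :
    SS σ α L lb Λ Fb Cf ρ (fun y => u (x1 + y)) (fun y => p (x1 + y))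
      (fun y => H (x1 + y)) (fun y => l (x1 + y)) (fun y => f (x1 + y)) := by
  have e : ∀ x y : E, ‖x1 + x - (x1 + y)‖ = ‖x - y‖ := by
    intro x y; rw [add_sub_add_left_eq_sub]
  refine ⟨?_, fun x => h.pL _, fun x => h.lb _, ?_, fun x => h.fb _, ?_, fun x => h.eq _⟩
  · simpa using h.c2.scale x1 one_ne_zero
  · intro x y
    have := h.ll (x1 + x) (x1 + y)
    rwa [e] at this
  · intro x y
    have := h.fh (x1 + x) (x1 + y)
    rwa [e] at this

theorem holder_cont {σ : ℝ → ℝ} {CS α : ℝ} (hα : 0 < α) (h : ∀ s t, |σ s - σ t| ≤ CS * |s - t| ^ α) :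
    Continuous σ := by
  rw [continuous_iff_continuousAt]
  intro t
  rw [ContinuousAt, tendsto_iff_norm_sub_tendsto_zero]
  have : Tendsto (fun y => CS * |y - t| ^ α) (𝓝 t) (𝓝 0) := by
    have h1 : Continuous (fun y => CS * |y - t| ^ α) :=
      continuous_const.mul ((continuous_abs.comp (continuous_id.sub continuous_const)).rpow_const
        (fun _ => Or.inr hα.le))
    have := h1.tendsto t
    simpa [Real.zero_rpow hα.ne'] using this
  exact squeeze_zero (fun _ => norm_nonneg _) (fun y => h y t) this

theorem sqdiff {q q' : E} {L : ℝ} (h : ‖q‖ ≤ L) (h' : ‖q'‖ ≤ L) :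
    |‖q‖ ^ 2 / 2 - ‖q'‖ ^ 2 / 2| ≤ L * ‖q - q'‖ := by
  have e : ‖q‖ ^ 2 / 2 - ‖q'‖ ^ 2 / 2 = (‖q‖ + ‖q'‖) / 2 * (‖q‖ - ‖q'‖) := by ring
  have h0 := norm_nonneg q
  have h0' := norm_nonneg q'
  rw [e, abs_mul, abs_of_nonneg (by positivity)]
  have := abs_norm_sub_norm_le q q'
  gcongr <;> linarith

theorem SS.tau_bd {σ : ℝ → ℝ} {α L lb Λ Fb Cf ρ S : ℝ} {u : E → ℝ} {p : E → E} {H : E → E →L[ℝ] E}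
    {l f : E → ℝ} (h : SS σ α L lb Λ Fb Cf ρ u p H l f) (hS : ∀ s, |σ s| ≤ S) (x : E) :
    ‖tauF σ p l x‖ ≤ S * L := by
  have hS0 : 0 ≤ S := (abs_nonneg _).trans (hS 0)
  rw [tauF, norm_smul, Real.norm_eq_abs]
  gcongr
  · exact hS _
  · exact h.pL x

theorem lip_holder {d L α A : ℝ} (hd : 0 ≤ d) (hα : 0 < α) (hα1 : α < 1) (h0 : 0 ≤ L) (h1 : A ≤ 2 * L)
    (h2 : A ≤ (2 * L + 1) * d) : A ≤ (2 * L + 1) * d ^ α := by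
  rcases le_total d 1 with h | h
  · refine h2.trans ?_
    gcongr
    exact Real.self_le_rpow_of_le_one hd h hα1.le
  · have := Real.one_le_rpow h hα.le
    nlinarith

theorem SS.tau_holder {σ : ℝ → ℝ} {α L lb Λ Fb Cf ρ S CS : ℝ} {u : E → ℝ} {p : E → E} {H : E → E →L[ℝ] E}
    {l f : E → ℝ} (h : SS σ α L lb Λ Fb Cf ρ u p H l f) (hα : 0 < α) (hα1 : α < 1) (hρ : 0 < ρ)
    (hρ1 : ρ ≤ 1) (hΛ : 0 ≤ Λ) (hS : ∀ s, |σ s| ≤ S) (hCS : 0 ≤ CS)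
    (hσ : ∀ s t, |σ s - σ t| ≤ CS * |s - t| ^ α)
    (hH : ∀ x y, ‖H x - H y‖ ≤ ‖x - y‖ ^ α) (x y : E) :
    ‖tauF σ p l x - tauF σ p l y‖ ≤
      (CS * (Λ + L * (2 * L + 1)) ^ α * L + S * (2 * L + 1)) * ‖x - y‖ ^ α := by
  have hL0 : 0 ≤ L := (norm_nonneg _).trans (h.pL 0)
  have hS0 : 0 ≤ S := (abs_nonneg _).trans (hS 0)
  have hp1 := h.c2.lipp (h.c2.hess_bd hα h.pL hH) x y
  have hp2 : ‖p x - p y‖ ≤ (2 * L + 1) * ‖x - y‖ ^ α :=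
    lip_holder (norm_nonneg _) hα hα1 hL0 ((norm_sub_le _ _).trans (by linarith [h.pL x, h.pL y])) hp1
  have hs : |(l x + ‖p x‖ ^ 2 / 2) - (l y + ‖p y‖ ^ 2 / 2)| ≤ (Λ + L * (2 * L + 1)) * ‖x - y‖ := by
    have h1 := sqdiff (h.pL x) (h.pL y)
    have h2 := h.ll x y
    have e : (l x + ‖p x‖ ^ 2 / 2) - (l y + ‖p y‖ ^ 2 / 2) =
      (l x - l y) + (‖p x‖ ^ 2 / 2 - ‖p y‖ ^ 2 / 2) := by ring
    rw [e]
    refine (abs_add_le _ _).trans ?_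
    have h3 : Λ * ρ * ‖x - y‖ ≤ Λ * 1 * ‖x - y‖ := by gcongr
    have h4 := mul_le_mul_of_nonneg_left hp1 hL0
    linarith
  have hs2 : |σ (l x + ‖p x‖ ^ 2 / 2) - σ (l y + ‖p y‖ ^ 2 / 2)| ≤
      CS * ((Λ + L * (2 * L + 1)) ^ α * ‖x - y‖ ^ α) := by
    refine (hσ _ _).trans ?_
    rw [← Real.mul_rpow (by positivity) (by positivity)]
    gcongr
  have e : tauF σ p l x - tauF σ p l y = (σ (l x + ‖p x‖ ^ 2 / 2) - σ (l y + ‖p y‖ ^ 2 / 2)) • p x +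
      σ (l y + ‖p y‖ ^ 2 / 2) • (p x - p y) := by simp only [tauF]; module
  rw [e]
  refine (norm_add_le _ _).trans ?_
  rw [norm_smul, norm_smul, Real.norm_eq_abs, Real.norm_eq_abs]
  calc _ ≤ CS * ((Λ + L * (2 * L + 1)) ^ α * ‖x - y‖ ^ α) * L + S * ((2 * L + 1) * ‖x - y‖ ^ α) := by
        gcongr
        · exact h.pL x
        · exact hS _
    _ = _ := by ring

theorem small_hess {σ : ℝ → ℝ} {α L lb Λ Fb Cf S CS : ℝ}
    (hα : 0 < α) (hα1 : α < 1)
    (hΛ : 0 ≤ Λ) (hFb : 0 ≤ Fb) (hS : ∀ s, |σ s| ≤ S) (hCS : 0 ≤ CS)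
    (hσ : ∀ s t, |σ s - σ t| ≤ CS * |s - t| ^ α) {δ : ℝ} (hδ : 0 < δ) :
    ∃ ρ0 > 0, ∀ ρ, 0 < ρ → ρ ≤ ρ0 → ∀ (u : E → ℝ) (p : E → E) (H : E → E →L[ℝ] E) (l f : E → ℝ),
      SS σ α L lb Λ Fb Cf ρ u p H l f → (∀ x y, ‖H x - H y‖ ≤ ‖x - y‖ ^ α) → ∀ x, ‖H x‖ ≤ δ := by
  by_contra hcon
  push Not at hcon
  have hn : ∀ n : ℕ, (0:ℝ) < 1 / (n + 1) := fun n => by positivity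
  choose ρ hρ hρ1 u p H l f hs hH x hx using fun n : ℕ => hcon (1 / (n + 1)) (hn n)
  have hρ0 : Tendsto ρ (hyperfilter ℕ) (𝓝 0) := by
    have : Tendsto ρ atTop (𝓝 0) := squeeze_zero (fun n => (hρ n).le) hρ1
      tendsto_one_div_add_atTop_nhds_zero_nat
    exact this.mono_left Nat.hyperfilter_le_atTop
  obtain ⟨s0, hs0⟩ := ulim_exists (hyperfilter ℕ) (f := fun n => l n (x n)) (C := lb) fun n => (hs n).lb _
  have hT := fun n => (hs n).translate (x n)
  have hL0 : 0 ≤ L := (norm_nonneg _).trans ((hs 0).pL 0)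
  have hH' : ∀ n y z, ‖H n (x n + y) - H n (x n + z)‖ ≤ ‖y - z‖ ^ α := by
    intro n y z
    have := hH n (x n + y) (x n + z)
    rwa [add_sub_add_left_eq_sub] at this
  obtain ⟨v0, p0, H0, hC, -, hp0, hH0⟩ := ulim_C2 (hyperfilter ℕ) (B0 := 0) (L := L) (B := 2 * L + 1) (K := 1)
    hα zero_le_one (fun n => (hT n).c2.add_const (-u n (x n))) (fun n => by simp) (fun n => (hT n).pL)
    (fun n => (hT n).c2.hess_bd hα (hT n).pL (hH' n)) (fun n y z => by simpa using hH' n y z)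
  have hl : ∀ y, Tendsto (fun n => l n (x n + y)) (hyperfilter ℕ) (𝓝 s0) := by
    intro y
    have h1 : Tendsto (fun n => l n (x n + y) - l n (x n)) (hyperfilter ℕ) (𝓝 0) := by
      apply squeeze_zero_norm (a := fun n => Λ * ρ n * ‖y‖)
      · intro n
        simpa using (hs n).ll (x n + y) (x n)
      · simpa using (hρ0.const_mul Λ).mul_const ‖y‖
    simpa using h1.add hs0
  have hσc := holder_cont hα hσ
  have hτ : ∀ y, Tendsto (fun n => tauF σ (fun y => p n (x n + y)) (fun y => l n (x n + y)) y)
      (hyperfilter ℕ) (𝓝 (σ (s0 + ‖p0 y‖ ^ 2 / 2) • p0 y)) := by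
    intro y
    exact ((hσc.tendsto _).comp ((hl y).add (((hp0 y).norm.pow 2).div_const 2))).smul (hp0 y)
  have hlim : ∀ y, tr (H0 y) + ⟪H0 y (σ (s0 + ‖p0 y‖ ^ 2 / 2) • p0 y + 0), σ (s0 + ‖p0 y‖ ^ 2 / 2) • p0 y + 0⟫ = 0 := by
    intro y
    rw [add_zero]
    have h1 : Tendsto (fun n => f n (x n + y)) (hyperfilter ℕ) (𝓝 0) := by
      apply squeeze_zero_norm (a := fun n => Fb * ρ n)
      · intro n; exact (hs n).fb _
      · simpa using hρ0.const_mul Fb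
    refine tendsto_nhds_unique ?_ h1
    have h2 := ((tr_continuous.tendsto _).comp (hH0 y)).add
      (((isBoundedBilinearMap_apply.continuous.tendsto _).comp ((hH0 y).prodMk_nhds (hτ y))).inner (hτ y))
    exact h2.congr fun n => (hT n).eq y
  have hz := liouville (σ := fun q => σ (s0 + ‖q‖ ^ 2 / 2)) (Cσ := CS * L ^ α) (L := L) hC hα hα1
    (fun q => hS _) (by positivity) ?_ ?_ hlim 0
  · have h1 := (hH0 0).norm
    rw [hz, norm_zero] at h1
    have := ge_of_tendsto h1 (Eventually.of_forall fun n => by simpa using (hx n).le)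
    linarith
  · intro q q' hq hq'
    refine (hσ _ _).trans ?_
    rw [mul_assoc, ← Real.mul_rpow hL0 (norm_nonneg _)]
    gcongr
    rw [add_sub_add_left_eq_sub]
    exact sqdiff hq hq'
  · intro y
    exact le_of_tendsto (hp0 y).norm (Eventually.of_forall fun n => (hT n).pL y)
end Blow

open MeasureTheory Set
set_option linter.unusedSectionVars false

section Blow2
open Filter Topology RealInnerProductSpace
variable {E : Type*} [NormedAddCommGroup E] [InnerProductSpace ℝ E]

theorem C2.sub {v : E → ℝ} {p : E → E} {H : E → E →L[ℝ] E} (hv : C2 v p H) {v' : E → ℝ} {p' : E → E}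
    {H' : E → E →L[ℝ] E} (hv' : C2 v' p' H') :
    C2 (fun y => v y - v' y) (fun y => p y - p' y) (fun y => H y - H' y) := by
  refine ⟨fun x => ?_, fun x => (hv.hp x).sub (hv'.hp x)⟩
  rw [map_sub]
  exact (hv.hv x).sub (hv'.hv x)

theorem C2.smul {v : E → ℝ} {p : E → E} {H : E → E →L[ℝ] E} (hv : C2 v p H) (c : ℝ) :
    C2 (fun y => c * v y) (fun y => c • p y) (fun y => c • H y) := by
  refine ⟨fun x => ?_, fun x => (hv.hp x).const_smul c⟩
  have := (hv.hv x).const_mul c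
  refine this.congr_fderiv ?_
  ext a
  simp [real_inner_smul_left]

theorem C2.translate {v : E → ℝ} {p : E → E} {H : E → E →L[ℝ] E} (hv : C2 v p H) (h : E) :
    C2 (fun y => v (h + y)) (fun y => p (h + y)) (fun y => H (h + y)) := by
  simpa using hv.scale h one_ne_zero

theorem additive_zero {X : Type*} [NormedAddCommGroup X] [NormedSpace ℝ X] {K : E → X} {α : ℝ} (hα1 : α < 1)
    (hadd : ∀ h k, K (h + k) = K h + K k) (hb : ∀ h, ‖K h‖ ≤ ‖h‖ ^ α) (h : E) : K h = 0 := by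
  have hn : ∀ n : ℕ, K (((n:ℝ) + 1) • h) = ((n:ℝ) + 1) • K h := by
    intro n
    induction n with
    | zero => simp
    | succ n ih =>
      have e : (((n + 1 : ℕ) : ℝ) + 1) • h = ((n:ℝ) + 1) • h + h := by push_cast; module
      rw [e, hadd, ih]; push_cast; module
  have hle : ∀ n : ℕ, ‖K h‖ ≤ ((n:ℝ) + 1) ^ (-(1 - α)) * ‖h‖ ^ α := by
    intro n
    have hp : (0:ℝ) < (n:ℝ) + 1 := by positivity
    have := hb (((n:ℝ) + 1) • h)
    rw [hn, norm_smul, norm_smul, Real.norm_eq_abs, abs_of_pos hp, Real.mul_rpow hp.le (norm_nonneg _)] at this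
    have e : ((n:ℝ) + 1) ^ (-(1 - α)) = ((n:ℝ) + 1)⁻¹ * ((n:ℝ) + 1) ^ α := by
      rw [neg_sub, Real.rpow_sub hp, Real.rpow_one]; field_simp
    rw [e, mul_assoc, ← div_eq_inv_mul, le_div_iff₀ hp]
    linarith
  have ht : Tendsto (fun n : ℕ => ((n:ℝ) + 1) ^ (-(1 - α)) * ‖h‖ ^ α) atTop (𝓝 0) := by
    have h1 := (tendsto_rpow_neg_atTop (y := 1 - α) (by linarith)).comp
      (tendsto_atTop_add_const_right atTop (1:ℝ) tendsto_natCast_atTop_atTop)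
    simpa using h1.mul_const (‖h‖ ^ α)
  exact norm_le_zero_iff.1 (ge_of_tendsto' ht hle)

theorem secdiff {v : E → ℝ} {p : E → E} {H : E → E →L[ℝ] E} (hv : C2 v p H) {α r : ℝ}
    (hr : 0 < r) (hH : ∀ x y, ‖H x - H y‖ ≤ ‖x - y‖ ^ α) (h k : E) {K : E → E →L[ℝ] E}
    (hK : ∀ y, K y = (r ^ α)⁻¹ • (H (r • y) - H 0)) :
    ∃ (w : E → ℝ) (q : E → E), C2 w q (fun y => K (y + h + k) - K (y + h) - K (y + k) + K y) ∧ w 0 = 0 ∧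
      ∀ y, ‖q y‖ ≤ ‖k‖ ^ α * ‖h‖ := by
  have hrα : 0 < r ^ α := by positivity
  have D := (hv.scale (r • k) hr.ne').sub (hv.scale 0 hr.ne')
  have W := ((D.translate h).sub D).smul (r ^ α * r)⁻¹
  have main : ∀ {w : E → ℝ} {q : E → E} {Hq : E → E →L[ℝ] E}, C2 w q Hq →
      (Hq = fun y => K (y + h + k) - K (y + h) - K (y + k) + K y) → (∀ y, ‖q y‖ ≤ ‖k‖ ^ α * ‖h‖) →
      ∃ (w : E → ℝ) (q : E → E), C2 w q (fun y => K (y + h + k) - K (y + h) - K (y + k) + K y) ∧ w 0 = 0 ∧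
      ∀ y, ‖q y‖ ≤ ‖k‖ ^ α * ‖h‖ := by
    intro w q Hq h1 h2 h3
    subst h2
    exact ⟨_, q, h1.add_const (-w 0), by simp, h3⟩
  refine main W ?_ ?_
  · ext1 y
    simp only [hK]
    have e1 : r • (y + h + k) = r • k + r • (h + y) := by module
    have e2 : r • (y + h) = 0 + r • (h + y) := by module
    have e3 : r • (y + k) = r • k + r • y := by module
    rw [e1, e2, e3, zero_add, zero_add, mul_inv, ← smul_sub, ← smul_sub, ← smul_sub, smul_smul, mul_assoc,
      inv_mul_cancel₀ hr.ne', mul_one]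
    module
  · intro y
    have hB := D.lipp (B := r ^ α * r * ‖k‖ ^ α) (fun z => by
      rw [← smul_sub, norm_smul, Real.norm_eq_abs, abs_of_pos hr]
      have := hH (r • k + r • z) (0 + r • z)
      rw [add_sub_add_right_eq_sub, sub_zero, norm_smul, Real.norm_eq_abs, abs_of_pos hr,
        Real.mul_rpow hr.le (norm_nonneg _)] at this
      calc _ ≤ r * (r ^ α * ‖k‖ ^ α) := by gcongr
        _ = _ := by ring) (h + y) y
    rw [add_sub_cancel_right] at hB
    rw [norm_smul, norm_inv, Real.norm_eq_abs, abs_of_pos (by positivity), inv_mul_le_iff₀ (by positivity)]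
    linarith

variable [FiniteDimensional ℝ E]

theorem lin_zero {α : ℝ} (hα : 0 < α) (hα1 : α < 1) (U : Ultrafilter ℕ) {v : ℕ → E → ℝ} {p : ℕ → E → E}
    {H : ℕ → E → E →L[ℝ] E} (hv : ∀ n, C2 (v n) (p n) (H n)) {r : ℕ → ℝ} (hr : ∀ n, 0 < r n)
    (hH : ∀ n x y, ‖H n x - H n y‖ ≤ ‖x - y‖ ^ α) {K : ℕ → E → E →L[ℝ] E} {τ0 : E}
    (hK : ∀ n y, K n y = (r n ^ α)⁻¹ • (H n (r n • y) - H n 0)) {K0 : E → E →L[ℝ] E}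
    (hlim : ∀ y, Tendsto (fun n => K n y) U (𝓝 (K0 y)))
    (heq : ∀ y, tr (K0 y) + ⟪K0 y τ0, τ0⟫ = 0) (y : E) : K0 y = 0 := by
  have hKh : ∀ n y z, ‖K n y - K n z‖ ≤ ‖y - z‖ ^ α := by
    intro n y z
    rw [hK, hK, ← smul_sub, sub_sub_sub_cancel_right, norm_smul, norm_inv, Real.norm_eq_abs,
      abs_of_pos (Real.rpow_pos_of_pos (hr n) α), inv_mul_le_iff₀ (Real.rpow_pos_of_pos (hr n) α),
      ← Real.mul_rpow (hr n).le (norm_nonneg _)]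
    refine (hH n _ _).trans_eq ?_
    rw [← smul_sub, norm_smul, Real.norm_eq_abs, abs_of_pos (hr n)]
  have hKz : ∀ n, K n 0 = 0 := fun n => by rw [hK]; simp
  have hKh0 : ∀ y z, ‖K0 y - K0 z‖ ≤ ‖y - z‖ ^ α := fun y z =>
    le_of_tendsto ((hlim y).sub (hlim z)).norm (Eventually.of_forall fun n => hKh n y z)
  have hK00 : K0 0 = 0 := by
    have := hlim 0
    simp only [hKz] at this
    exact (tendsto_nhds_unique this tendsto_const_nhds)
  have main : ∀ h k, K0 (0 + h + k) - K0 (0 + h) - K0 (0 + k) + K0 0 = 0 := by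
    intro h k
    choose w q hw hw0 hq using fun n => secdiff (hv n) (hr n) (hH n) h k (hK n)
    have hb1 : ∀ n y, ‖K n (y + h + k) - K n (y + h) - K n (y + k) + K n y‖ ≤ ‖k‖ ^ α + ‖k‖ ^ α := by
      intro n y
      have e : K n (y + h + k) - K n (y + h) - K n (y + k) + K n y =
        (K n (y + h + k) - K n (y + h)) - (K n (y + k) - K n y) := by abel
      rw [e]
      refine (norm_sub_le _ _).trans ?_
      have h1 := hKh n (y + h + k) (y + h)
      have h2 := hKh n (y + k) y
      rw [add_sub_cancel_left] at h1 h2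
      linarith
    have hb2 : ∀ n y z, ‖K n (y + h + k) - K n (y + h) - K n (y + k) + K n y -
          (K n (z + h + k) - K n (z + h) - K n (z + k) + K n z)‖ ≤ 4 * ‖y - z‖ ^ α := by
      intro n y z
      have e : K n (y + h + k) - K n (y + h) - K n (y + k) + K n y -
          (K n (z + h + k) - K n (z + h) - K n (z + k) + K n z) =
        (K n (y + h + k) - K n (z + h + k)) - (K n (y + h) - K n (z + h)) -
          (K n (y + k) - K n (z + k)) + (K n y - K n z) := by abel
      rw [e]
      have h1 := hKh n (y + h + k) (z + h + k)
      have h2 := hKh n (y + k) (z + k)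
      have h3 := hKh n (y + h) (z + h)
      have h4 := hKh n y z
      rw [add_sub_add_right_eq_sub] at h2 h3
      rw [add_sub_add_right_eq_sub, add_sub_add_right_eq_sub] at h1
      refine (norm_add_le _ _).trans ?_
      refine (add_le_add_left ((norm_sub_le _ _).trans (add_le_add_left (norm_sub_le _ _) _)) _).trans ?_
      linarith
    obtain ⟨v0, p0, H0, hC, -, hp0, hH0⟩ := ulim_C2 U (B0 := 0) (L := ‖k‖ ^ α * ‖h‖)
      (B := ‖k‖ ^ α + ‖k‖ ^ α) (K := 4) hα (by norm_num) hw (fun n => by rw [hw0]; simp) hq hb1 hb2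
    have hHe : ∀ y, H0 y = K0 (y + h + k) - K0 (y + h) - K0 (y + k) + K0 y := fun y =>
      tendsto_nhds_unique (hH0 y) ((((hlim _).sub (hlim _)).sub (hlim _)).add (hlim _))
    rw [← hHe]
    refine liouville (σ := fun _ => 0) (τ0 := τ0) (S := 0) (Cσ := 0) (L := ‖k‖ ^ α * ‖h‖) hC hα hα1
      (by simp) le_rfl (by simp) ?_ ?_ 0
    · intro y
      exact le_of_tendsto (hp0 y).norm (Eventually.of_forall fun n => hq n y)
    · intro y
      rw [hHe]
      simp only [zero_smul, zero_add, tr_add, tr_sub, add_apply, sub_apply, inner_add_left, inner_sub_left]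
      linarith [heq (y + h + k), heq (y + h), heq (y + k), heq y]
  refine additive_zero hα1 (K := K0) ?_ ?_ y
  · intro h k
    have := main h k
    rw [hK00, zero_add, zero_add, add_zero, sub_sub, sub_eq_zero] at this
    exact this
  · intro h
    simpa [hK00] using hKh0 h 0
end Blow2

open MeasureTheory Set
set_option linter.unusedSectionVars false

section Blow3
open Filter Topology RealInnerProductSpace
variable {E : Type*} [NormedAddCommGroup E] [InnerProductSpace ℝ E]

theorem quad_diff (A : E →L[ℝ] E) {x y : E} {T : ℝ} (hx : ‖x‖ ≤ T) (hy : ‖y‖ ≤ T) :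
    |⟪A x, x⟫ - ⟪A y, y⟫| ≤ ‖A‖ * (2 * T * ‖x - y‖) := by
  have e : ⟪A x, x⟫ - ⟪A y, y⟫ = ⟪A (x - y), x⟫ + ⟪A y, x - y⟫ := by
    rw [map_sub, inner_sub_left, inner_sub_right]; ring
  rw [e]
  have h1 : |⟪A (x - y), x⟫| ≤ ‖A‖ * ‖x - y‖ * T :=
    (abs_real_inner_le_norm _ _).trans (by gcongr; exact A.le_opNorm _)
  have h2 : |⟪A y, x - y⟫| ≤ ‖A‖ * T * ‖x - y‖ :=
    (abs_real_inner_le_norm _ _).trans (by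
      gcongr
      exact (A.le_opNorm _).trans (by gcongr))
  refine (abs_add_le _ _).trans ?_
  linarith

variable [FiniteDimensional ℝ E]

theorem noblow {σ : ℝ → ℝ} {α L lb Λ Fb Cf S CS : ℝ}
    (hα : 0 < α) (hα1 : α < 1) (hCf : 0 ≤ Cf)
    (hΛ : 0 ≤ Λ) (hFb : 0 ≤ Fb) (hS : ∀ s, |σ s| ≤ S) (hCS : 0 ≤ CS)
    (hσ : ∀ s t, |σ s - σ t| ≤ CS * |s - t| ^ α) :
    ∃ ρ0 > 0, ∀ ρ, 0 < ρ → ρ ≤ ρ0 → ∀ (u : E → ℝ) (p : E → E) (H : E → E →L[ℝ] E) (l f : E → ℝ),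
      SS σ α L lb Λ Fb Cf ρ u p H l f → (∀ x y, ‖H x - H y‖ ≤ ‖x - y‖ ^ α) → ∀ ζ : E, ζ ≠ 0 →
        ‖H ζ - H 0‖ < 1/2 * ‖ζ‖ ^ α := by
  by_contra hcon
  push Not at hcon
  have hn : ∀ n : ℕ, (0:ℝ) < 1 / (n + 1) := fun n => by positivity
  choose ρ hρ hρn u p H l f hs hH ζ hζ0 hζ using fun n : ℕ => hcon (1 / (n + 1)) (hn n)
  have hρ1 : ∀ n, ρ n ≤ 1 := fun n => (hρn n).trans (by
    rw [div_le_one (by positivity)]; linarith [(Nat.cast_nonneg n : (0:ℝ) ≤ n)])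
  have hρ0 : Tendsto ρ (hyperfilter ℕ) (𝓝 0) := by
    have : Tendsto ρ atTop (𝓝 0) := squeeze_zero (fun n => (hρ n).le) hρn
      tendsto_one_div_add_atTop_nhds_zero_nat
    exact this.mono_left Nat.hyperfilter_le_atTop
  have hL0 : 0 ≤ L := (norm_nonneg _).trans ((hs 0).pL 0)
  have hS0 : 0 ≤ S := (abs_nonneg _).trans (hS 0)
  have hsm : ∀ x : ℕ → E, Tendsto (fun n => ‖H n (x n)‖) (hyperfilter ℕ) (𝓝 0) := by
    intro x
    rw [Metric.tendsto_nhds]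
    intro δ hδ
    obtain ⟨r0, hr0, hr⟩ := small_hess (E := E) (σ := σ) (α := α) (L := L) (lb := lb) (Λ := Λ) (Fb := Fb) (Cf := Cf)
      hα hα1 hΛ hFb hS hCS hσ (half_pos hδ)
    filter_upwards [hρ0.eventually (gt_mem_nhds hr0)] with n hn
    have := hr (ρ n) (hρ n) hn.le _ _ _ _ _ (hs n) (hH n) (x n)
    rw [Real.dist_0_eq_abs, abs_norm]
    linarith
  set r : ℕ → ℝ := fun n => ‖ζ n‖ with hrd
  have hr : ∀ n, 0 < r n := fun n => norm_pos_iff.2 (hζ0 n)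
  have hrα : ∀ n, 0 < r n ^ α := fun n => Real.rpow_pos_of_pos (hr n) α
  have hrt : Tendsto (fun n => r n ^ α) (hyperfilter ℕ) (𝓝 0) := by
    have h1 := ((hsm ζ).add (hsm fun _ => 0)).const_mul 2
    simp only [add_zero, mul_zero] at h1
    refine squeeze_zero (fun n => (hrα n).le) (fun n => ?_) h1
    have := norm_sub_le (H n (ζ n)) (H n 0)
    linarith [hζ n]
  set K : ℕ → E → E →L[ℝ] E := fun n y => (r n ^ α)⁻¹ • (H n (r n • y) - H n 0) with hKd
  set Ct : ℝ := (CS * (Λ + L * (2 * L + 1)) ^ α * L + S * (2 * L + 1)) with hCt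
  have hCt0 : 0 ≤ Ct := by positivity
  have hτh : ∀ n y, ‖tauF σ (p n) (l n) (r n • y) - tauF σ (p n) (l n) 0‖ ≤ Ct * (r n ^ α * ‖y‖ ^ α) := by
    intro n y
    have := (hs n).tau_holder hα hα1 (hρ n) (hρ1 n) hΛ hS hCS hσ (hH n) (r n • y) 0
    rwa [sub_zero, norm_smul, Real.norm_eq_abs, abs_of_pos (hr n), Real.mul_rpow (hr n).le (norm_nonneg _)] at this
  have : ProperSpace E := FiniteDimensional.proper_real E
  have : ProperSpace (E →L[ℝ] E) := FiniteDimensional.proper_real _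
  obtain ⟨τ0, hτ0⟩ := ulim_exists (hyperfilter ℕ) (f := fun n => tauF σ (p n) (l n) 0)
    (fun n => (hs n).tau_bd hS 0)
  have hτ : ∀ y, Tendsto (fun n => tauF σ (p n) (l n) (r n • y)) (hyperfilter ℕ) (𝓝 τ0) := by
    intro y
    have h1 : Tendsto (fun n => tauF σ (p n) (l n) (r n • y) - tauF σ (p n) (l n) 0) (hyperfilter ℕ) (𝓝 0) := by
      apply squeeze_zero_norm (hτh · y)
      simpa using (hrt.mul_const (‖y‖ ^ α)).const_mul Ct
    simpa using h1.add hτ0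
  have hKh : ∀ n y z, ‖K n y - K n z‖ ≤ ‖y - z‖ ^ α := by
    intro n y z
    simp only [hKd]
    rw [← smul_sub, sub_sub_sub_cancel_right, norm_smul, norm_inv, Real.norm_eq_abs,
      abs_of_pos (hrα n), inv_mul_le_iff₀ (hrα n), ← Real.mul_rpow (hr n).le (norm_nonneg _)]
    refine (hH n _ _).trans_eq ?_
    rw [← smul_sub, norm_smul, Real.norm_eq_abs, abs_of_pos (hr n)]
  have hKz : ∀ n, K n 0 = 0 := fun n => by simp [hKd]
  have hKb : ∀ n y, ‖K n y‖ ≤ ‖y‖ ^ α := fun n y => by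
    have := hKh n y 0
    rwa [hKz, sub_zero, sub_zero] at this
  choose K0 hK0 using fun y => ulim_exists (hyperfilter ℕ) (f := fun n => K n y) (hKb · y)
  have hR : ∀ n y, tr (K n y) + ⟪K n y (tauF σ (p n) (l n) (r n • y)), tauF σ (p n) (l n) (r n • y)⟫ =
      (r n ^ α)⁻¹ * (f n (r n • y) - f n 0 -
        (⟪H n 0 (tauF σ (p n) (l n) (r n • y)), tauF σ (p n) (l n) (r n • y)⟫ -
          ⟪H n 0 (tauF σ (p n) (l n) 0), tauF σ (p n) (l n) 0⟫)) := by
    intro n y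
    simp only [hKd]
    rw [tr_smul, smul_apply, real_inner_smul_left, sub_apply, inner_sub_left, tr_sub, ← (hs n).eq (r n • y),
      ← (hs n).eq 0]
    ring
  have hR0 : ∀ n y, |(r n ^ α)⁻¹ * (f n (r n • y) - f n 0 -
        (⟪H n 0 (tauF σ (p n) (l n) (r n • y)), tauF σ (p n) (l n) (r n • y)⟫ -
          ⟪H n 0 (tauF σ (p n) (l n) 0), tauF σ (p n) (l n) 0⟫))| ≤
        Cf * ρ n * (‖y‖ ^ α + ((2 * L + 1) * ‖y‖) ^ α) + ‖H n 0‖ * (2 * (S * L) * (Ct * ‖y‖ ^ α)) := by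
    intro n y
    rw [abs_mul, abs_inv, abs_of_pos (hrα n), inv_mul_le_iff₀ (hrα n)]
    refine (abs_sub _ _).trans ?_
    rw [mul_add]
    apply add_le_add
    · have h1 := (hs n).fh (r n • y) 0
      have h2 := (hs n).c2.lipp ((hs n).c2.hess_bd hα (hs n).pL (hH n)) (r n • y) 0
      rw [sub_zero, norm_smul, Real.norm_eq_abs, abs_of_pos (hr n)] at h1 h2
      refine h1.trans ?_
      have h3 : 0 ≤ Cf * ρ n := mul_nonneg hCf (hρ n).le
      have h4 : ‖p n (r n • y) - p n 0‖ ^ α ≤ r n ^ α * ((2 * L + 1) * ‖y‖) ^ α := by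
        rw [← Real.mul_rpow (hr n).le (by positivity)]
        apply Real.rpow_le_rpow (norm_nonneg _) _ hα.le
        linarith
      rw [Real.mul_rpow (hr n).le (norm_nonneg _)]
      calc _ ≤ Cf * ρ n * (r n ^ α * ‖y‖ ^ α + r n ^ α * ((2 * L + 1) * ‖y‖) ^ α) := by gcongr
        _ = _ := by ring
    · refine (quad_diff _ ((hs n).tau_bd hS _) ((hs n).tau_bd hS _)).trans ?_
      calc _ ≤ ‖H n 0‖ * (2 * (S * L) * (Ct * (r n ^ α * ‖y‖ ^ α))) := by
            gcongr
            exact hτh n y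
        _ = _ := by ring
  have heq : ∀ y, tr (K0 y) + ⟪K0 y τ0, τ0⟫ = 0 := by
    intro y
    have h2 := ((tr_continuous.tendsto _).comp (hK0 y)).add
      (((isBoundedBilinearMap_apply.continuous.tendsto _).comp ((hK0 y).prodMk_nhds (hτ y))).inner (hτ y))
    refine tendsto_nhds_unique h2 ?_
    apply squeeze_zero_norm (a := fun n => Cf * ρ n * (‖y‖ ^ α + ((2 * L + 1) * ‖y‖) ^ α) +
      ‖H n 0‖ * (2 * (S * L) * (Ct * ‖y‖ ^ α)))
    · intro n
      refine le_of_eq_of_le ?_ (hR0 n y)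
      rw [← hR n y, Real.norm_eq_abs]
      rfl
    · have h3 := ((hρ0.const_mul Cf).mul_const (‖y‖ ^ α + ((2 * L + 1) * ‖y‖) ^ α)).add
        ((hsm fun _ => 0).mul_const (2 * (S * L) * (Ct * ‖y‖ ^ α)))
      simpa using h3
  have hz := lin_zero hα hα1 (hyperfilter ℕ) (fun n => (hs n).c2) hr hH (K := K) (fun n y => rfl) hK0 heq
  obtain ⟨e, he⟩ := ulim_exists (hyperfilter ℕ) (f := fun n => (r n)⁻¹ • ζ n) (C := 1) (fun n => by
    rw [norm_smul, norm_inv, norm_norm, inv_mul_cancel₀ (hr n).ne'])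
  have h1 : ∀ n, 1/2 ≤ ‖K n e‖ + ‖(r n)⁻¹ • ζ n - e‖ ^ α := by
    intro n
    have h2 : 1/2 ≤ ‖K n ((r n)⁻¹ • ζ n)‖ := by
      simp only [hKd]
      rw [smul_smul, mul_inv_cancel₀ (hr n).ne', one_smul, norm_smul, norm_inv, Real.norm_eq_abs,
        abs_of_pos (hrα n), le_inv_mul_iff₀ (hrα n)]
      linarith [hζ n]
    have h3 := hKh n ((r n)⁻¹ • ζ n) e
    have h4 := norm_sub_norm_le (K n ((r n)⁻¹ • ζ n)) (K n e)
    linarith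
  have h2 : Tendsto (fun n => ‖K n e‖ + ‖(r n)⁻¹ • ζ n - e‖ ^ α) (hyperfilter ℕ) (𝓝 0) := by
    have a1 := (hK0 e).norm
    rw [hz, norm_zero] at a1
    have a2 := (tendsto_iff_norm_sub_tendsto_zero.1 he).rpow_const (p := α) (Or.inr hα.le)
    rw [Real.zero_rpow hα.ne'] at a2
    simpa using a1.add a2
  have := ge_of_tendsto' h2 h1
  norm_num at this

/-- A priori Hölder estimate for the Hessian. -/
theorem apriori {σ : ℝ → ℝ} {α L lb Λ Fb Cf S CS : ℝ}
    (hα : 0 < α) (hα1 : α < 1) (hCf : 0 ≤ Cf)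
    (hΛ : 0 ≤ Λ) (hFb : 0 ≤ Fb) (hS : ∀ s, |σ s| ≤ S) (hCS : 0 ≤ CS)
    (hσ : ∀ s t, |σ s - σ t| ≤ CS * |s - t| ^ α) :
    ∃ N : ℝ, 0 ≤ N ∧ ∀ (u : E → ℝ) (p : E → E) (H : E → E →L[ℝ] E) (l f : E → ℝ),
      SS σ α L lb Λ Fb Cf 1 u p H l f → (∃ C, ∀ x y, ‖H x - H y‖ ≤ C * ‖x - y‖ ^ α) →
        ∀ x y, ‖H x - H y‖ ≤ N * ‖x - y‖ ^ α := by
  obtain ⟨ρ1, hρ1, hno⟩ := noblow (E := E) (σ := σ) (α := α) (L := L) (lb := lb) (Λ := Λ) (Fb := Fb) (Cf := Cf)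
      hα hα1 hCf hΛ hFb hS hCS hσ
  set ρ0 := min ρ1 1 with hρ0d
  have hρ0 : 0 < ρ0 := lt_min hρ1 one_pos
  refine ⟨ρ0 ^ (-(1 + α)), by positivity, ?_⟩
  intro u p H l f hs ⟨C, hC⟩
  by_contra hcon
  push Not at hcon
  obtain ⟨a, b, hab⟩ := hcon
  have hab0 : ∀ {x y : E}, x ≠ y → 0 < ‖x - y‖ ^ α := fun h =>
    Real.rpow_pos_of_pos (norm_pos_iff.2 (sub_ne_zero.2 h)) α
  have hne : a ≠ b := by
    rintro rfl
    simp [Real.zero_rpow hα.ne'] at hab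
  set R : Set ℝ := {t | ∃ x y : E, x ≠ y ∧ t = ‖H x - H y‖ / ‖x - y‖ ^ α} with hR
  have hRb : BddAbove R := ⟨C, by
    rintro t ⟨x, y, hxy, rfl⟩
    rw [div_le_iff₀ (hab0 hxy)]
    exact hC x y⟩
  have hRm : ‖H a - H b‖ / ‖a - b‖ ^ α ∈ R := ⟨a, b, hne, rfl⟩
  set N := sSup R with hN
  have hNge : ρ0 ^ (-(1 + α)) < N := by
    refine lt_of_lt_of_le ?_ (le_csSup hRb hRm)
    rw [lt_div_iff₀ (hab0 hne)]
    exact hab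
  have hN0 : 0 < N := lt_trans (by positivity) hNge
  obtain ⟨t, ⟨x, y, hxy, rfl⟩, ht⟩ := exists_lt_of_lt_csSup ⟨_, hRm⟩ (show N / 2 < sSup R by rw [← hN]; linarith)
  have hNh : ∀ x y, ‖H x - H y‖ ≤ N * ‖x - y‖ ^ α := by
    intro x y
    by_cases h : x = y
    · subst h; simp [Real.zero_rpow hα.ne']
    · rw [← div_le_iff₀ (hab0 h)]
      exact le_csSup hRb ⟨x, y, h, rfl⟩
  set ρ := N ^ (-(1 / (1 + α))) with hρ
  have hρp : 0 < ρ := by positivity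
  have hρN : ρ * (N * ρ ^ α) = 1 := by
    have : ρ ^ (1 + α) = N⁻¹ := by
      rw [hρ, ← Real.rpow_mul hN0.le, ← Real.rpow_neg_one]
      congr 1
      field_simp
    rw [Real.rpow_add hρp, Real.rpow_one] at this
    calc _ = N * (ρ * ρ ^ α) := by ring
      _ = 1 := by rw [this, mul_inv_cancel₀ hN0.ne']
  have hρle : ρ ≤ ρ0 := by
    have : ρ ≤ (ρ0 ^ (-(1 + α))) ^ (-(1 / (1 + α))) := by
      rw [hρ]
      apply Real.rpow_le_rpow_of_nonpos (by positivity) hNge.le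
      have : 0 < 1 / (1 + α) := by positivity
      linarith
    rw [← Real.rpow_mul hρ0.le] at this
    have e : -(1 + α) * -(1 / (1 + α)) = 1 := by field_simp
    rwa [e, Real.rpow_one] at this
  have hsc := hs.scale hα hρp (hρle.trans (min_le_right _ _)) hCf y
  have hz : ρ⁻¹ • (x - y) ≠ 0 := smul_ne_zero (inv_ne_zero hρp.ne') (sub_ne_zero.2 hxy)
  have := hno ρ hρp (hρle.trans (min_le_left _ _)) _ _ _ _ _ hsc ?_ _ hz
  · have e : y + ρ • ρ⁻¹ • (x - y) = x := by
      rw [smul_smul, mul_inv_cancel₀ hρp.ne', one_smul]; abel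
    rw [e, smul_zero, add_zero, ← smul_sub, norm_smul, norm_smul, Real.norm_eq_abs, Real.norm_eq_abs,
      abs_of_pos hρp, abs_of_pos (inv_pos.2 hρp), Real.mul_rpow (by positivity) (norm_nonneg _),
      Real.inv_rpow hρp.le] at this
    rw [lt_div_iff₀ (hab0 hxy)] at ht
    have h1 := mul_lt_mul_of_pos_left ht hρp
    have e2 : (ρ ^ α)⁻¹ = ρ * N := by
      have : ρ ^ α ≠ 0 := by positivity
      symm
      apply eq_inv_of_mul_eq_one_left
      linarith
    rw [e2] at this
    linarith
  · intro z w
    rw [← smul_sub, norm_smul, Real.norm_eq_abs, abs_of_pos hρp]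
    have h1 := hNh (y + ρ • z) (y + ρ • w)
    rw [add_sub_add_left_eq_sub, ← smul_sub, norm_smul, Real.norm_eq_abs, abs_of_pos hρp,
      Real.mul_rpow hρp.le (norm_nonneg _)] at h1
    calc _ ≤ ρ * (N * (ρ ^ α * ‖z - w‖ ^ α)) := by gcongr
      _ = (ρ * (N * ρ ^ α)) * ‖z - w‖ ^ α := by ring
      _ = _ := by rw [hρN, one_mul]
end Blow3

open MeasureTheory Set
set_option linter.unusedSectionVars false

section LipB
open Filter Topology RealInnerProductSpace
variable {E : Type*} [NormedAddCommGroup E] [InnerProductSpace ℝ E]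

theorem zero_C2 : C2 (fun _ : E => (0:ℝ)) (fun _ => 0) (fun _ => 0) :=
  ⟨fun x => by rw [map_zero]; exact hasFDerivAt_const _ _, fun x => hasFDerivAt_const _ _⟩

theorem quad_jet (L K t : ℝ) : JetAt (fun t => L * t - K * (t * t)) t (L * t - K * (t * t)) (L - 2 * K * t) (-(2 * K)) :=
  (((JetAt.id t).smul' L).sub (((JetAt.id t).mul (JetAt.id t)).smul' K)).congr rfl (by ring) (by ring)

variable [FiniteDimensional ℝ E]

set_option maxHeartbeats 1000000 in
theorem lip_apriori {u : E → ℝ} {p : E → E} {H : E → E →L[ℝ] E} (hv : C2 u p H) {Q : Set E} (hQ : IsCompact Q)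
    (hper : ∀ x, ∃ γ : E, (∀ y, u (y + γ) = u y) ∧ x + γ ∈ Q) {m c : E → ℝ} {w : E → E} {ε m0 Wb O : ℝ}
    (hε : 0 < ε) (hm0 : 0 < m0) (hm : ∀ x, m0 ≤ m x) (hc : ∀ x, 0 ≤ c x) (hw : ∀ x, ‖w x‖ ≤ Wb)
    (hO : ∀ x y, u x - u y ≤ O) 
    (heq : ∀ x, tr (H x) + c x * (⟪H x (p x), p x⟫ + ε * ‖p x‖ ^ 2 + ⟪w x, p x⟫) = ε * (1 - 1 / m x)) (x : E) :
    ‖p x‖ ≤ O + 2 * (ε / m0 + ε + Wb) + 2 := by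
  have hWb : 0 ≤ Wb := (norm_nonneg _).trans (hw 0)
  have hO0 : 0 ≤ O := by simpa using hO 0 0
  set K := ε / m0 + ε + Wb with hK
  have hKp : 0 < K := by positivity
  set L := O + 2 * K + 2 with hL
  have main : ∀ x y, ‖x - y‖ ≤ 1 → u x - u y ≤ L * ‖x - y‖ - K * (‖x - y‖ * ‖x - y‖) := by
    by_contra hcon
    push Not at hcon
    obtain ⟨a, b, hab, hab1⟩ := hcon
    set Ψ : E × E → ℝ := fun q => u q.1 - u q.2 - (L * ‖q.1 - q.2‖ - K * (‖q.1 - q.2‖ * ‖q.1 - q.2‖)) with hΨ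
    have hΨc : Continuous Ψ := by
      have := hv.cont
      fun_prop
    haveI : ProperSpace E := FiniteDimensional.proper_real E
    set D : Set (E × E) := (fun q : E × E => (q.1, q.1 + q.2)) '' (Q ×ˢ Metric.closedBall 0 1) with hD
    have hDc : IsCompact D := (hQ.prod (isCompact_closedBall 0 1)).image (by fun_prop)
    have hDm : ∀ {x y : E}, x ∈ Q → ‖x - y‖ ≤ 1 → (x, y) ∈ D := by
      intro x y h1 h2
      refine ⟨(x, y - x), ⟨h1, ?_⟩, by simp⟩
      simpa [norm_sub_rev] using h2
    have hsh : ∀ x y : E, ‖x - y‖ ≤ 1 → ∃ q ∈ D, Ψ q = Ψ (x, y) := by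
      intro x y h
      obtain ⟨γ, hγ, hx⟩ := hper x
      refine ⟨(x + γ, y + γ), hDm hx (by simpa using h), ?_⟩
      simp only [hΨ, hγ, add_sub_add_right_eq_sub]
    obtain ⟨q0, hq0, hq0e⟩ := hsh a b hab
    obtain ⟨⟨x, y⟩, hxyD, hmax⟩ := hDc.exists_isMaxOn ⟨q0, hq0⟩ hΨc.continuousOn
    have hmax' : ∀ x' y', ‖x' - y'‖ ≤ 1 → Ψ (x', y') ≤ Ψ (x, y) := by
      intro x' y' h
      obtain ⟨q, hq, he⟩ := hsh x' y' h
      rw [← he]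
      exact hmax hq
    have hpos : 0 < Ψ (x, y) := lt_of_lt_of_le (by simp only [hΨ]; linarith) (hmax' a b hab)
    have hle1 : ‖x - y‖ ≤ 1 := by
      obtain ⟨⟨q1, q2⟩, ⟨_, h2⟩, h3⟩ := hxyD
      simp only [Prod.mk.injEq] at h3
      obtain ⟨rfl, rfl⟩ := h3
      simpa using h2
    simp only [hΨ] at hpos
    have hne : x ≠ y := by
      rintro rfl
      simp at hpos
    set t := ‖x - y‖ with ht
    have htp : 0 < t := norm_pos_iff.2 (sub_ne_zero.2 hne)
    have hlt : t < 1 := by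
      refine lt_of_le_of_ne hle1 fun h => ?_
      rw [h] at hpos
      have := hO x y
      linarith
    have hlm : IsLocalMax (fun q : E × E => u q.1 - u q.2 - (fun t => L * t - K * (t * t)) ‖q.1 - q.2‖
      - (fun _ => (0:ℝ)) ‖q.1 - q.2‖ * (fun _ => (0:ℝ)) ((1/2:ℝ) • (q.1 + q.2))) (x, y) := by
      have hop : IsOpen {q : E × E | ‖q.1 - q.2‖ < 1} :=
        isOpen_lt (by fun_prop) continuous_const
      filter_upwards [hop.mem_nhds (show (x, y) ∈ {q : E × E | ‖q.1 - q.2‖ < 1} from hlt)] with q hq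
      have := hmax' q.1 q.2 (le_of_lt hq)
      simp only [hΨ] at this
      simpa using this
    set z := t⁻¹ • (x - y) with hz
    obtain ⟨hpx, hpy, hquad⟩ := dbl hv zero_C2 hne (quad_jet L K t) (JetAt.const 0 _) hlm ht hz rfl rfl
    set P := L - 2 * K * t with hP
    have hP1 : 1 ≤ P := by nlinarith only [hKp, hlt, hP, hL, hO0]
    simp only [mul_zero, add_zero, zero_mul, zero_div, smul_zero, sub_zero] at hpx hpy hquad
    have hz1 : ‖z‖ = 1 := by
      rw [hz, norm_smul, norm_inv, Real.norm_eq_abs, abs_of_pos htp, ← ht, inv_mul_cancel₀ htp.ne']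
    have hzz : ⟪z, z⟫ = (1:ℝ) := by rw [real_inner_self_eq_norm_sq, hz1]; norm_num
    have htr : tr (H x - H y) ≤ ⟪(H x - H y) z, z⟫ := by
      apply tr_le _ _ z hz1
      intro a
      have := hquad a a
      simpa [inner_sub_left] using this
    rw [tr_sub, sub_apply, inner_sub_left] at htr
    have ex := heq x
    have ey := heq y
    rw [hpx] at ex
    rw [hpy] at ey
    simp only [map_smul, real_inner_smul_left, inner_smul_right, norm_smul, hz1, Real.norm_eq_abs, mul_one, sq_abs] at ex ey
    set X := ⟪H x z, z⟫ with hX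
    set Y := ⟪H y z, z⟫ with hY
    have hcx := hc x
    have hcy := hc y
    set Ax := 1 + c x * P ^ 2 with hAx
    set Ay := 1 + c y * P ^ 2 with hAy
    have hAx1 : 1 ≤ Ax := by rw [hAx]; exact le_add_of_nonneg_right (mul_nonneg hcx (sq_nonneg P))
    have hAy1 : 1 ≤ Ay := by rw [hAy]; exact le_add_of_nonneg_right (mul_nonneg hcy (sq_nonneg P))
    have hq := hquad (√Ax • z) ((-√Ay) • z)
    rw [← sub_smul, sub_neg_eq_add] at hq
    simp only [map_smul, real_inner_smul_left, inner_smul_right, norm_smul, hz1, Real.norm_eq_abs, mul_one, sq_abs, hzz,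
      sub_self, zero_div, mul_zero, zero_add] at hq
    have s1 : √Ax * √Ax = Ax := Real.mul_self_sqrt (by linarith)
    have s2 : √Ay * √Ay = Ay := Real.mul_self_sqrt (by linarith)
    have hq2 : Ax * X - Ay * Y ≤ -(2 * K) * (Ax + Ay) := by
      have h3 : Ax * X - Ay * Y ≤ -(2 * K) * (√Ax + √Ay) ^ 2 := by
        have i1 : Ax * X = √Ax * (√Ax * X) := by rw [← mul_assoc, s1]
        have i2 : Ay * Y = √Ay * (√Ay * Y) := by rw [← mul_assoc, s2]
        rw [i1, i2]; rw [hX, hY]; linarith only [hq]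
      have h4 : 0 ≤ √Ax * √Ay := by positivity
      have h5 : (√Ax + √Ay) ^ 2 = Ax + Ay + 2 * (√Ax * √Ay) := by
        calc _ = √Ax * √Ax + √Ay * √Ay + 2 * (√Ax * √Ay) := by ring
          _ = _ := by rw [s1, s2]
      rw [h5] at h3
      nlinarith only [h3, h4, hKp]
    have hwx' : |⟪w x, z⟫| ≤ Wb := (abs_real_inner_le_norm (w x) z).trans (by rw [hz1, mul_one]; exact hw x)
    have hwx := abs_le.1 hwx'
    have hwy' : |⟪w y, z⟫| ≤ Wb := (abs_real_inner_le_norm (w y) z).trans (by rw [hz1, mul_one]; exact hw y)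
    have hwy := abs_le.1 hwy'
    have hPP : P ≤ P ^ 2 := by nlinarith only [hP1]
    have b1 : P * ⟪w x, z⟫ ≤ Wb * P ^ 2 := by
      linarith only [mul_le_mul_of_nonneg_left hPP hWb, mul_le_mul_of_nonneg_left hwx.2 (zero_le_one.trans hP1)]
    have b2 : -(Wb * P ^ 2) ≤ P * ⟪w y, z⟫ := by
      linarith only [mul_le_mul_of_nonneg_left hPP hWb, mul_le_mul_of_nonneg_left hwy.1 (zero_le_one.trans hP1)]
    have b3 := mul_le_mul_of_nonneg_left b1 hcx
    have b4 := mul_le_mul_of_nonneg_left b2 hcy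
    have hmx : 1 / m x ≤ 1 / m0 := one_div_le_one_div_of_le hm0 (hm x)
    have hmy : 0 ≤ 1 / m y := by have := hm0.trans_le (hm y); positivity
    have b5 := mul_le_mul_of_nonneg_left hmx hε.le
    have b6 := mul_nonneg hε.le hmy
    have b7 : ε * (1 / m0) = ε / m0 := by ring
    have b8 : 0 ≤ c x * P ^ 2 := by positivity
    have b9 : 0 ≤ c y * P ^ 2 := by positivity
    have hkey : -(ε / m0) - (ε + Wb) * (c x * P ^ 2 + c y * P ^ 2) ≤ Ax * X - Ay * Y := by
      have i1 : Ax * X = X + c x * (P ^ 2 * X) := by rw [hAx]; ring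
      have i2 : Ay * Y = Y + c y * (P ^ 2 * Y) := by rw [hAy]; ring
      rw [i1, i2]
      nlinarith only [ex, ey, htr, b3, b4, b5, b6, b7, b8, b9, mul_nonneg hε.le b8, mul_nonneg hε.le b9]
    have j1 : 0 < ε / m0 := by positivity
    have j2 : (ε + Wb) * (c x * P ^ 2 + c y * P ^ 2) ≤ K * (c x * P ^ 2 + c y * P ^ 2) := by
      apply mul_le_mul_of_nonneg_right _ (by positivity)
      rw [hK]; linarith
    have j3 : ε / m0 ≤ K := by rw [hK]; linarith
    have j4 : 0 ≤ K * (c x * P ^ 2 + c y * P ^ 2) := by positivity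
    have j5 : (2 * K) * (Ax + Ay) = 4 * K + 2 * (K * (c x * P ^ 2 + c y * P ^ 2)) := by rw [hAx, hAy]; ring
    linarith
  refine hv.grad_le x (by positivity) ?_
  intro e he s hs0 hs1
  have e1 : x + (s / 2) • e - (x - (s / 2) • e) = s • e := by module
  have hn : ‖x + (s / 2) • e - (x - (s / 2) • e)‖ = s := by
    rw [e1, norm_smul, he, Real.norm_eq_abs, abs_of_pos hs0, mul_one]
  have := main (x + (s / 2) • e) (x - (s / 2) • e) (by rw [hn]; exact hs1)
  rw [hn] at this
  nlinarith [mul_pos hs0 hs0]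
end LipB

open MeasureTheory Set
set_option linter.unusedSectionVars false

section Gfun
open Filter Topology

theorem rpow_split {d M α : ℝ} (hd : 0 ≤ d) (hM : d ≤ M) (hα : 0 < α) (hα1 : α < 1) : d ≤ M ^ (1 - α) * d ^ α := by
  rcases hd.eq_or_lt with hz | hz
  · rw [← hz, Real.zero_rpow hα.ne', mul_zero]
  · calc d = d ^ (1 - α) * d ^ α := by
          rw [← Real.rpow_add hz]; simp
      _ ≤ _ := by
          gcongr

theorem A2_pos {g : ℝ → ℝ} (h : A2 g) {z : ℝ} (hz : 0 < z) : 0 < deriv g z := by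
  obtain ⟨C1, C2, β, h1, h2, h3, h4⟩ := h
  exact lt_of_lt_of_le (by positivity) (h3 z hz)

theorem g_unbdd {α : ℝ} {g : ℝ → ℝ} (hg : Ghyp α g) (h : A2 g) (T : ℝ) : ∃ M, 1 ≤ M ∧ T ≤ g M := by
  obtain ⟨C1, C2, β, h1, h2, h3, h4⟩ := h
  obtain ⟨hmono, hcont, hdiff, hhol⟩ := hg
  have hda : ∀ z : ℝ, 0 < z → DifferentiableAt ℝ g z := fun z hz =>
    (hdiff z hz).differentiableAt (Ioi_mem_nhds hz)
  rcases le_total (-1) β with hβ | hβ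
  · -- `g - C1 log` is monotone on `[1, ∞)`
    have hm : MonotoneOn (fun z => g z - C1 * Real.log z) (Ici 1) := by
      apply monotoneOn_of_deriv_nonneg (convex_Ici 1)
      · apply ContinuousOn.sub (hcont.mono (Ici_subset_Ici.2 zero_le_one))
        apply ContinuousOn.mul continuousOn_const
        exact Real.continuousOn_log.mono (fun z hz => by
          have : (1:ℝ) ≤ z := hz
          simp; linarith)
      · intro z hz
        rw [interior_Ici] at hz
        have hz0 : (0:ℝ) < z := zero_lt_one.trans hz
        exact ((hda z hz0).sub ((Real.differentiableAt_log hz0.ne').const_mul C1)).differentiableWithinAt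
      · intro z hz
        rw [interior_Ici] at hz
        have hz0 : (0:ℝ) < z := zero_lt_one.trans hz
        rw [show deriv (fun z => g z - C1 * Real.log z) z = deriv g z - C1 * z⁻¹ from
          ((hda z hz0).hasDerivAt.sub ((Real.hasDerivAt_log hz0.ne').const_mul C1)).deriv]
        have := h3 z hz0
        have h5 : z ^ (-1:ℝ) ≤ z ^ β := Real.rpow_le_rpow_of_exponent_le (le_of_lt hz) hβ
        rw [Real.rpow_neg_one] at h5
        have := mul_le_mul_of_nonneg_left h5 h1.le
        linarith
    have ht : Tendsto (fun z => g 1 + C1 * Real.log z) atTop atTop :=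
      tendsto_atTop_add_const_left _ _ (Real.tendsto_log_atTop.const_mul_atTop h1)
    obtain ⟨M, hM1, hM⟩ := ((eventually_ge_atTop (1:ℝ)).and (ht.eventually_ge_atTop T)).exists
    refine ⟨M, hM1, hM.trans ?_⟩
    have := hm (mem_Ici.2 le_rfl) hM1 hM1
    simp only [Real.log_one, mul_zero, sub_zero] at this
    linarith
  · exfalso
    have hm : MonotoneOn (fun z => g z - C1 * Real.log z) (Ioc 0 1) := by
      apply monotoneOn_of_deriv_nonneg (convex_Ioc 0 1)
      · apply ContinuousOn.sub (hcont.mono (fun z hz => hz.1.le))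
        apply ContinuousOn.mul continuousOn_const
        exact Real.continuousOn_log.mono (fun z hz => by simpa using hz.1.ne')
      · intro z hz
        rw [interior_Ioc] at hz
        have hz0 : (0:ℝ) < z := hz.1
        exact ((hda z hz0).sub ((Real.differentiableAt_log hz0.ne').const_mul C1)).differentiableWithinAt
      · intro z hz
        rw [interior_Ioc] at hz
        have hz0 : (0:ℝ) < z := hz.1
        rw [show deriv (fun z => g z - C1 * Real.log z) z = deriv g z - C1 * z⁻¹ from
          ((hda z hz0).hasDerivAt.sub ((Real.hasDerivAt_log hz0.ne').const_mul C1)).deriv]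
        have := h3 z hz0
        have h5 : z ^ (-1:ℝ) ≤ z ^ β := Real.rpow_le_rpow_of_exponent_ge hz0 hz.2.le hβ
        rw [Real.rpow_neg_one] at h5
        have := mul_le_mul_of_nonneg_left h5 h1.le
        linarith
    set a := (g 1 - g 0) / C1 + 1 with ha
    have hg01 : g 0 < g 1 := hmono (mem_Ici.2 le_rfl) (mem_Ici.2 zero_le_one) zero_lt_one
    have ha0 : 0 < a := by
      have : 0 < (g 1 - g 0) / C1 := div_pos (by linarith) h1
      linarith
    have hz1 : Real.exp (-a) ≤ 1 := by rw [Real.exp_le_one_iff]; linarith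
    have := hm ⟨Real.exp_pos (-a), hz1⟩ ⟨zero_lt_one, le_rfl⟩ hz1
    simp only [Real.log_one, mul_zero, sub_zero, Real.log_exp] at this
    have h0 : g 0 < g (Real.exp (-a)) := hmono (mem_Ici.2 le_rfl) (mem_Ici.2 (Real.exp_pos _).le) (Real.exp_pos _)
    have h6 : C1 * a = g 1 - g 0 + C1 := by rw [ha]; field_simp
    linarith

theorem dg_bounds {α : ℝ} (hα : 0 < α) {g : ℝ → ℝ} (hg : Ghyp α g) (hp : ∀ z, 0 < z → 0 < deriv g z) {a b : ℝ}
    (ha : 0 < a) (hab : a ≤ b) : ∃ c D, 0 < c ∧ ∀ z ∈ Icc a b, c ≤ deriv g z ∧ deriv g z ≤ D := by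
  obtain ⟨C, hC0, hC⟩ := hg.2.2.2 (Icc a b) isCompact_Icc (fun z hz => ha.trans_le hz.1)
  have hcont : ContinuousOn (deriv g) (Icc a b) := by
    intro z hz
    rw [ContinuousWithinAt, tendsto_iff_norm_sub_tendsto_zero]
    have h1 : Tendsto (fun y => C * dist y z ^ α) (𝓝[Icc a b] z) (𝓝 0) := by
      have h1 : Continuous (fun y => C * dist y z ^ α) :=
        continuous_const.mul ((continuous_id.dist continuous_const).rpow_const (fun _ => Or.inr hα.le))
      have := (h1.tendsto z).mono_left (nhdsWithin_le_nhds (s := Icc a b))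
      simpa [Real.zero_rpow hα.ne'] using this
    refine squeeze_zero' (Eventually.of_forall fun _ => norm_nonneg _) ?_ h1
    filter_upwards [self_mem_nhdsWithin] with y hy
    exact hC y hy z hz
  obtain ⟨x, hx, hx1⟩ := isCompact_Icc.exists_isMinOn ⟨a, left_mem_Icc.2 hab⟩ hcont
  obtain ⟨y, hy, hy1⟩ := isCompact_Icc.exists_isMaxOn ⟨a, left_mem_Icc.2 hab⟩ hcont
  exact ⟨deriv g x, deriv g y, hp x (ha.trans_le hx.1), fun z hz => ⟨hx1 hz, hy1 hz⟩⟩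

theorem g_inv {α : ℝ} (hα : 0 < α) {g : ℝ → ℝ} (hg : Ghyp α g) (hp : ∀ z, 0 < z → 0 < deriv g z) {a b : ℝ}
    (ha : 0 < a) (hab : a < b) : ∃ G : ℝ → ℝ, (∀ s, G s ∈ Icc a b) ∧ (∀ z ∈ Icc a b, G (g z) = z) ∧
      (∀ s ∈ Icc (g a) (g b), g (G s) = s) ∧ (∀ s ∈ Ioo (g a) (g b), HasDerivAt G (1 / deriv g (G s)) s) ∧
      ∃ CG, 0 ≤ CG ∧ ∀ s t, |G s - G t| ≤ CG * |s - t| := by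
  obtain ⟨c, D, hc, hcD⟩ := dg_bounds hα hg hp ha hab.le
  obtain ⟨hmono, hcont, hdiff, hhol⟩ := hg
  have hsub : Icc a b ⊆ Ici (0:ℝ) := fun z hz => ha.le.trans hz.1
  have hgab : g a ≤ g b := (hmono (ha.le) (ha.le.trans hab.le) hab).le
  have hivt : ∀ s, ∃ z ∈ Icc a b, g z = max (g a) (min (g b) s) := by
    intro s
    have := intermediate_value_Icc hab.le (hcont.mono hsub)
    exact this ⟨le_max_left _ _, max_le hgab (min_le_left _ _)⟩
  choose G hG1 hG2 using hivt
  have hinj : ∀ z ∈ Icc a b, ∀ y ∈ Icc a b, g z = g y → z = y := fun z hz y hy h =>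
    hmono.injOn (hsub hz) (hsub hy) h
  have hclamp : ∀ s ∈ Icc (g a) (g b), max (g a) (min (g b) s) = s := by
    intro s hs
    rw [min_eq_right hs.2, max_eq_right hs.1]
  have hda : ∀ z : ℝ, 0 < z → DifferentiableAt ℝ g z := fun z hz =>
    (hdiff z hz).differentiableAt (Ioi_mem_nhds hz)
  have hmv : ∀ z ∈ Icc a b, ∀ y ∈ Icc a b, z ≤ y → c * (y - z) ≤ g y - g z := by
    intro z hz y hy hzy
    refine (convex_Icc a b).mul_sub_le_image_sub_of_le_deriv (hcont.mono hsub) ?_ ?_ z hz y hy hzy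
    · intro w hw
      rw [interior_Icc] at hw
      exact (hda w (ha.trans hw.1)).differentiableWithinAt
    · intro w hw
      rw [interior_Icc] at hw
      exact (hcD w (Ioo_subset_Icc_self hw)).1
  have hmv2 : ∀ z ∈ Icc a b, ∀ y ∈ Icc a b, c * |y - z| ≤ |g y - g z| := by
    intro z hz y hy
    rcases le_total z y with h | h
    · rw [abs_of_nonneg (sub_nonneg.2 h)]
      exact (hmv z hz y hy h).trans (le_abs_self _)
    · rw [abs_sub_comm, abs_of_nonneg (sub_nonneg.2 h), abs_sub_comm]
      exact (hmv y hy z hz h).trans (le_abs_self _)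
  have hlip : ∀ s t, |G s - G t| ≤ c⁻¹ * |s - t| := by
    intro s t
    have h1 := hmv2 (G t) (hG1 t) (G s) (hG1 s)
    rw [hG2, hG2] at h1
    have h2 : |max (g a) (min (g b) s) - max (g a) (min (g b) t)| ≤ |s - t| := by
      refine (abs_max_sub_max_le_max _ _ _ _).trans (max_le (by simp) ?_)
      exact (abs_min_sub_min_le_max _ _ _ _).trans (max_le (by simp) le_rfl)
    rw [← div_eq_inv_mul, le_div_iff₀ hc]
    linarith
  refine ⟨G, hG1, ?_, ?_, ?_, c⁻¹, by positivity, hlip⟩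
  · intro z hz
    apply hinj _ (hG1 _) _ hz
    rw [hG2, hclamp]
    exact ⟨hmono.monotoneOn ha.le (hsub hz) hz.1, hmono.monotoneOn (hsub hz) (ha.le.trans hab.le) hz.2⟩
  · intro s hs
    rw [hG2, hclamp s hs]
  · intro s hs
    have hGc : Continuous G := by
      have : LipschitzWith (⟨c⁻¹, by positivity⟩ : NNReal) G := LipschitzWith.of_dist_le_mul fun s t => hlip s t
      exact this.continuous
    rw [one_div]
    have hz : 0 < G s := ha.trans_le (hG1 s).1
    refine HasDerivAt.of_local_left_inverse hGc.continuousAt (hda _ hz).hasDerivAt (hp _ hz).ne' ?_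
    filter_upwards [Ioo_mem_nhds hs.1 hs.2] with t ht
    rw [hG2, hclamp t (Ioo_subset_Icc_self ht)]

theorem sig_holder {α : ℝ} (hα : 0 < α) (hα1 : α < 1) {g : ℝ → ℝ} (hg : Ghyp α g)
    (hp : ∀ z, 0 < z → 0 < deriv g z) {a b : ℝ}
    (ha : 0 < a) (hab : a < b) : ∃ S CS : ℝ, 0 ≤ CS ∧
      (∀ z ∈ Icc a b, |1 / √(z * deriv g z)| ≤ S) ∧
      (∀ z ∈ Icc a b, ∀ y ∈ Icc a b, |1 / √(z * deriv g z) - 1 / √(y * deriv g y)| ≤ CS * |z - y| ^ α) := by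
  obtain ⟨c, D, hc, hcD⟩ := dg_bounds hα hg hp ha hab.le
  obtain ⟨C, hC0, hC⟩ := hg.2.2.2 (Icc a b) isCompact_Icc (fun z hz => ha.trans_le hz.1)
  have hs : 0 < √(a * c) := Real.sqrt_pos.2 (by positivity)
  have hlow : ∀ z ∈ Icc a b, √(a * c) ≤ √(z * deriv g z) := by
    intro z hz
    apply Real.sqrt_le_sqrt
    exact mul_le_mul hz.1 (hcD z hz).1 hc.le (ha.le.trans hz.1)
  have hD0 : 0 ≤ D := hc.le.trans ((hcD a (left_mem_Icc.2 hab.le)).1.trans (hcD a (left_mem_Icc.2 hab.le)).2)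
  have hb0 : 0 < b := ha.trans hab
  refine ⟨1 / √(a * c), (b * C + (b ^ (1 - α)) * D) / √(a * c) ^ 3, by positivity, ?_, ?_⟩
  · intro z hz
    rw [abs_of_nonneg (by positivity)]
    exact one_div_le_one_div_of_le hs (hlow z hz)
  · intro z hz y hy
    set A := √(z * deriv g z) with hA
    set B := √(y * deriv g y) with hB
    have hA1 := hlow z hz
    have hB1 := hlow y hy
    set s := √(a * c)
    have hA0 : 0 < A := hs.trans_le hA1
    have hB0 : 0 < B := hs.trans_le hB1
    have hz0 : 0 < z := ha.trans_le hz.1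
    have hy0 : 0 < y := ha.trans_le hy.1
    have hA2 : A * A = z * deriv g z := Real.mul_self_sqrt (mul_pos hz0 (hp z hz0)).le
    have hB2 : B * B = y * deriv g y := Real.mul_self_sqrt (mul_pos hy0 (hp y hy0)).le
    have hk : |z * deriv g z - y * deriv g y| ≤ (b * C + (b ^ (1 - α)) * D) * |z - y| ^ α := by
      have e : z * deriv g z - y * deriv g y = z * (deriv g z - deriv g y) + (z - y) * deriv g y := by ring
      rw [e]
      refine (abs_add_le _ _).trans ?_
      rw [abs_mul, abs_mul, abs_of_pos hz0, abs_of_pos (hp y hy0), add_mul]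
      have h1 := hC z hz y hy
      rw [Real.dist_eq] at h1
      have h2 : |z - y| ≤ b ^ (1 - α) * |z - y| ^ α := rpow_split (abs_nonneg _) (by
        rw [abs_le]; constructor <;> linarith [hz.1, hz.2, hy.1, hy.2]) hα hα1
      apply add_le_add
      · calc _ ≤ b * (C * |z - y| ^ α) := by
              gcongr
              exact hz.2
          _ = _ := by ring
      · calc _ ≤ (b ^ (1 - α) * |z - y| ^ α) * D :=
              mul_le_mul h2 (hcD y hy).2 (hp y hy0).le (by positivity)
          _ = _ := by ring
    have e : 1 / A - 1 / B = (B * B - A * A) / (A * B * (A + B)) := by field_simp; ring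
    rw [e, hA2, hB2, abs_div, abs_of_pos (show 0 < A * B * (A + B) by positivity), abs_sub_comm,
      div_mul_eq_mul_div]
    gcongr
    calc s ^ 3 = s * s * s := by ring
      _ ≤ A * B * (A + B) := by
        gcongr
        linarith
end Gfun

open MeasureTheory Set
set_option linter.unusedSectionVars false

section Conv
open Filter Topology RealInnerProductSpace

noncomputable def gradE (d : ℕ) (f : (Fin d → ℝ) → ℝ) (x : EuclideanSpace ℝ (Fin d)) : EuclideanSpace ℝ (Fin d) :=
  WithLp.toLp 2 (fun i => pd d i f (WithLp.ofLp x))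

theorem gradE_apply (d : ℕ) (f : (Fin d → ℝ) → ℝ) (x : EuclideanSpace ℝ (Fin d)) (i : Fin d) :
    gradE d f x i = pd d i f (WithLp.ofLp x) := rfl

theorem inner_coord {d : ℕ} (x y : EuclideanSpace ℝ (Fin d)) : ⟪x, y⟫ = ∑ i, x i * y i := by
  rw [PiLp.inner_apply]
  refine Finset.sum_congr rfl fun i _ => ?_
  simp [mul_comm]

theorem norm_le_coord {d : ℕ} (x : EuclideanSpace ℝ (Fin d)) : ‖x‖ ≤ ∑ i, |x i| := by
  have h : x = ∑ i, x i • EuclideanSpace.single i (1:ℝ) := by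
    ext j
    simp [Finset.sum_apply, Pi.single_apply]
  calc ‖x‖ = ‖∑ i, x i • EuclideanSpace.single i (1:ℝ)‖ := by rw [← h]
    _ ≤ ∑ i, ‖x i • EuclideanSpace.single i (1:ℝ)‖ := norm_sum_le _ _
    _ = _ := by
      refine Finset.sum_congr rfl fun i _ => ?_
      rw [norm_smul]; simp

theorem coord_le {d : ℕ} (x : EuclideanSpace ℝ (Fin d)) (i : Fin d) : |x i| ≤ ‖x‖ := by
  have := PiLp.norm_apply_le x i
  simpa using this

theorem gradE_hasFDerivAt {d : ℕ} {f : (Fin d → ℝ) → ℝ} (hf : Differentiable ℝ f) (x : EuclideanSpace ℝ (Fin d)) :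
    HasFDerivAt (fun y : EuclideanSpace ℝ (Fin d) => f (WithLp.ofLp y)) (innerSL ℝ (gradE d f x)) x := by
  have h1 := (hf (WithLp.ofLp x)).hasFDerivAt
  have h2 : HasFDerivAt (fun y : EuclideanSpace ℝ (Fin d) => WithLp.ofLp y)
    ((EuclideanSpace.equiv (Fin d) ℝ) : EuclideanSpace ℝ (Fin d) →L[ℝ] (Fin d → ℝ)) x :=
    (EuclideanSpace.equiv (Fin d) ℝ).hasFDerivAt
  have h3 := h1.comp x h2
  refine h3.congr_fderiv ?_
  ext a
  rw [innerSL_apply_apply, inner_coord]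
  show fderiv ℝ f (WithLp.ofLp x) (WithLp.ofLp a) = _
  conv_lhs => rw [pi_eq_sum_univ' (WithLp.ofLp a)]
  rw [map_sum]
  refine Finset.sum_congr rfl fun i _ => ?_
  rw [map_smul, gradE_apply, smul_eq_mul, mul_comm]
  unfold pd
  congr 2

theorem pd_of_hasFDerivAt {d : ℕ} {F : EuclideanSpace ℝ (Fin d) → ℝ} {q : EuclideanSpace ℝ (Fin d) → EuclideanSpace ℝ (Fin d)}
    (hF : ∀ x, HasFDerivAt F (innerSL ℝ (q x)) x) :
    Differentiable ℝ (fun x : Fin d → ℝ => F (WithLp.toLp 2 x)) ∧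
      ∀ i, pd d i (fun x : Fin d → ℝ => F (WithLp.toLp 2 x)) = fun x => q (WithLp.toLp 2 x) i := by
  have h : ∀ x : Fin d → ℝ, HasFDerivAt (fun x : Fin d → ℝ => F (WithLp.toLp 2 x)) ((innerSL ℝ (q (WithLp.toLp 2 x))).comp
      ((EuclideanSpace.equiv (Fin d) ℝ).symm : (Fin d → ℝ) →L[ℝ] EuclideanSpace ℝ (Fin d))) x := fun x => by
    have h2 : HasFDerivAt (fun y : Fin d → ℝ => (WithLp.toLp 2 y : EuclideanSpace ℝ (Fin d)))
      ((EuclideanSpace.equiv (Fin d) ℝ).symm : (Fin d → ℝ) →L[ℝ] EuclideanSpace ℝ (Fin d)) x :=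
      (EuclideanSpace.equiv (Fin d) ℝ).symm.hasFDerivAt
    exact (hF (WithLp.toLp 2 x)).comp x h2
  refine ⟨fun x => (h x).differentiableAt, fun i => ?_⟩
  funext x
  unfold pd
  rw [(h x).fderiv]
  show innerSL ℝ (q (WithLp.toLp 2 x)) (WithLp.toLp 2 (Pi.single i 1)) = _
  rw [innerSL_apply_apply, inner_coord]
  simp [Pi.single_apply]

theorem contDiff_one_of_pd {d : ℕ} {f : (Fin d → ℝ) → ℝ} (hf : Differentiable ℝ f) (hc : ∀ i, Continuous (pd d i f)) :
    ContDiff ℝ 1 f := by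
  rw [contDiff_one_iff_fderiv]
  refine ⟨hf, ?_⟩
  rw [continuous_clm_apply]
  intro y
  have : (fun x => fderiv ℝ f x y) = fun x => ∑ i, y i * pd d i f x := by
    funext x
    conv_lhs => rw [pi_eq_sum_univ' y]
    rw [map_sum]
    refine Finset.sum_congr rfl fun i _ => ?_
    rw [map_smul, smul_eq_mul]
    unfold pd
    congr 2
  rw [this]
  fun_prop

theorem contDiff_two_of_pd {d : ℕ} {f : (Fin d → ℝ) → ℝ} (hf : Differentiable ℝ f) (hc : ∀ i, ContDiff ℝ 1 (pd d i f)) :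
    ContDiff ℝ 2 f := by
  have h12 : ((1:WithTop ℕ∞) + 1) = 2 := by norm_num
  rw [← h12, contDiff_succ_iff_fderiv]
  refine ⟨hf, by simp, ?_⟩
  rw [contDiff_clm_apply_iff]
  intro y
  have : (fun x => fderiv ℝ f x y) = fun x => ∑ i, y i * pd d i f x := by
    funext x
    conv_lhs => rw [pi_eq_sum_univ' y]
    rw [map_sum]
    refine Finset.sum_congr rfl fun i _ => ?_
    rw [map_smul, smul_eq_mul]
    unfold pd
    congr 2
  rw [this]
  fun_prop

theorem pd_contDiff {d : ℕ} {f : (Fin d → ℝ) → ℝ} (hf : ContDiff ℝ 2 f) (i : Fin d) : ContDiff ℝ 1 (pd d i f) := by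
  unfold pd
  have := hf.fderiv_right (m := 1) (by norm_num)
  exact this.clm_apply contDiff_const

theorem dist_ofLp_le {d : ℕ} (x y : EuclideanSpace ℝ (Fin d)) : dist (WithLp.ofLp x) (WithLp.ofLp y) ≤ ‖x - y‖ := by
  rw [dist_pi_le_iff (norm_nonneg _)]
  intro i
  rw [Real.dist_eq]
  have := coord_le (x - y) i
  simpa using this

theorem norm_toLp_le {d : ℕ} (x y : Fin d → ℝ) : ‖(WithLp.toLp 2 x : EuclideanSpace ℝ (Fin d)) - WithLp.toLp 2 y‖ ≤ d * dist x y := by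
  refine (norm_le_coord _).trans ?_
  calc _ ≤ ∑ i : Fin d, dist x y := by
        refine Finset.sum_le_sum fun i _ => ?_
        have := dist_le_pi_dist x y i
        rw [Real.dist_eq] at this
        simpa using this
    _ = _ := by simp

theorem gradE_holder {d : ℕ} {α : ℝ} (hα : 0 < α) {f : (Fin d → ℝ) → ℝ} (hf : ∀ i, HolderSemi α (pd d i f)) :
    ∃ C, 0 ≤ C ∧ ∀ x y, ‖gradE d f x - gradE d f y‖ ≤ C * ‖x - y‖ ^ α := by
  choose C hC0 hC using hf
  refine ⟨∑ i, C i, Finset.sum_nonneg fun i _ => hC0 i, fun x y => (norm_le_coord _).trans ?_⟩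
  rw [Finset.sum_mul]
  refine Finset.sum_le_sum fun i _ => ?_
  have h1 := hC i (WithLp.ofLp x) (WithLp.ofLp y)
  have h2 : dist (WithLp.ofLp x) (WithLp.ofLp y) ^ α ≤ ‖x - y‖ ^ α :=
    Real.rpow_le_rpow dist_nonneg (dist_ofLp_le x y) hα.le
  exact h1.trans (mul_le_mul_of_nonneg_left h2 (hC0 i))

theorem holder_back {d : ℕ} {α : ℝ} (hα : 0 < α) {F : EuclideanSpace ℝ (Fin d) → ℝ} {C : ℝ} (hC : 0 ≤ C)
    (hF : ∀ x y, |F x - F y| ≤ C * ‖x - y‖ ^ α) : HolderSemi α (fun x : Fin d → ℝ => F (WithLp.toLp 2 x)) := by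
  refine ⟨C * (d:ℝ) ^ α, by positivity, fun x y => ?_⟩
  have h2 : ‖(WithLp.toLp 2 x : EuclideanSpace ℝ (Fin d)) - WithLp.toLp 2 y‖ ^ α ≤ (d * dist x y) ^ α :=
    Real.rpow_le_rpow (norm_nonneg _) (norm_toLp_le x y) hα.le
  rw [Real.mul_rpow (by positivity) dist_nonneg] at h2
  refine (hF _ _).trans ?_
  rw [mul_assoc]
  exact mul_le_mul_of_nonneg_left h2 hC

noncomputable def hessE (d : ℕ) (f : (Fin d → ℝ) → ℝ) (x : EuclideanSpace ℝ (Fin d)) :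
    EuclideanSpace ℝ (Fin d) →L[ℝ] EuclideanSpace ℝ (Fin d) :=
  ((EuclideanSpace.equiv (Fin d) ℝ).symm : (Fin d → ℝ) →L[ℝ] EuclideanSpace ℝ (Fin d)).comp
    (ContinuousLinearMap.pi fun i => innerSL ℝ (gradE d (pd d i f) x))

theorem hessE_apply {d : ℕ} (f : (Fin d → ℝ) → ℝ) (x a : EuclideanSpace ℝ (Fin d)) (i : Fin d) :
    hessE d f x a i = ⟪gradE d (pd d i f) x, a⟫ := rfl

theorem C2_of_contDiff {d : ℕ} {f : (Fin d → ℝ) → ℝ} (hf : ContDiff ℝ 2 f) :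
    C2 (fun x : EuclideanSpace ℝ (Fin d) => f (WithLp.ofLp x)) (gradE d f) (hessE d f) := by
  refine ⟨fun x => gradE_hasFDerivAt (hf.differentiable (by norm_num)) x, fun x => ?_⟩
  have h1 : HasFDerivAt (fun y : EuclideanSpace ℝ (Fin d) => fun i => pd d i f (WithLp.ofLp y))
      (ContinuousLinearMap.pi fun i => innerSL ℝ (gradE d (pd d i f) x)) x := by
    rw [hasFDerivAt_pi]
    intro i
    exact gradE_hasFDerivAt ((pd_contDiff hf i).differentiable (by norm_num)) x
  exact (EuclideanSpace.equiv (Fin d) ℝ).symm.hasFDerivAt.comp x h1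

theorem hessE_holder {d : ℕ} {α : ℝ} (hα : 0 < α) {f : (Fin d → ℝ) → ℝ} (hf : ∀ i j, HolderSemi α (pd d i (pd d j f))) :
    ∃ C, 0 ≤ C ∧ ∀ x y, ‖hessE d f x - hessE d f y‖ ≤ C * ‖x - y‖ ^ α := by
  choose C hC0 hC using fun j => gradE_holder hα (fun i => hf i j)
  refine ⟨∑ i, C i, Finset.sum_nonneg fun i _ => hC0 i, fun x y => ?_⟩
  have hs := Finset.sum_nonneg fun i (_ : i ∈ Finset.univ) => hC0 i
  refine ContinuousLinearMap.opNorm_le_bound _ (by positivity) fun a => (norm_le_coord _).trans ?_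
  rw [Finset.sum_mul, Finset.sum_mul]
  refine Finset.sum_le_sum fun i _ => ?_
  have : (hessE d f x - hessE d f y) a i = ⟪gradE d (pd d i f) x - gradE d (pd d i f) y, a⟫ := by
    rw [inner_sub_left, ← hessE_apply, ← hessE_apply]; rfl
  rw [this]
  refine (abs_real_inner_le_norm _ _).trans ?_
  exact mul_le_mul_of_nonneg_right (hC i x y) (norm_nonneg _)

theorem tr_coord {d : ℕ} (A : EuclideanSpace ℝ (Fin d) →L[ℝ] EuclideanSpace ℝ (Fin d)) :
    tr A = ∑ i, A (EuclideanSpace.single i 1) i := by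
  unfold tr
  rw [LinearMap.trace_eq_sum_inner _ (EuclideanSpace.basisFun (Fin d) ℝ)]
  refine Finset.sum_congr rfl fun i _ => ?_
  rw [EuclideanSpace.basisFun_apply, inner_coord]
  simp [Pi.single_apply]

theorem inner_single {d : ℕ} (q : EuclideanSpace ℝ (Fin d)) (i : Fin d) : ⟪q, EuclideanSpace.single i 1⟫ = q i := by
  rw [inner_coord]
  simp [Pi.single_apply]

theorem gradSq_eq {d : ℕ} (f : (Fin d → ℝ) → ℝ) (x : EuclideanSpace ℝ (Fin d)) : gradSq d f (WithLp.ofLp x) = ‖gradE d f x‖ ^ 2 := by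
  rw [← real_inner_self_eq_norm_sq, inner_coord]
  unfold gradSq
  refine Finset.sum_congr rfl fun i _ => ?_
  rw [gradE_apply]; ring

theorem divUp_eq {d : ℕ} {m u : (Fin d → ℝ) → ℝ} (hm : Differentiable ℝ m) (hu : ∀ i, Differentiable ℝ (pd d i u)) (y : Fin d → ℝ) :
    divUp d m u y = ∑ i, (pd d i m y * pd d i u y + m y * pd d i (pd d i u) y) := by
  unfold divUp
  refine Finset.sum_congr rfl fun i _ => ?_
  conv_lhs => unfold pd
  have := ((hm y).hasFDerivAt.mul (hu i y).hasFDerivAt).fderiv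
  have h2 : fderiv ℝ (fun y => m y * (fderiv ℝ u y) (Pi.single i 1)) y = m y • fderiv ℝ (pd d i u) y + pd d i u y • fderiv ℝ m y := this
  rw [h2]
  simp only [add_apply, smul_apply, smul_eq_mul]
  unfold pd
  ring

structure ES {d : ℕ} (α : ℝ) (g : ℝ → ℝ) (V : EuclideanSpace ℝ (Fin d) → ℝ) (ε : ℝ)
    (u : EuclideanSpace ℝ (Fin d) → ℝ) (p : EuclideanSpace ℝ (Fin d) → EuclideanSpace ℝ (Fin d))
    (H : EuclideanSpace ℝ (Fin d) → EuclideanSpace ℝ (Fin d) →L[ℝ] EuclideanSpace ℝ (Fin d))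
    (m : EuclideanSpace ℝ (Fin d) → ℝ) (q : EuclideanSpace ℝ (Fin d) → EuclideanSpace ℝ (Fin d)) : Prop where
  c2 : C2 u p H
  hH : ∃ C, 0 ≤ C ∧ ∀ x y, ‖H x - H y‖ ≤ C * ‖x - y‖ ^ α
  hm : ∀ x, HasFDerivAt m (innerSL ℝ (q x)) x
  hq : ∃ C, 0 ≤ C ∧ ∀ x y, ‖q x - q y‖ ≤ C * ‖x - y‖ ^ α
  mpos : ∀ x, 0 < m x
  hj : ∀ x, ε * u x + ‖p x‖ ^ 2 / 2 + V x = g (m x)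
  fp : ∀ x, ε * m x - (⟪q x, p x⟫ + m x * tr (H x)) = ε
  peru : ∀ (k : Fin d → ℤ) x, u (x + WithLp.toLp 2 (fun i => (k i : ℝ))) = u x
  perm : ∀ (k : Fin d → ℤ) x, m (x + WithLp.toLp 2 (fun i => (k i : ℝ))) = m x

theorem ES_of_DiscSol {d : ℕ} {α : ℝ} (hα : 0 < α) {g : ℝ → ℝ} {V : (Fin d → ℝ) → ℝ} {ε : ℝ} {u m : (Fin d → ℝ) → ℝ}
    (h : DiscSol d α g V ε u m) (hpos : ∀ x, 0 < m x) :
    ES α g (fun x => V (WithLp.ofLp x)) ε (fun x => u (WithLp.ofLp x)) (gradE d u) (hessE d u)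
      (fun x => m (WithLp.ofLp x)) (gradE d m) := by
  have hmd : Differentiable ℝ m := h.reg_m.1.differentiable (by norm_num)
  refine ⟨C2_of_contDiff h.reg_u.1, hessE_holder hα h.reg_u.2, fun x => gradE_hasFDerivAt hmd x,
    gradE_holder hα h.reg_m.2, fun x => hpos _, fun x => ?_, fun x => ?_, fun k x => ?_, fun k x => ?_⟩
  · rw [← h.hj, gradSq_eq]; ring
  · have h1 := h.fp (WithLp.ofLp x)
    rw [divUp_eq hmd (fun i => (pd_contDiff h.reg_u.1 i).differentiable (by norm_num)), Finset.sum_add_distrib,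
      ← Finset.mul_sum] at h1
    rw [inner_coord, tr_coord]
    simp only [hessE_apply, inner_single]
    exact h1
  · exact h.per_u _ k
  · exact h.per_m _ k

theorem DiscSol_of_ES {d : ℕ} {α : ℝ} (hα : 0 < α) {g : ℝ → ℝ} {V : (Fin d → ℝ) → ℝ} {ε : ℝ}
    {u : EuclideanSpace ℝ (Fin d) → ℝ} {p : EuclideanSpace ℝ (Fin d) → EuclideanSpace ℝ (Fin d)}
    {H : EuclideanSpace ℝ (Fin d) → EuclideanSpace ℝ (Fin d) →L[ℝ] EuclideanSpace ℝ (Fin d)}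
    {m : EuclideanSpace ℝ (Fin d) → ℝ} {q : EuclideanSpace ℝ (Fin d) → EuclideanSpace ℝ (Fin d)}
    (h : ES α g (fun x => V (WithLp.ofLp x)) ε u p H m q) :
    DiscSol d α g V ε (fun x => u (WithLp.toLp 2 x)) (fun x => m (WithLp.toLp 2 x)) := by
  obtain ⟨du, pu⟩ := pd_of_hasFDerivAt h.c2.hv
  obtain ⟨dm, pm⟩ := pd_of_hasFDerivAt h.hm
  -- second derivatives
  have hcol : ∀ i x, ∃ b : EuclideanSpace ℝ (Fin d), HasFDerivAt (fun y => p y i) (innerSL ℝ b) x ∧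
      ∀ j, b j = H x (EuclideanSpace.single j 1) i := fun i x => by
    have h1 := (EuclideanSpace.proj (𝕜 := ℝ) i).hasFDerivAt.comp x (h.c2.hp x)
    refine ⟨WithLp.toLp 2 (fun j => H x (EuclideanSpace.single j 1) i), ?_, fun j => rfl⟩
    refine h1.congr_fderiv ?_
    ext a
    rw [innerSL_apply_apply, inner_coord]
    have h3 : a = ∑ j, a j • EuclideanSpace.single j (1:ℝ) := by
      ext j
      simp [Finset.sum_apply, Pi.single_apply]
    show H x a i = _
    conv_lhs => rw [h3]
    rw [map_sum]
    simp [Finset.sum_apply, mul_comm]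
  choose b hb hbj using hcol
  have hp2 : ∀ i, Differentiable ℝ (pd d i (fun x => u (WithLp.toLp 2 x))) ∧ ∀ j, pd d j (pd d i (fun x => u (WithLp.toLp 2 x)))
      = fun x => H (WithLp.toLp 2 x) (EuclideanSpace.single j 1) i := fun i => by
    rw [pu]
    obtain ⟨h1, h2⟩ := pd_of_hasFDerivAt (hb i)
    refine ⟨h1, fun j => ?_⟩
    rw [h2 j]
    funext x
    exact hbj i _ j
  obtain ⟨CH, hCH0, hCH⟩ := h.hH
  obtain ⟨Cq, hCq0, hCq⟩ := h.hq
  have hHs : ∀ i j, HolderSemi α (pd d i (pd d j (fun x => u (WithLp.toLp 2 x)))) := fun i j => by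
    rw [(hp2 j).2 i]
    refine holder_back hα (F := fun x => H x (EuclideanSpace.single i 1) j) hCH0 fun x y => ?_
    have h1 := coord_le ((H x - H y) (EuclideanSpace.single i 1)) j
    have h2 := (H x - H y).le_opNorm (EuclideanSpace.single i 1)
    have h3 : ‖(EuclideanSpace.single i 1 : EuclideanSpace ℝ (Fin d))‖ = 1 := by simp
    rw [h3, mul_one] at h2
    exact h1.trans (h2.trans (hCH x y))
  have hqs : ∀ i, HolderSemi α (pd d i (fun x => m (WithLp.toLp 2 x))) := fun i => by
    rw [pm]
    refine holder_back hα (F := fun x => q x i) hCq0 fun x y => ?_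
    exact (coord_le (q x - q y) i).trans (hCq x y)
  have hcont : ∀ f : (Fin d → ℝ) → ℝ, HolderSemi α f → Continuous f := fun f ⟨C, hC0, hC⟩ => by
    rw [continuous_iff_continuousAt]
    intro x
    rw [ContinuousAt, tendsto_iff_dist_tendsto_zero]
    have h1 : Tendsto (fun y => C * dist y x ^ α) (𝓝 x) (𝓝 0) := by
      have h2 : Continuous (fun y => C * dist y x ^ α) :=
        continuous_const.mul ((continuous_id.dist continuous_const).rpow_const fun _ => Or.inr hα.le)
      have h3 := h2.tendsto x
      simpa [Real.zero_rpow hα.ne'] using h3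
    exact squeeze_zero (fun _ => dist_nonneg) (fun y => by rw [Real.dist_eq]; exact hC y x) h1
  refine ⟨fun x k => h.peru k _, fun x k => h.perm k _, ⟨?_, hHs⟩, ⟨?_, hqs⟩, fun x => (h.mpos _).le, fun x => ?_, fun x => ?_⟩
  · exact contDiff_two_of_pd du fun i => contDiff_one_of_pd (hp2 i).1 fun j => hcont _ (hHs j i)
  · exact contDiff_one_of_pd dm fun i => hcont _ (hqs i)
  · have h1 := h.hj (WithLp.toLp 2 x)
    have h2 : gradSq d (fun x => u (WithLp.toLp 2 x)) x = ‖p (WithLp.toLp 2 x)‖ ^ 2 := by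
      rw [← real_inner_self_eq_norm_sq, inner_coord]
      unfold gradSq
      refine Finset.sum_congr rfl fun i _ => ?_
      rw [pu]; ring
    rw [h2]
    simp only at h1 ⊢
    linarith
  · have h1 := h.fp (WithLp.toLp 2 x)
    rw [divUp_eq dm (fun i => (hp2 i).1), Finset.sum_add_distrib, ← Finset.mul_sum]
    rw [inner_coord, tr_coord] at h1
    have h2 : ∀ i, pd d i (pd d i (fun x => u (WithLp.toLp 2 x))) x = H (WithLp.toLp 2 x) (EuclideanSpace.single i 1) i := fun i => by
      rw [(hp2 i).2 i]
    simp only [h2]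
    simp only [pu, pm]
    exact h1

end Conv

open MeasureTheory Set
set_option linter.unusedSectionVars false

section StepOne
open Filter Topology RealInnerProductSpace

theorem per_cover {d : ℕ} (x : EuclideanSpace ℝ (Fin d)) : ∃ k : Fin d → ℤ,
    x + WithLp.toLp 2 (fun i => (k i : ℝ)) ∈ (fun y : Fin d → ℝ => (WithLp.toLp 2 y : EuclideanSpace ℝ (Fin d))) '' Icc 0 1 := by
  refine ⟨fun i => -⌊x i⌋, WithLp.ofLp x + fun i => ((-⌊x i⌋ : ℤ) : ℝ), ⟨fun i => ?_, fun i => ?_⟩, ?_⟩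
  · have := Int.floor_le (x i)
    simp only [Pi.zero_apply, Pi.add_apply, Int.cast_neg]
    linarith
  · have := Int.lt_floor_add_one (x i)
    simp only [Pi.one_apply, Pi.add_apply, Int.cast_neg]
    linarith
  · rfl

theorem cube_compact (d : ℕ) : IsCompact ((fun y : Fin d → ℝ => (WithLp.toLp 2 y : EuclideanSpace ℝ (Fin d))) '' Icc 0 1) :=
  isCompact_Icc.image (EuclideanSpace.equiv (Fin d) ℝ).symm.continuous

theorem per_max {d : ℕ} {u : EuclideanSpace ℝ (Fin d) → ℝ} (hu : Continuous u)
    (hper : ∀ (k : Fin d → ℤ) x, u (x + WithLp.toLp 2 (fun i => (k i : ℝ))) = u x) : ∃ x, ∀ y, u y ≤ u x := by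
  obtain ⟨x, -, hx⟩ := (cube_compact d).exists_isMaxOn ⟨_, 0, ⟨le_refl _, fun i => by simp⟩, rfl⟩ hu.continuousOn
  refine ⟨x, fun y => ?_⟩
  obtain ⟨k, hk⟩ := per_cover y
  rw [← hper k y]
  exact hx hk

theorem C2.at_max {d : ℕ} {u : EuclideanSpace ℝ (Fin d) → ℝ} {p : EuclideanSpace ℝ (Fin d) → EuclideanSpace ℝ (Fin d)}
    {H : EuclideanSpace ℝ (Fin d) → EuclideanSpace ℝ (Fin d) →L[ℝ] EuclideanSpace ℝ (Fin d)} (h : C2 u p H)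
    {x : EuclideanSpace ℝ (Fin d)} (hx : ∀ y, u y ≤ u x) : p x = 0 ∧ tr (H x) ≤ 0 := by
  have h1 : ∀ a, ⟪p x, a⟫ = 0 ∧ ⟪H x a, a⟫ ≤ 0 := fun a => by
    refine (h.jet x a).max (Eventually.of_forall fun s => ?_)
    simpa using hx (x + s • a)
  exact ⟨inner_self_eq_zero.1 (h1 (p x)).1, tr_nonpos _ fun a => (h1 a).2⟩

theorem C2.at_min {d : ℕ} {u : EuclideanSpace ℝ (Fin d) → ℝ} {p : EuclideanSpace ℝ (Fin d) → EuclideanSpace ℝ (Fin d)}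
    {H : EuclideanSpace ℝ (Fin d) → EuclideanSpace ℝ (Fin d) →L[ℝ] EuclideanSpace ℝ (Fin d)} (h : C2 u p H)
    {x : EuclideanSpace ℝ (Fin d)} (hx : ∀ y, u x ≤ u y) : p x = 0 ∧ 0 ≤ tr (H x) := by
  obtain ⟨h1, h2⟩ := (h.smul (-1)).at_max (x := x) (fun y => by linarith [hx y])
  rw [tr_smul] at h2
  exact ⟨by simpa using h1, by linarith⟩

variable {d : ℕ} {α : ℝ} {g : ℝ → ℝ} {V : EuclideanSpace ℝ (Fin d) → ℝ}
    {W : EuclideanSpace ℝ (Fin d) → EuclideanSpace ℝ (Fin d)} {ε lam : ℝ}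
    {u : EuclideanSpace ℝ (Fin d) → ℝ} {p : EuclideanSpace ℝ (Fin d) → EuclideanSpace ℝ (Fin d)}
    {H : EuclideanSpace ℝ (Fin d) → EuclideanSpace ℝ (Fin d) →L[ℝ] EuclideanSpace ℝ (Fin d)}
    {m : EuclideanSpace ℝ (Fin d) → ℝ} {q : EuclideanSpace ℝ (Fin d) → EuclideanSpace ℝ (Fin d)}

/-- derivative of the running quantity `ε u + |p|²/2 + λ V`. -/
theorem s_hasFDerivAt (h : C2 u p H) (hV : ∀ x, HasFDerivAt V (innerSL ℝ (W x)) x) (ε lam : ℝ) (x : EuclideanSpace ℝ (Fin d)) :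
    HasFDerivAt (fun x => ε * u x + ‖p x‖ ^ 2 / 2 + lam * V x)
      (innerSL ℝ (ε • p x + ContinuousLinearMap.adjoint (H x) (p x) + lam • W x)) x := by
  have h1 := ((h.hv x).const_mul ε).add (((h.hp x).norm_sq).mul_const (1/2 : ℝ))
  have h2 := h1.add ((hV x).const_mul lam)
  have h3 := h2.congr_fderiv (g' := innerSL ℝ (ε • p x + ContinuousLinearMap.adjoint (H x) (p x) + lam • W x)) (by
    ext a
    simp [inner_add_left, real_inner_smul_left, ContinuousLinearMap.adjoint_inner_left])
  refine h3.congr_of_eventuallyEq (Eventually.of_forall fun y => ?_)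
  simp only [Pi.add_apply]
  ring

theorem ES.dg (h : ES α g (fun x => lam * V x) ε u p H m q) (hV : ∀ x, HasFDerivAt V (innerSL ℝ (W x)) x)
    (hg : Ghyp α g) (x : EuclideanSpace ℝ (Fin d)) :
    deriv g (m x) * ⟪q x, p x⟫ = ε * ‖p x‖ ^ 2 + ⟪H x (p x), p x⟫ + lam * ⟪W x, p x⟫ := by
  have h1 := s_hasFDerivAt h.c2 hV ε lam x
  have hd : DifferentiableAt ℝ g (m x) := (hg.2.2.1 _ (h.mpos x)).differentiableAt (Ioi_mem_nhds (h.mpos x))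
  have h2 := hd.hasDerivAt.comp_hasFDerivAt x (h.hm x)
  have h3 : (fun x => ε * u x + ‖p x‖ ^ 2 / 2 + lam * V x) = g ∘ m := by
    funext y; exact h.hj y
  rw [h3] at h1
  have h4 := congrArg (fun A => A (p x)) (h2.unique h1)
  simp only [smul_apply, innerSL_apply_apply, inner_add_left, real_inner_smul_left, ContinuousLinearMap.adjoint_inner_left,
    smul_eq_mul] at h4
  rw [h4, real_inner_self_eq_norm_sq, real_inner_comm (p x) (H x (p x))]

theorem ES.nondiv (h : ES α g (fun x => lam * V x) ε u p H m q) (hV : ∀ x, HasFDerivAt V (innerSL ℝ (W x)) x)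
    (hg : Ghyp α g) (hp : ∀ z, 0 < z → 0 < deriv g z) (x : EuclideanSpace ℝ (Fin d)) :
    tr (H x) + 1 / (m x * deriv g (m x)) * (⟪H x (p x), p x⟫ + ε * ‖p x‖ ^ 2 + ⟪lam • W x, p x⟫) = ε * (1 - 1 / m x) := by
  have h1 := h.dg hV hg x
  have h2 := h.fp x
  have hm := h.mpos x
  have hg' := hp _ hm
  rw [real_inner_smul_left]
  have h3 : ⟪H x (p x), p x⟫ + ε * ‖p x‖ ^ 2 + lam * ⟪W x, p x⟫ = deriv g (m x) * ⟪q x, p x⟫ := by rw [h1]; ring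
  rw [h3]
  have h4 : 1 / (m x * deriv g (m x)) * (deriv g (m x) * ⟪q x, p x⟫) = ⟪q x, p x⟫ / m x := by
    field_simp
  rw [h4]
  field_simp
  linarith

theorem ES.bounds (h : ES α g (fun x => lam * V x) ε u p H m q) (hg : Ghyp α g)
    (hl : lam ∈ Icc (0:ℝ) 1) (hε : 0 < ε) {osc vb z0 : ℝ} (hosc : ∀ x y, V x - V y ≤ osc) (hvb : ∀ x, |V x| ≤ vb)
    (hz0 : 0 < z0) (hgz : g z0 = g 1 - osc) : (∀ x, z0 ≤ m x) ∧ (∀ x, |ε * u x| ≤ |g 1| + vb) := by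
  obtain ⟨x1, hx1⟩ := per_max h.c2.cont h.peru
  obtain ⟨x0, hx0⟩ := per_max (u := fun x => - u x) h.c2.cont.neg (fun k x => by rw [h.peru k x])
  obtain ⟨hp1, ht1⟩ := h.c2.at_max hx1
  obtain ⟨hp0, ht0⟩ := h.c2.at_min (x := x0) (fun y => by linarith [hx0 y])
  have m1 : m x1 ≤ 1 := by
    have := h.fp x1
    rw [hp1, inner_zero_right] at this
    nlinarith [h.mpos x1]
  have m0 : 1 ≤ m x0 := by
    have := h.fp x0
    rw [hp0, inner_zero_right] at this
    nlinarith [h.mpos x0]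
  have g1 : g (m x1) ≤ g 1 := hg.1.monotoneOn (h.mpos x1).le (zero_le_one (α := ℝ)) m1
  have g0 : g 1 ≤ g (m x0) := hg.1.monotoneOn (zero_le_one (α := ℝ)) (h.mpos x0).le m0
  have j1 := h.hj x1
  have j0 := h.hj x0
  rw [hp1] at j1
  rw [hp0] at j0
  simp only [norm_zero] at j1 j0
  have hosc0 : 0 ≤ osc := by simpa using hosc 0 0
  have hlow : ∀ x, ε * u x ≥ g 1 - lam * V x0 := fun x => by
    have := hx0 x
    nlinarith
  have hupp : ∀ x, ε * u x ≤ g 1 - lam * V x1 := fun x => by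
    have := hx1 x
    nlinarith
  have hlv : ∀ x, |lam * V x| ≤ vb := fun x => by
    rw [abs_mul, abs_of_nonneg hl.1]
    have := hvb x
    have := abs_nonneg (V x)
    nlinarith [hl.1, hl.2]
  refine ⟨fun x => ?_, fun x => ?_⟩
  · have hj := h.hj x
    have h3 : lam * (V x0 - V x) ≤ osc := by
      have := hosc x0 x
      nlinarith [hl.1, hl.2]
    have h4 : g z0 ≤ g (m x) := by
      rw [hgz, ← hj]
      nlinarith [hlow x, sq_nonneg ‖p x‖]
    exact (hg.1.le_iff_le hz0.le (h.mpos x).le).1 h4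
  · rw [abs_le]
    have a1 := abs_le.1 (hlv x0)
    have a2 := abs_le.1 (hlv x1)
    have a3 := neg_abs_le (g 1)
    have a4 := le_abs_self (g 1)
    constructor
    · linarith [hlow x]
    · linarith [hupp x]

theorem ES.lip (h : ES α g (fun x => lam * V x) ε u p H m q) (hV : ∀ x, HasFDerivAt V (innerSL ℝ (W x)) x)
    (hg : Ghyp α g) (hp : ∀ z, 0 < z → 0 < deriv g z)
    (hl : lam ∈ Icc (0:ℝ) 1) (hε : 0 < ε) {B z0 Wb : ℝ} (hW : ∀ x, ‖W x‖ ≤ Wb)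
    (hz0 : 0 < z0) (hm : ∀ x, z0 ≤ m x) (hu : ∀ x, |ε * u x| ≤ B) (x : EuclideanSpace ℝ (Fin d)) :
    ‖p x‖ ≤ 2 * B / ε + 2 * (ε / z0 + ε + Wb) + 2 := by
  refine lip_apriori (m := m) (c := fun x => 1 / (m x * deriv g (m x))) (w := fun x => lam • W x) h.c2 (cube_compact d) ?_ hε hz0 hm
    ?_ ?_ ?_ (fun x => h.nondiv hV hg hp x) x
  · intro x
    obtain ⟨k, hk⟩ := per_cover x
    exact ⟨_, h.peru k, hk⟩
  · intro x
    have := h.mpos x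
    have := hp _ this
    positivity
  · intro x
    rw [norm_smul, Real.norm_eq_abs, abs_of_nonneg hl.1]
    have := hW x
    nlinarith [hl.1, hl.2, norm_nonneg (W x)]
  · intro x y
    have h1 := abs_le.1 (hu x)
    have h2 := abs_le.1 (hu y)
    rw [le_div_iff₀ hε]
    linarith

end StepOne

open MeasureTheory Set
set_option linter.unusedSectionVars false

section StepTwo
open Filter Topology RealInnerProductSpace
variable {E : Type*} [NormedAddCommGroup E] [InnerProductSpace ℝ E] [FiniteDimensional ℝ E]

theorem s_holder {α L Λ : ℝ} {p : E → E} {l : E → ℝ} (hα : 0 < α) (hα1 : α < 1) (hΛ : 0 ≤ Λ)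
    (hp : ∀ x, ‖p x‖ ≤ L) (hl : ∀ x y, |l x - l y| ≤ Λ * ‖x - y‖) (x y : E) :
    |(l x + ‖p x‖ ^ 2 / 2) - (l y + ‖p y‖ ^ 2 / 2)| ^ α ≤ (Λ ^ α + L ^ α) * (‖x - y‖ ^ α + ‖p x - p y‖ ^ α) := by
  have hL : 0 ≤ L := (norm_nonneg _).trans (hp x)
  have h1 : |(l x + ‖p x‖ ^ 2 / 2) - (l y + ‖p y‖ ^ 2 / 2)| ≤ Λ * ‖x - y‖ + L * ‖p x - p y‖ := by
    have e : (l x + ‖p x‖ ^ 2 / 2) - (l y + ‖p y‖ ^ 2 / 2) = (l x - l y) + (‖p x‖ ^ 2 / 2 - ‖p y‖ ^ 2 / 2) := by ring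
    rw [e]
    exact (abs_add_le _ _).trans (add_le_add (hl x y) (sqdiff (hp x) (hp y)))
  have h2 : (Λ * ‖x - y‖ + L * ‖p x - p y‖) ^ α ≤ (Λ * ‖x - y‖) ^ α + (L * ‖p x - p y‖) ^ α :=
    Real.rpow_add_le_add_rpow (by positivity) (by positivity) hα.le hα1.le
  rw [Real.mul_rpow hΛ (norm_nonneg _), Real.mul_rpow hL (norm_nonneg _)] at h2
  have h3 := (Real.rpow_le_rpow (abs_nonneg _) h1 hα.le).trans h2
  refine h3.trans ?_
  have a1 : 0 ≤ Λ ^ α * ‖p x - p y‖ ^ α := by positivity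
  have a2 : 0 ≤ L ^ α * ‖x - y‖ ^ α := by positivity
  linarith only [a1, a2]

theorem mk_SS {σ b : ℝ → ℝ} {α L lb Λ S CS Bb CB Wb CW ε : ℝ} (hα : 0 < α) (hα1 : α < 1) (hΛ : 0 ≤ Λ) (hε : 0 < ε)
    (hS : ∀ s, |σ s| ≤ S) (hCS : 0 ≤ CS)
    (hσ : ∀ s t, |σ s - σ t| ≤ CS * |s - t| ^ α) (hCB : 0 ≤ CB) (hb : ∀ s, |b s| ≤ Bb)
    (hbh : ∀ s t, |b s - b t| ≤ CB * |s - t| ^ α)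
    {u : E → ℝ} {p w : E → E} {H : E → E →L[ℝ] E} {l : E → ℝ} (hc : C2 u p H) (hp : ∀ x, ‖p x‖ ≤ L)
    (hlb : ∀ x, |l x| ≤ lb) (hl : ∀ x y, |l x - l y| ≤ Λ * ‖x - y‖) (hw : ∀ x, ‖w x‖ ≤ Wb) (hCW : 0 ≤ CW)
    (hwh : ∀ x y, ‖w x - w y‖ ≤ CW * ‖x - y‖ ^ α)
    (heq : ∀ x, tr (H x) + σ (l x + ‖p x‖ ^ 2 / 2) ^ 2 * (⟪H x (p x), p x⟫ + ε * ‖p x‖ ^ 2 + ⟪w x, p x⟫)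
      = b (l x + ‖p x‖ ^ 2 / 2)) :
    SS σ α L lb Λ (Bb + S ^ 2 * (ε * L ^ 2 + Wb * L))
      (CB * (Λ ^ α + L ^ α) + 2 * S * CS * (Λ ^ α + L ^ α) * (ε * L ^ 2 + Wb * L)
        + S ^ 2 * ((2 * ε * L + Wb) * (2 * L) ^ (1 - α) + CW * L)) 1 u p H l
      (fun x => b (l x + ‖p x‖ ^ 2 / 2) - σ (l x + ‖p x‖ ^ 2 / 2) ^ 2 * (ε * ‖p x‖ ^ 2 + ⟪w x, p x⟫)) := by
  have hL : 0 ≤ L := (norm_nonneg _).trans (hp 0)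
  have hWb : 0 ≤ Wb := (norm_nonneg _).trans (hw 0)
  have hS0 : 0 ≤ S := (abs_nonneg _).trans (hS 0)
  have hN : ∀ x, |ε * ‖p x‖ ^ 2 + ⟪w x, p x⟫| ≤ ε * L ^ 2 + Wb * L := fun x => by
    refine (abs_add_le _ _).trans (add_le_add ?_ ?_)
    · rw [abs_of_nonneg (by positivity)]
      have := hp x
      gcongr
    · refine (abs_real_inner_le_norm _ _).trans ?_
      have := hp x
      have := hw x
      gcongr
  have hσ2 : ∀ s, |σ s ^ 2| ≤ S ^ 2 := fun s => by
    rw [abs_pow]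
    have := hS s
    gcongr
  refine ⟨hc, hp, hlb, fun x y => by simpa using hl x y, fun x => ?_, fun x y => ?_, fun x => ?_⟩
  · rw [mul_one]
    refine (abs_sub _ _).trans (add_le_add (hb _) ?_)
    rw [abs_mul]
    exact mul_le_mul (hσ2 _) (hN x) (abs_nonneg _) (by positivity)
  · rw [mul_one]
    have hs := s_holder hα hα1 hΛ hp hl x y
    set s := l x + ‖p x‖ ^ 2 / 2
    set t := l y + ‖p y‖ ^ 2 / 2
    set X := ‖x - y‖ ^ α with hX
    set P := ‖p x - p y‖ ^ α with hP
    have hX0 : 0 ≤ X := by positivity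
    have hP0 : 0 ≤ P := by positivity
    set K1 := Λ ^ α + L ^ α
    have hK1 : 0 ≤ K1 := by positivity
    set Nb := ε * L ^ 2 + Wb * L
    have hNb : 0 ≤ Nb := by positivity
    have hdp : ‖p x - p y‖ ≤ (2 * L) ^ (1 - α) * P :=
      rpow_split (norm_nonneg _) ((norm_sub_le _ _).trans (by linarith [hp x, hp y])) hα hα1
    have t1 : |b s - b t| ≤ CB * K1 * (X + P) := by
      refine (hbh s t).trans ?_
      rw [mul_assoc]
      exact mul_le_mul_of_nonneg_left hs hCB
    have t2 : |σ s ^ 2 - σ t ^ 2| ≤ 2 * S * CS * K1 * (X + P) := by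
      have e : σ s ^ 2 - σ t ^ 2 = (σ s + σ t) * (σ s - σ t) := by ring
      rw [e, abs_mul]
      have e1 : |σ s + σ t| ≤ 2 * S := (abs_add_le _ _).trans (by linarith [hS s, hS t])
      have e2 : |σ s - σ t| ≤ CS * (K1 * (X + P)) := (hσ s t).trans (mul_le_mul_of_nonneg_left hs hCS)
      calc _ ≤ 2 * S * (CS * (K1 * (X + P))) := mul_le_mul e1 e2 (abs_nonneg _) (by positivity)
        _ = _ := by ring
    have t3 : |(ε * ‖p x‖ ^ 2 + ⟪w x, p x⟫) - (ε * ‖p y‖ ^ 2 + ⟪w y, p y⟫)| ≤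
        ((2 * ε * L + Wb) * (2 * L) ^ (1 - α) + CW * L) * (X + P) := by
      have e : (ε * ‖p x‖ ^ 2 + ⟪w x, p x⟫) - (ε * ‖p y‖ ^ 2 + ⟪w y, p y⟫)
          = 2 * ε * (‖p x‖ ^ 2 / 2 - ‖p y‖ ^ 2 / 2) + (⟪w x - w y, p x⟫ + ⟪w y, p x - p y⟫) := by
        rw [inner_sub_left, inner_sub_right]; ring
      have e1 : |2 * ε * (‖p x‖ ^ 2 / 2 - ‖p y‖ ^ 2 / 2)| ≤ 2 * ε * (L * ((2 * L) ^ (1 - α) * P)) := by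
        rw [abs_mul, abs_of_pos (by positivity : 0 < 2 * ε)]
        have := sqdiff (hp x) (hp y)
        have : L * ‖p x - p y‖ ≤ L * ((2 * L) ^ (1 - α) * P) := mul_le_mul_of_nonneg_left hdp hL
        gcongr
        linarith
      have e2 : |⟪w x - w y, p x⟫| ≤ CW * X * L :=
        (abs_real_inner_le_norm _ _).trans (mul_le_mul (hwh x y) (hp x) (norm_nonneg _) (by positivity))
      have e3 : |⟪w y, p x - p y⟫| ≤ Wb * ((2 * L) ^ (1 - α) * P) :=
        (abs_real_inner_le_norm _ _).trans (mul_le_mul (hw y) hdp (norm_nonneg _) hWb)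
      rw [e]
      have e4 := abs_add_le (2 * ε * (‖p x‖ ^ 2 / 2 - ‖p y‖ ^ 2 / 2)) (⟪w x - w y, p x⟫ + ⟪w y, p x - p y⟫)
      have e5 := abs_add_le ⟪w x - w y, p x⟫ ⟪w y, p x - p y⟫
      have e6 : 0 ≤ (2 * ε * L + Wb) * (2 * L) ^ (1 - α) * X := by positivity
      have e7 : 0 ≤ CW * L * P := by positivity
      linarith only [e1, e2, e3, e4, e5, e6, e7]
    have e : (b s - σ s ^ 2 * (ε * ‖p x‖ ^ 2 + ⟪w x, p x⟫)) - (b t - σ t ^ 2 * (ε * ‖p y‖ ^ 2 + ⟪w y, p y⟫))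
        = (b s - b t) + (-((σ s ^ 2 - σ t ^ 2) * (ε * ‖p x‖ ^ 2 + ⟪w x, p x⟫))
          + (-(σ t ^ 2 * ((ε * ‖p x‖ ^ 2 + ⟪w x, p x⟫) - (ε * ‖p y‖ ^ 2 + ⟪w y, p y⟫))))) := by ring
    rw [e]
    have f1 := abs_add_le (b s - b t) (-((σ s ^ 2 - σ t ^ 2) * (ε * ‖p x‖ ^ 2 + ⟪w x, p x⟫))
          + (-(σ t ^ 2 * ((ε * ‖p x‖ ^ 2 + ⟪w x, p x⟫) - (ε * ‖p y‖ ^ 2 + ⟪w y, p y⟫)))))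
    have f2 := abs_add_le (-((σ s ^ 2 - σ t ^ 2) * (ε * ‖p x‖ ^ 2 + ⟪w x, p x⟫)))
          (-(σ t ^ 2 * ((ε * ‖p x‖ ^ 2 + ⟪w x, p x⟫) - (ε * ‖p y‖ ^ 2 + ⟪w y, p y⟫))))
    rw [abs_neg, abs_neg, abs_mul, abs_mul] at f2
    have f3 : |σ s ^ 2 - σ t ^ 2| * |ε * ‖p x‖ ^ 2 + ⟪w x, p x⟫| ≤ 2 * S * CS * K1 * (X + P) * Nb :=
      mul_le_mul t2 (hN x) (abs_nonneg _) (by positivity)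
    have f4 : |σ t ^ 2| * |(ε * ‖p x‖ ^ 2 + ⟪w x, p x⟫) - (ε * ‖p y‖ ^ 2 + ⟪w y, p y⟫)| ≤
        S ^ 2 * (((2 * ε * L + Wb) * (2 * L) ^ (1 - α) + CW * L) * (X + P)) :=
      mul_le_mul (hσ2 t) t3 (abs_nonneg _) (by positivity)
    linarith only [f1, f2, f3, f4, t1]
  · have := heq x
    have e : ⟪H x (tauF σ p l x), tauF σ p l x⟫ = σ (l x + ‖p x‖ ^ 2 / 2) ^ 2 * ⟪H x (p x), p x⟫ := by
      unfold tauF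
      rw [map_smul, real_inner_smul_left, real_inner_smul_right]; ring
    rw [e]
    linarith

theorem C2.hess_bdK {v : E → ℝ} {p : E → E} {H : E → E →L[ℝ] E} (hv : C2 v p H) {L α K : ℝ} (hα : 0 < α) (hK : 0 ≤ K)
    (hL : ∀ x, ‖p x‖ ≤ L) (hH : ∀ x y, ‖H x - H y‖ ≤ K * ‖x - y‖ ^ α) (x : E) : ‖H x‖ ≤ 2 * L + K := by
  have hL0 : 0 ≤ L := (norm_nonneg _).trans (hL 0)
  refine ContinuousLinearMap.opNorm_le_of_unit_norm (by positivity) ?_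
  intro a ha
  have := taylor_bd hα hK hv.hp hH x (x + a)
  simp only [add_sub_cancel_left, ha, Real.one_rpow, mul_one] at this
  have e : H x a = p (x + a) - p x - (p (x + a) - p x - H x a) := by abel
  rw [e]
  refine (norm_sub_le _ _).trans ?_
  have := norm_sub_le (p (x + a)) (p x)
  linarith [hL (x + a), hL x]

end StepTwo

open MeasureTheory Set
set_option linter.unusedSectionVars false

section Coef
open Filter Topology RealInnerProductSpace

theorem coef {α : ℝ} (hα : 0 < α) (hα1 : α < 1) {g : ℝ → ℝ} (hg : Ghyp α g)
    (hp : ∀ z, 0 < z → 0 < deriv g z) {a b ε : ℝ} (hε : 0 < ε) (ha : 0 < a) (hab : a < b) {G : ℝ → ℝ}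
    (hG : ∀ s, G s ∈ Icc a b) {CG : ℝ} (hCG : 0 ≤ CG) (hGl : ∀ s t, |G s - G t| ≤ CG * |s - t|) :
    ∃ (σ : ℝ → ℝ) (S CS Bb CB Kb CK : ℝ), 0 ≤ CS ∧ 0 ≤ CB ∧ 0 ≤ CK ∧ (∀ s, |σ s| ≤ S) ∧ (∀ s t, |σ s - σ t| ≤ CS * |s - t| ^ α) ∧
      (∀ s, σ s ^ 2 = 1 / (G s * deriv g (G s))) ∧ (∀ s, |ε * (1 - 1 / G s)| ≤ Bb) ∧
      (∀ s t, |ε * (1 - 1 / G s) - ε * (1 - 1 / G t)| ≤ CB * |s - t| ^ α) ∧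
      (∀ s, |1 / deriv g (G s)| ≤ Kb) ∧ (∀ s t, |1 / deriv g (G s) - 1 / deriv g (G t)| ≤ CK * |s - t| ^ α) := by
  obtain ⟨S, CS, hCS, hS, hSh⟩ := sig_holder hα hα1 hg hp ha hab
  have hb : 0 < b := ha.trans hab
  have hGp : ∀ s, 0 < G s := fun s => ha.trans_le (hG s).1
  have hgp : ∀ s, 0 < deriv g (G s) := fun s => hp _ (hGp s)
  have hS0 : 0 ≤ S := (abs_nonneg _).trans (hS a ⟨le_refl _, hab.le⟩)
  have hGa : ∀ s t, |G s - G t| ^ α ≤ CG ^ α * |s - t| ^ α := fun s t => by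
    rw [← Real.mul_rpow hCG (abs_nonneg _)]
    exact Real.rpow_le_rpow (abs_nonneg _) (hGl s t) hα.le
  have hGh : ∀ s t, |G s - G t| ≤ (b - a) ^ (1 - α) * CG ^ α * |s - t| ^ α := fun s t => by
    have h1 : |G s - G t| ≤ b - a := by
      have := hG s
      have := hG t
      rw [abs_le]; constructor <;> linarith [(hG s).1, (hG s).2, (hG t).1, (hG t).2]
    have h2 := rpow_split (abs_nonneg (G s - G t)) h1 hα hα1
    refine h2.trans ?_
    rw [mul_assoc]
    exact mul_le_mul_of_nonneg_left (hGa s t) (Real.rpow_nonneg (by linarith) _)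
  have hba : 0 ≤ (b - a) ^ (1 - α) * CG ^ α := mul_nonneg (Real.rpow_nonneg (by linarith) _) (Real.rpow_nonneg hCG _)
  set J := (b - a) ^ (1 - α) * CG ^ α with hJ
  have hσh : ∀ s t, |1 / √(G s * deriv g (G s)) - 1 / √(G t * deriv g (G t))| ≤ CS * CG ^ α * |s - t| ^ α := fun s t => by
    refine (hSh _ (hG s) _ (hG t)).trans ?_
    rw [mul_assoc]
    exact mul_le_mul_of_nonneg_left (hGa s t) hCS
  have hsq : ∀ s, (1 / √(G s * deriv g (G s))) ^ 2 = 1 / (G s * deriv g (G s)) := fun s => by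
    rw [div_pow, Real.sq_sqrt (mul_pos (hGp s) (hgp s)).le, one_pow]
  have hinv : ∀ s, |1 / G s| ≤ 1 / a := fun s => by
    rw [abs_of_pos (one_div_pos.2 (hGp s))]
    exact one_div_le_one_div_of_le ha (hG s).1
  have hk : ∀ s, 1 / deriv g (G s) = G s * (1 / √(G s * deriv g (G s))) ^ 2 := fun s => by
    rw [hsq]
    have h1 := (hGp s).ne'
    have h2 := (hgp s).ne'
    field_simp
  have hGb : ∀ s, |G s| ≤ b := fun s => by
    rw [abs_of_pos (hGp s)]; exact (hG s).2
  refine ⟨fun s => 1 / √(G s * deriv g (G s)), S, CS * CG ^ α, ε * (1 + 1 / a), ε * (1 / a) * (1 / a) * J,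
    b * S ^ 2, J * S ^ 2 + b * (2 * S * (CS * CG ^ α)), by positivity, by positivity, by positivity, fun s => hS _ (hG s), hσh, hsq, fun s => ?_,
    fun s t => ?_, fun s => ?_, fun s t => ?_⟩
  · rw [abs_mul, abs_of_pos hε]
    have := abs_sub 1 (1 / G s)
    have h2 := hinv s
    rw [abs_one] at this
    gcongr
    linarith
  · have e : ε * (1 - 1 / G s) - ε * (1 - 1 / G t) = ε * (1 / G s) * (1 / G t) * (G s - G t) := by
      have h1 := (hGp s).ne'
      have h2 := (hGp t).ne'
      field_simp
      ring
    rw [e, abs_mul, abs_mul, abs_mul, abs_of_pos hε]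
    have h1 := hinv s
    have h2 := hinv t
    have h3 := hGh s t
    rw [mul_assoc (ε * (1 / a) * (1 / a))]
    exact mul_le_mul (mul_le_mul (mul_le_mul_of_nonneg_left h1 hε.le) h2 (abs_nonneg _) (by positivity)) h3 (abs_nonneg _) (by positivity)
  · rw [hk, abs_mul, abs_pow]
    have h1 := hS _ (hG s)
    have h2 := hGb s
    exact mul_le_mul h2 (pow_le_pow_left₀ (abs_nonneg _) h1 2) (by positivity) hb.le
  · rw [hk, hk]
    have h1 := hS _ (hG s)
    have h2 := hS _ (hG t)
    have h3 := hσh s t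
    have h4 := hGh s t
    have h5 := hGb t
    set A := 1 / √(G s * deriv g (G s))
    set B := 1 / √(G t * deriv g (G t))
    have e : G s * A ^ 2 - G t * B ^ 2 = (G s - G t) * A ^ 2 + G t * ((A + B) * (A - B)) := by ring
    rw [e]
    refine (abs_add_le _ _).trans ?_
    rw [abs_mul, abs_mul, abs_mul, abs_pow]
    have h6 : |A + B| ≤ 2 * S := (abs_add_le _ _).trans (by linarith)
    have h7 : |G s - G t| * |A| ^ 2 ≤ J * |s - t| ^ α * S ^ 2 :=
      mul_le_mul h4 (pow_le_pow_left₀ (abs_nonneg _) h1 2) (by positivity) (by positivity)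
    have h8 : |G t| * (|A + B| * |A - B|) ≤ b * (2 * S * (CS * CG ^ α * |s - t| ^ α)) :=
      mul_le_mul h5 (mul_le_mul h6 h3 (abs_nonneg _) (by positivity)) (by positivity) hb.le
    linarith only [h7, h8]

theorem adj_holder {E : Type*} [NormedAddCommGroup E] [InnerProductSpace ℝ E] [FiniteDimensional ℝ E]
    {p W : E → E} {H : E → E →L[ℝ] E} {κ : E → ℝ} {α ε lam L B N Wb CW Kb CK : ℝ} (hα : 0 < α) (hα1 : α < 1)
    (hε : 0 < ε) (hlam : lam ∈ Icc (0:ℝ) 1) (hN : 0 ≤ N) (hCW : 0 ≤ CW) (hCK : 0 ≤ CK) (hp : ∀ x, ‖p x‖ ≤ L) (hB : ∀ x, ‖H x‖ ≤ B)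
    (hpl : ∀ x y, ‖p x - p y‖ ≤ B * ‖x - y‖) (hH : ∀ x y, ‖H x - H y‖ ≤ N * ‖x - y‖ ^ α)
    (hW : ∀ x, ‖W x‖ ≤ Wb) (hWh : ∀ x y, ‖W x - W y‖ ≤ CW * ‖x - y‖ ^ α) (hK : ∀ x, |κ x| ≤ Kb)
    (hKh : ∀ x y, |κ x - κ y| ≤ CK * ‖x - y‖ ^ α) :
    ∃ C, 0 ≤ C ∧ ∀ x y, ‖κ x • (ε • p x + ContinuousLinearMap.adjoint (H x) (p x) + lam • W x)
      - κ y • (ε • p y + ContinuousLinearMap.adjoint (H y) (p y) + lam • W y)‖ ≤ C * ‖x - y‖ ^ α := by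
  have hL0 : 0 ≤ L := (norm_nonneg _).trans (hp 0)
  have hB0 : 0 ≤ B := (norm_nonneg _).trans (hB 0)
  have hWb0 : 0 ≤ Wb := (norm_nonneg _).trans (hW 0)
  have hKb0 : 0 ≤ Kb := (abs_nonneg _).trans (hK 0)
  set D := (2 * L) ^ (1 - α) * B ^ α with hD
  have hD0 : 0 ≤ D := by positivity
  have hdp : ∀ x y, ‖p x - p y‖ ≤ D * ‖x - y‖ ^ α := fun x y => by
    have h1 := rpow_split (norm_nonneg (p x - p y)) ((norm_sub_le _ _).trans (by linarith [hp x, hp y] : _ ≤ 2 * L)) hα hα1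
    refine h1.trans ?_
    rw [hD, mul_assoc, ← Real.mul_rpow hB0 (norm_nonneg _)]
    exact mul_le_mul_of_nonneg_left (Real.rpow_le_rpow (norm_nonneg _) (hpl x y) hα.le) (by positivity)
  have hadj : ∀ A : E →L[ℝ] E, ‖ContinuousLinearMap.adjoint A‖ = ‖A‖ := fun A => LinearIsometryEquiv.norm_map _ _
  have hYb : ∀ x, ‖ε • p x + ContinuousLinearMap.adjoint (H x) (p x) + lam • W x‖ ≤ ε * L + B * L + Wb := fun x => by
    refine (norm_add_le _ _).trans (add_le_add ((norm_add_le _ _).trans (add_le_add ?_ ?_)) ?_)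
    · rw [norm_smul, Real.norm_of_nonneg hε.le]
      exact mul_le_mul_of_nonneg_left (hp x) hε.le
    · refine (ContinuousLinearMap.le_opNorm _ _).trans ?_
      rw [hadj]
      exact mul_le_mul (hB x) (hp x) (norm_nonneg _) hB0
    · rw [norm_smul, Real.norm_of_nonneg hlam.1]
      nlinarith only [hW x, norm_nonneg (W x), hlam.1, hlam.2]
  have hYh : ∀ x y, ‖(ε • p x + ContinuousLinearMap.adjoint (H x) (p x) + lam • W x)
      - (ε • p y + ContinuousLinearMap.adjoint (H y) (p y) + lam • W y)‖ ≤ (ε * D + N * L + B * D + CW) * ‖x - y‖ ^ α := fun x y => by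
    have e : (ε • p x + ContinuousLinearMap.adjoint (H x) (p x) + lam • W x)
      - (ε • p y + ContinuousLinearMap.adjoint (H y) (p y) + lam • W y)
      = ε • (p x - p y) + ContinuousLinearMap.adjoint (H x - H y) (p x) + ContinuousLinearMap.adjoint (H y) (p x - p y) + lam • (W x - W y) := by
      simp only [map_sub, sub_apply, smul_sub]
      abel
    rw [e, add_mul, add_mul, add_mul]
    have hX : 0 ≤ ‖x - y‖ ^ α := by positivity
    refine (norm_add_le _ _).trans (add_le_add ((norm_add_le _ _).trans (add_le_add ((norm_add_le _ _).trans (add_le_add ?_ ?_)) ?_)) ?_)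
    · rw [norm_smul, Real.norm_of_nonneg hε.le, mul_assoc]
      exact mul_le_mul_of_nonneg_left (hdp x y) hε.le
    · refine (ContinuousLinearMap.le_opNorm _ _).trans ?_
      rw [hadj, mul_right_comm]
      exact mul_le_mul (hH x y) (hp x) (norm_nonneg _) (by positivity)
    · refine (ContinuousLinearMap.le_opNorm _ _).trans ?_
      rw [hadj, mul_assoc]
      exact mul_le_mul (hB y) (hdp x y) (norm_nonneg _) hB0
    · rw [norm_smul, Real.norm_of_nonneg hlam.1]
      nlinarith only [hWh x y, norm_nonneg (W x - W y), hlam.1, hlam.2]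
  refine ⟨CK * (ε * L + B * L + Wb) + Kb * (ε * D + N * L + B * D + CW), by positivity, fun x y => ?_⟩
  have h1 := hYb x
  have h2 := hYh x y
  set Yx := ε • p x + ContinuousLinearMap.adjoint (H x) (p x) + lam • W x
  set Yy := ε • p y + ContinuousLinearMap.adjoint (H y) (p y) + lam • W y
  have e : κ x • Yx - κ y • Yy = (κ x - κ y) • Yx + κ y • (Yx - Yy) := by
    rw [sub_smul, smul_sub]; abel
  rw [e]
  refine (norm_add_le _ _).trans ?_
  rw [norm_smul, norm_smul, Real.norm_eq_abs, Real.norm_eq_abs]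
  have h3 : |κ x - κ y| * ‖Yx‖ ≤ CK * ‖x - y‖ ^ α * (ε * L + B * L + Wb) := mul_le_mul (hKh x y) h1 (norm_nonneg _) (by positivity)
  have h4 : |κ y| * ‖Yx - Yy‖ ≤ Kb * ((ε * D + N * L + B * D + CW) * ‖x - y‖ ^ α) := mul_le_mul (hK y) h2 (norm_nonneg _) hKb0
  linarith only [h3, h4]

end Coef

open MeasureTheory Set
set_option linter.unusedSectionVars false

section Core
open Filter Topology RealInnerProductSpace

set_option maxHeartbeats 1000000 in
theorem core {d : ℕ} {α : ℝ} (hα : 0 < α) (hα1 : α < 1) {g : ℝ → ℝ} (hg : Ghyp α g) (hA2 : A2 g) {ε : ℝ} (hε : 0 < ε)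
    {V : EuclideanSpace ℝ (Fin d) → ℝ} {W : EuclideanSpace ℝ (Fin d) → EuclideanSpace ℝ (Fin d)}
    (hV : ∀ x, HasFDerivAt V (innerSL ℝ (W x)) x) {Wb CW osc vb z0 : ℝ} (hW : ∀ x, ‖W x‖ ≤ Wb) (hCW : 0 ≤ CW)
    (hWh : ∀ x y, ‖W x - W y‖ ≤ CW * ‖x - y‖ ^ α)
    (hosc : ∀ x y, V x - V y ≤ osc) (hvb : ∀ x, |V x| ≤ vb) (hz0 : 0 < z0) (hgz : g z0 = g 1 - osc)
    {lamseq : ℕ → ℝ} (hmem : ∀ n, lamseq n ∈ Icc (0 : ℝ) 1) {lam : ℝ} (hlam : lam ∈ Icc (0:ℝ) 1)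
    (hconv : Tendsto lamseq atTop (𝓝 lam))
    {u : ℕ → EuclideanSpace ℝ (Fin d) → ℝ} {p : ℕ → EuclideanSpace ℝ (Fin d) → EuclideanSpace ℝ (Fin d)}
    {H : ℕ → EuclideanSpace ℝ (Fin d) → EuclideanSpace ℝ (Fin d) →L[ℝ] EuclideanSpace ℝ (Fin d)}
    {m : ℕ → EuclideanSpace ℝ (Fin d) → ℝ} {q : ℕ → EuclideanSpace ℝ (Fin d) → EuclideanSpace ℝ (Fin d)}
    (h : ∀ n, ES α g (fun x => lamseq n * V x) ε (u n) (p n) (H n) (m n) (q n)) :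
    ∃ (u : EuclideanSpace ℝ (Fin d) → ℝ) (p : EuclideanSpace ℝ (Fin d) → EuclideanSpace ℝ (Fin d))
    (H : EuclideanSpace ℝ (Fin d) → EuclideanSpace ℝ (Fin d) →L[ℝ] EuclideanSpace ℝ (Fin d))
    (m : EuclideanSpace ℝ (Fin d) → ℝ) (q : EuclideanSpace ℝ (Fin d) → EuclideanSpace ℝ (Fin d)),
      ES α g (fun x => lam * V x) ε u p H m q := by
  have hp : ∀ z, 0 < z → 0 < deriv g z := fun z hz => A2_pos hA2 hz
  have hvb0 : 0 ≤ vb := (abs_nonneg _).trans (hvb 0)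
  have hWb0 : 0 ≤ Wb := (norm_nonneg _).trans (hW 0)
  set B0 := |g 1| + vb with hB0
  have hB00 : 0 ≤ B0 := by positivity
  have hmlow : ∀ n x, z0 ≤ m n x := fun n => ((h n).bounds hg (hmem n) hε hosc hvb hz0 hgz).1
  have hub : ∀ n x, |ε * u n x| ≤ B0 := fun n => ((h n).bounds hg (hmem n) hε hosc hvb hz0 hgz).2
  set L := 2 * B0 / ε + 2 * (ε / z0 + ε + Wb) + 2 with hL
  have hL0 : 0 ≤ L := by positivity
  have hpL : ∀ n x, ‖p n x‖ ≤ L := fun n x => (h n).lip hV hg hp (hmem n) hε hW hz0 (hmlow n) (hub n) x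
  have hlv : ∀ n x, |lamseq n * V x| ≤ vb := fun n x => by
    rw [abs_mul, abs_of_nonneg (hmem n).1]
    nlinarith only [hvb x, abs_nonneg (V x), (hmem n).1, (hmem n).2]
  obtain ⟨M, hM1, hMg⟩ := g_unbdd hg hA2 (B0 + vb + L ^ 2 / 2)
  have hmup : ∀ n x, m n x ≤ M := fun n x => by
    have hj := (h n).hj x
    have h1 : g (m n x) ≤ g M := by
      rw [← hj]
      have a1 := (abs_le.1 (hub n x)).2
      have a2 := (abs_le.1 (hlv n x)).2
      have a3 : ‖p n x‖ ^ 2 ≤ L ^ 2 := pow_le_pow_left₀ (norm_nonneg _) (hpL n x) 2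
      linarith only [a1, a2, a3, hMg]
    exact (hg.1.le_iff_le ((h n).mpos x).le (zero_le_one.trans hM1)).1 h1
  have hz0M : z0 ≤ M := (hmlow 0 0).trans (hmup 0 0)
  have ha : 0 < z0 / 2 := by positivity
  have hab : z0 / 2 < M + 1 := by linarith
  obtain ⟨G, hG1, hG2, hG3, hG4, CG, hCG, hGl⟩ := g_inv hα hg hp ha hab
  obtain ⟨σ, S, CS, Bb, CB, Kb, CK, hCS, hCB, hCK, hS, hσ, hσ2, hb, hbh, hK, hKh⟩ := coef hα hα1 hg hp hε ha hab hG1 hCG hGl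
  have hmI : ∀ n x, m n x ∈ Icc (z0 / 2) (M + 1) := fun n x =>
    ⟨by linarith [hmlow n x], by linarith [hmup n x]⟩
  -- the equation for each solution
  set l : ℕ → EuclideanSpace ℝ (Fin d) → ℝ := fun n x => ε * u n x + lamseq n * V x with hl
  have hs : ∀ n x, l n x + ‖p n x‖ ^ 2 / 2 = g (m n x) := fun n x => by
    rw [← (h n).hj x]; simp only [hl]; ring
  have hGs : ∀ n x, G (l n x + ‖p n x‖ ^ 2 / 2) = m n x := fun n x => by
    rw [hs]; exact hG2 _ (hmI n x)
  have heq : ∀ n x, tr (H n x) + σ (l n x + ‖p n x‖ ^ 2 / 2) ^ 2 *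
      (⟪H n x (p n x), p n x⟫ + ε * ‖p n x‖ ^ 2 + ⟪lamseq n • W x, p n x⟫)
      = ε * (1 - 1 / G (l n x + ‖p n x‖ ^ 2 / 2)) := fun n x => by
    rw [hσ2, hGs]
    exact (h n).nondiv hV hg hp x
  have hVl : ∀ x y, |V x - V y| ≤ Wb * ‖x - y‖ := fun x y => by
    have := Convex.norm_image_sub_le_of_norm_hasFDerivWithin_le (𝕜 := ℝ) (f := V)
      (fun x _ => (hV x).hasFDerivWithinAt) (C := Wb) (s := Set.univ)
      (fun x _ => by simpa using hW x) convex_univ (mem_univ y) (mem_univ x)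
    simpa using this
  have hlb : ∀ n x, |l n x| ≤ B0 + vb := fun n x => (abs_add_le _ _).trans (add_le_add (hub n x) (hlv n x))
  have hll : ∀ n x y, |l n x - l n y| ≤ (ε * L + Wb) * ‖x - y‖ := fun n x y => by
    have e : l n x - l n y = ε * (u n x - u n y) + lamseq n * (V x - V y) := by simp only [hl]; ring
    rw [e, add_mul]
    refine (abs_add_le _ _).trans (add_le_add ?_ ?_)
    · rw [abs_mul, abs_of_pos hε, mul_assoc]
      exact mul_le_mul_of_nonneg_left ((h n).c2.lip (hpL n) x y) hε.le
    · rw [abs_mul, abs_of_nonneg (hmem n).1]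
      nlinarith only [hVl x y, abs_nonneg (V x - V y), (hmem n).1, (hmem n).2]
  have hw : ∀ n x, ‖lamseq n • W x‖ ≤ Wb := fun n x => by
    rw [norm_smul, Real.norm_of_nonneg (hmem n).1]
    nlinarith only [hW x, norm_nonneg (W x), (hmem n).1, (hmem n).2]
  have hwh : ∀ n x y, ‖lamseq n • W x - lamseq n • W y‖ ≤ CW * ‖x - y‖ ^ α := fun n x y => by
    rw [← smul_sub, norm_smul, Real.norm_of_nonneg (hmem n).1]
    nlinarith only [hWh x y, norm_nonneg (W x - W y), (hmem n).1, (hmem n).2]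
  have hΛ : 0 ≤ ε * L + Wb := by positivity
  have hSS := fun n => mk_SS hα hα1 hΛ hε hS hCS hσ hCB hb hbh (h n).c2 (hpL n) (hlb n) (hll n) (hw n) hCW (hwh n) (heq n)
  have hBb0 : 0 ≤ Bb := (abs_nonneg _).trans (hb 0)
  have hS0 : 0 ≤ S := (abs_nonneg _).trans (hS 0)
  obtain ⟨N, hN0, hN⟩ := apriori (E := EuclideanSpace ℝ (Fin d)) (σ := σ) (L := L) (lb := B0 + vb) (Λ := ε * L + Wb)
    (Fb := Bb + S ^ 2 * (ε * L ^ 2 + Wb * L))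
    (Cf := CB * ((ε * L + Wb) ^ α + L ^ α) + 2 * S * CS * ((ε * L + Wb) ^ α + L ^ α) * (ε * L ^ 2 + Wb * L)
        + S ^ 2 * ((2 * ε * L + Wb) * (2 * L) ^ (1 - α) + CW * L)) hα hα1 (by positivity) hΛ (by positivity) hS hCS hσ
  have hHN : ∀ n x y, ‖H n x - H n y‖ ≤ N * ‖x - y‖ ^ α := fun n => by
    obtain ⟨C, -, hC⟩ := (h n).hH
    exact hN _ _ _ _ _ (hSS n) ⟨C, hC⟩
  have hHB : ∀ n x, ‖H n x‖ ≤ 2 * L + N := fun n x => (h n).c2.hess_bdK hα hN0 (hpL n) (hHN n) x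
  have hu0 : ∀ n, |u n 0| ≤ B0 / ε := fun n => by
    rw [le_div_iff₀ hε]
    have := hub n 0
    rw [abs_mul, abs_of_pos hε] at this
    linarith
  -- the limit
  set U : Ultrafilter ℕ := Filter.hyperfilter ℕ with hU
  obtain ⟨v, P, K, hc2, tv, tP, tK⟩ := ulim_C2 U hα hN0 (fun n => (h n).c2) hu0 hpL hHB hHN
  have tlam : Tendsto lamseq U (𝓝 lam) := hconv.mono_left Nat.hyperfilter_le_atTop
  set s0 : EuclideanSpace ℝ (Fin d) → ℝ := fun x => ε * v x + ‖P x‖ ^ 2 / 2 + lam * V x with hs0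
  have ts : ∀ x, Tendsto (fun n => l n x + ‖p n x‖ ^ 2 / 2) U (𝓝 (s0 x)) := fun x => by
    have h1 := (((tv x).const_mul ε).add (((tP x).norm.pow 2).div_const 2)).add (tlam.mul_const (V x))
    refine h1.congr fun n => ?_
    simp only [hl]; ring
  have hPL : ∀ x, ‖P x‖ ≤ L := fun x => le_of_tendsto (tP x).norm (Eventually.of_forall fun n => hpL n x)
  have hKB : ∀ x, ‖K x‖ ≤ 2 * L + N := fun x => le_of_tendsto (tK x).norm (Eventually.of_forall fun n => hHB n x)
  have hKN : ∀ x y, ‖K x - K y‖ ≤ N * ‖x - y‖ ^ α := fun x y =>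
    le_of_tendsto ((tK x).sub (tK y)).norm (Eventually.of_forall fun n => hHN n x y)
  have hs0I : ∀ x, s0 x ∈ Ioo (g (z0 / 2)) (g (M + 1)) := fun x => by
    have h1 : g z0 ≤ s0 x := ge_of_tendsto (ts x) (Eventually.of_forall fun n => by
      rw [hs]; exact hg.1.monotoneOn hz0.le ((h n).mpos x).le (hmlow n x))
    have h2 : s0 x ≤ g M := le_of_tendsto (ts x) (Eventually.of_forall fun n => by
      rw [hs]; exact hg.1.monotoneOn ((h n).mpos x).le (zero_le_one.trans hM1) (hmup n x))
    have h3 : g (z0 / 2) < g z0 := hg.1 ha.le hz0.le (by linarith)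
    have h4 : g M < g (M + 1) := hg.1 (show (0:ℝ) ≤ M by linarith) (show (0:ℝ) ≤ M + 1 by linarith) (by linarith)
    exact ⟨h3.trans_le h1, h2.trans_lt h4⟩
  have hGc : Continuous G := by
    refine continuous_iff_continuousAt.2 fun t => ?_
    exact (LipschitzWith.of_dist_le_mul (K := ⟨CG, hCG⟩) (fun a b => by
      rw [Real.dist_eq, Real.dist_eq]; exact hGl a b)).continuous.continuousAt
  have hσc : Continuous σ := holder_cont hα hσ
  have hbc : Continuous (fun s => ε * (1 - 1 / G s)) := holder_cont hα hbh
  have tm : ∀ x, Tendsto (fun n => m n x) U (𝓝 (G (s0 x))) := fun x => by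
    have := (hGc.tendsto _).comp (ts x)
    refine this.congr fun n => ?_
    exact hGs n x
  have hGpos : ∀ s, 0 < G s := fun s => ha.trans_le (hG1 s).1
  have hlim : ∀ x, tr (K x) + σ (s0 x) ^ 2 * (⟪K x (P x), P x⟫ + ε * ‖P x‖ ^ 2 + ⟪lam • W x, P x⟫)
      = ε * (1 - 1 / G (s0 x)) := fun x => by
    have t1 : Tendsto (fun n => tr (H n x)) U (𝓝 (tr (K x))) := (tr_continuous.tendsto _).comp (tK x)
    have t2 : Tendsto (fun n => σ (l n x + ‖p n x‖ ^ 2 / 2)) U (𝓝 (σ (s0 x))) := (hσc.tendsto _).comp (ts x)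
    have t3 : Tendsto (fun n => H n x (p n x)) U (𝓝 (K x (P x))) := 
      ((isBoundedBilinearMap_apply (𝕜 := ℝ)).continuous.tendsto (K x, P x)).comp ((tK x).prodMk_nhds (tP x))
    have t4 := t1.add ((t2.pow 2).mul (((t3.inner (𝕜 := ℝ) (tP x)).add (((tP x).norm.pow 2).const_mul ε)).add
      ((tlam.smul_const (W x)).inner (𝕜 := ℝ) (tP x))))
    have t5 : Tendsto (fun n => ε * (1 - 1 / G (l n x + ‖p n x‖ ^ 2 / 2))) U (𝓝 (ε * (1 - 1 / G (s0 x)))) :=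
      (hbc.tendsto _).comp (ts x)
    exact tendsto_nhds_unique (t4.congr fun n => heq n x) t5
  have hκh : ∃ C, 0 ≤ C ∧ ∀ x y, |1 / deriv g (G (s0 x)) - 1 / deriv g (G (s0 y))| ≤ C * ‖x - y‖ ^ α := by
    have hl0 : ∀ x y, |(ε * v x + lam * V x) - (ε * v y + lam * V y)| ≤ (ε * L + Wb) * ‖x - y‖ := fun x y => by
      have e : (ε * v x + lam * V x) - (ε * v y + lam * V y) = ε * (v x - v y) + lam * (V x - V y) := by ring
      rw [e, add_mul]
      refine (abs_add_le _ _).trans (add_le_add ?_ ?_)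
      · rw [abs_mul, abs_of_pos hε, mul_assoc]
        exact mul_le_mul_of_nonneg_left (hc2.lip hPL x y) hε.le
      · rw [abs_mul, abs_of_nonneg hlam.1]
        nlinarith only [hVl x y, abs_nonneg (V x - V y), hlam.1, hlam.2]
    have hB' : 0 ≤ 2 * L + N := by positivity
    refine ⟨CK * (((ε * L + Wb) ^ α + L ^ α) * (1 + (2 * L + N) ^ α)), by positivity, fun x y => ?_⟩
    refine (hKh _ _).trans ?_
    rw [mul_assoc]
    refine mul_le_mul_of_nonneg_left ?_ hCK
    have h1 := s_holder hα hα1 hΛ hPL hl0 x y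
    have e : s0 x - s0 y = (ε * v x + lam * V x + ‖P x‖ ^ 2 / 2) - (ε * v y + lam * V y + ‖P y‖ ^ 2 / 2) := by
      simp only [hs0]; ring
    rw [e]
    refine h1.trans ?_
    rw [mul_assoc]
    refine mul_le_mul_of_nonneg_left ?_ (by positivity)
    have h2 := Real.rpow_le_rpow (norm_nonneg _) (hc2.lipp hKB x y) hα.le
    rw [Real.mul_rpow hB' (norm_nonneg _)] at h2
    linarith only [h2]
  obtain ⟨Cκ, hCκ, hκ⟩ := hκh
  refine ⟨v, P, K, fun x => G (s0 x), fun x => (1 / deriv g (G (s0 x))) •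
    (ε • P x + ContinuousLinearMap.adjoint (K x) (P x) + lam • W x), hc2, ⟨N, hN0, hKN⟩, fun x => ?_, ?_, fun x => hGpos _,
    fun x => ?_, fun x => ?_, fun k x => ?_, fun k x => ?_⟩
  · have h1 := (hG4 _ (hs0I x)).comp_hasFDerivAt x (s_hasFDerivAt hc2 hV ε lam x)
    refine h1.congr_fderiv ?_
    ext a
    simp only [smul_apply, innerSL_apply_apply, real_inner_smul_left, smul_eq_mul]
  · exact adj_holder hα hα1 hε hlam hN0 hCW hCκ hPL hKB (fun x y => hc2.lipp hKB x y) hKN hW hWh (fun x => hK _) hκ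
  · exact (hG3 _ (Ioo_subset_Icc_self (hs0I x))).symm
  · have h1 := hlim x
    rw [hσ2, real_inner_smul_left] at h1
    have h2 : ⟪(1 / deriv g (G (s0 x))) • (ε • P x + ContinuousLinearMap.adjoint (K x) (P x) + lam • W x), P x⟫
        = 1 / deriv g (G (s0 x)) * (⟪K x (P x), P x⟫ + ε * ‖P x‖ ^ 2 + lam * ⟪W x, P x⟫) := by
      rw [real_inner_smul_left, inner_add_left, inner_add_left, real_inner_smul_left, real_inner_smul_left,
        ContinuousLinearMap.adjoint_inner_left, real_inner_self_eq_norm_sq, real_inner_comm (P x) (K x (P x))]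
      ring
    have hm := hGpos (s0 x)
    have hd := hp _ hm
    rw [h2]
    set X := ⟪K x (P x), P x⟫ + ε * ‖P x‖ ^ 2 + lam * ⟪W x, P x⟫
    have h3 : G (s0 x) * (tr (K x) + 1 / (G (s0 x) * deriv g (G (s0 x))) * X) = G (s0 x) * (ε * (1 - 1 / G (s0 x))) := by rw [h1]
    have h4 : G (s0 x) * (tr (K x) + 1 / (G (s0 x) * deriv g (G (s0 x))) * X) = G (s0 x) * tr (K x) + 1 / deriv g (G (s0 x)) * X := by
      field_simp
    have h5 : G (s0 x) * (ε * (1 - 1 / G (s0 x))) = ε * G (s0 x) - ε := by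
      field_simp
    linarith only [h3, h4, h5]
  · refine tendsto_nhds_unique (tv _) ((tv x).congr fun n => ?_)
    exact ((h n).peru k x).symm
  · refine tendsto_nhds_unique (tm _) ((tm x).congr fun n => ?_)
    exact ((h n).perm k x).symm

end Core

open MeasureTheory Set
set_option linter.unusedSectionVars false

section Fin
open Filter Topology RealInnerProductSpace

theorem V_facts {d : ℕ} {α : ℝ} (hα : 0 < α) {V : (Fin d → ℝ) → ℝ} (hV : Vhyp d α V) :
    (∀ x, HasFDerivAt (fun x : EuclideanSpace ℝ (Fin d) => V (WithLp.ofLp x)) (innerSL ℝ (gradE d V x)) x) ∧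
    (∀ x y : EuclideanSpace ℝ (Fin d), V (WithLp.ofLp x) - V (WithLp.ofLp y) ≤ oscV d V) ∧
    (∃ vb, ∀ x : EuclideanSpace ℝ (Fin d), |V (WithLp.ofLp x)| ≤ vb) ∧
    (∃ Wb, ∀ x, ‖gradE d V x‖ ≤ Wb) ∧
    (∃ CW, 0 ≤ CW ∧ ∀ x y, ‖gradE d V x - gradE d V y‖ ≤ CW * ‖x - y‖ ^ α) := by
  obtain ⟨hper, hc, hh⟩ := hV
  have h1 : ∀ x, HasFDerivAt (fun x : EuclideanSpace ℝ (Fin d) => V (WithLp.ofLp x)) (innerSL ℝ (gradE d V x)) x :=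
    fun x => gradE_hasFDerivAt (hc.differentiable (by norm_num)) x
  have hcomp : IsCompact (V '' Icc (0 : Fin d → ℝ) 1) := isCompact_Icc.image hc.continuous
  have hmemI : ∀ x : EuclideanSpace ℝ (Fin d), V (WithLp.ofLp x) ∈ V '' Icc (0 : Fin d → ℝ) 1 := fun x => by
    obtain ⟨k, y, hy, hxy⟩ := per_cover x
    refine ⟨y, hy, ?_⟩
    have h2 : y = WithLp.ofLp x + fun i => (k i : ℝ) := congrArg WithLp.ofLp hxy
    rw [h2, hper]
  have hvb : ∃ vb, ∀ x : EuclideanSpace ℝ (Fin d), |V (WithLp.ofLp x)| ≤ vb := by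
    obtain ⟨C, hC⟩ := hcomp.isBounded.exists_norm_le
    exact ⟨C, fun x => hC _ (hmemI x)⟩
  have hW := gradE_holder hα hh
  refine ⟨h1, fun x y => ?_, hvb, ?_, hW⟩
  · exact sub_le_sub (le_csSup hcomp.bddAbove (hmemI x)) (csInf_le hcomp.bddBelow (hmemI y))
  · obtain ⟨vb, hvb⟩ := hvb
    obtain ⟨C, hC0, hC⟩ := hW
    have hvb0 : 0 ≤ vb := (abs_nonneg _).trans (hvb 0)
    refine ⟨2 * vb + C, fun x => ?_⟩
    rw [← innerSL_apply_norm (𝕜 := ℝ) (gradE d V x)]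
    refine ContinuousLinearMap.opNorm_le_of_unit_norm (by positivity) ?_
    intro a ha
    have := taylor_bd hα hC0 h1 (fun x y => by
      rw [← map_sub, innerSL_apply_norm]; exact hC x y) x (x + a)
    simp only [add_sub_cancel_left, ha, Real.one_rpow, mul_one, Real.norm_eq_abs] at this
    rw [Real.norm_eq_abs]
    have a1 := abs_le.1 this
    have a2 := abs_le.1 (hvb x)
    have a3 := abs_le.1 (hvb (x + a))
    rw [abs_le]
    constructor <;> linarith only [a1.1, a1.2, a2.1, a2.2, a3.1, a3.2]

end Fin

theorem stmt14 (d : ℕ) (α : ℝ) (hα0 : 0 < α) (hα1 : α < 1)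
    (g : ℝ → ℝ) (V : (Fin d → ℝ) → ℝ) (hg : Ghyp α g) (hV : Vhyp d α V)
    (hA1 : A1 d g V) (hA2 : A2 g) (ε : ℝ) (hε : 0 < ε)
    (lamseq : ℕ → ℝ) (hmem : ∀ n, lamseq n ∈ Icc (0 : ℝ) 1)
    (hin : ∀ n, InLambda d α g V ε (lamseq n))
    (lam : ℝ) (hlam : lam ∈ Icc (0 : ℝ) 1)
    (hconv : Filter.Tendsto lamseq Filter.atTop (nhds lam)) :
    InLambda d α g V ε lam := by
  obtain ⟨h1, h2, ⟨vb, h3⟩, ⟨Wb, h4⟩, CW, h5, h6⟩ := V_facts hα0 hV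
  obtain ⟨z0, hz0, hgz⟩ := hA1
  choose u m hsol hpos using hin
  have hES := fun n => ES_of_DiscSol hα0 (hsol n) (hpos n)
  obtain ⟨v, p, H, μ, q, h⟩ := core hα0 hα1 hg hA2 hε h1 h4 h5 h6 h2 h3 hz0 hgz hmem hlam hconv hES
  exact ⟨_, _, DiscSol_of_ES (V := fun x => lam * V x) hα0 h, fun x => h.mpos _⟩
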